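/- The infinite time reducibility relation on reals, {(x,y) ∈ 2^ℕ × 2^ℕ : x = φ_p^y(0) for some program p}, is infinite time semi-decidable but not infinite time decidable. -/

import Mathlib

open scoped Classical

namespace ITTM

/-- A real is an element of Cantor space. -/
abbrev R := ℕ → Bool

/-- The constant-zero real. -/
def zeroR : R := fun _ => false

/-- The real ⟨1,0,0,...⟩ coding the answer "Yes". -/
def oneR : R := fun n => decide (n = 0)

/-- The real coding a natural number `p`: `p` ones followed by zeros. -/
def natR (p : ℕ) : R := fun n => decide (n < p)

/-- The real coding the pair of reals `(y, z)`. -/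
def pairR (y z : R) : R := fun n => if n % 2 = 0 then y (n / 2) else z (n / 2)

/-- A snapshot of an infinite time Turing machine computation with state set
`Fin (Q+1)`: the current state, the head position, and the contents of the
three tapes (tape 0 is the input tape, tape 1 the scratch tape, tape 2 the
output tape); cells hold values in `Bool` (`true` = 1, `false` = 0). -/
structure Snapshot (Q : ℕ) where
  state : Fin (Q + 1)
  head : ℕ
  tape : Fin 3 → ℕ → Bool

/-- An infinite time Turing machine program: a finite set of states
`Fin (Q+1)` with distinguished start, limit and halt states, and a finite
transition table which, given the current state and the three cell values
read by the head, specifies the next state, the three values to write, and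
the direction to move (`true` = right, `false` = left). -/
structure Machine where
  Q : ℕ
  start : Fin (Q + 1)
  limit : Fin (Q + 1)
  halt : Fin (Q + 1)
  trans : Fin (Q + 1) × (Fin 3 → Bool) → Fin (Q + 1) × (Fin 3 → Bool) × Bool

instance : Inhabited Machine := ⟨⟨0, 0, 0, 0, fun _ => (0, fun _ => false, true)⟩⟩

namespace Machine

/-- The initial snapshot on input `x`: head on cell 0 in the start state, `x`
on the input tape, the other tapes filled with zeros. -/
def init (M : Machine) (x : R) : Snapshot M.Q where
  state := M.start
  head := 0
  tape := fun i n => if i = 0 then x n else false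

/-- One step of computation applied to a snapshot. -/
def stepSnap (M : Machine) (s : Snapshot M.Q) : Snapshot M.Q :=
  let t := M.trans (s.state, fun i => s.tape i s.head)
  { state := t.1
    head := if t.2.2 then s.head + 1 else s.head - 1
    tape := fun i n => if n = s.head then t.2.1 i else s.tape i n }

/-- The snapshot of the computation of machine `M` on input `x` at ordinal
stage `α`, defined by transfinite recursion: at stage 0 the initial snapshot,
at successor stages the transition table is applied, and at limit stages the
head is on cell 0 in the limit state and each cell holds the `limsup` of its
earlier values (1 iff its value was 1 cofinally often below the limit). -/
noncomputable def snap (M : Machine) (x : R) : Ordinal.{0} → Snapshot M.Q :=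
  WellFounded.fix Ordinal.lt_wf fun α ih =>
    if _h0 : α = 0 then M.init x
    else if hs : ∃ β, β < α ∧ α = β + 1 then
      M.stepSnap (ih hs.choose hs.choose_spec.1)
    else
      { state := M.limit
        head := 0
        tape := fun i n =>
          decide (∀ β < α, ∃ γ, β ≤ γ ∧ ∃ hγ : γ < α, (ih γ hγ).tape i n = true) }

/-- The machine is in the halt state at stage `α`. -/
def haltedAt (M : Machine) (x : R) (α : Ordinal) : Prop :=
  (M.snap x α).state = M.halt

/-- The computation of `M` on input `x` halts exactly at stage `α`: stage `α`
is the first stage at which the machine is in the halt state. -/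
def haltsAt (M : Machine) (x : R) (α : Ordinal) : Prop :=
  M.haltedAt x α ∧ ∀ β < α, ¬ M.haltedAt x β

/-- The computation of `M` on input `x` halts. -/
def halts (M : Machine) (x : R) : Prop := ∃ α, M.haltedAt x α

/-- The computation of `M` on input `x` halts with output `y`: at the first
stage at which the machine is in the halt state, the output tape reads `y`. -/
def outputs (M : Machine) (x y : R) : Prop :=
  ∃ α, M.haltsAt x α ∧ (M.snap x α).tape 2 = y

end Machine

/-- Machines are coded by natural numbers. -/
noncomputable instance : Encodable Machine :=
  Encodable.ofEquiv
    (Σ Q : ℕ, (Fin (Q + 1) × Fin (Q + 1) × Fin (Q + 1)) ×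
      ((Fin (Q + 1) × (Fin 3 → Bool)) → Fin (Q + 1) × (Fin 3 → Bool) × Bool))
    { toFun := fun M => ⟨M.Q, (M.start, M.limit, M.halt), M.trans⟩
      invFun := fun s => ⟨s.1, s.2.1.1, s.2.1.2.1, s.2.1.2.2, s.2.2⟩
      left_inv := fun _ => rfl
      right_inv := fun _ => rfl }

/-- The machine coded by the natural number `p`; every natural number codes a
machine, and every machine is coded by some natural number. -/
noncomputable def prog (p : ℕ) : Machine :=
  ((Encodable.decode p : Option Machine)).getD default

/-- `φ_p(x)` halts with output `y`. -/
noncomputable def phiOutputs (p : ℕ) (x y : R) : Prop := (prog p).outputs x y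

/-- A set of reals is infinite time decidable when some machine, on any input
`x`, halts with output ⟨1,0,0,...⟩ if `x ∈ A` and output ⟨0,0,0,...⟩ if
`x ∉ A`. -/
def ITTMDecidable (A : Set R) : Prop :=
  ∃ M : Machine, ∀ x : R, (x ∈ A → M.outputs x oneR) ∧ (x ∉ A → M.outputs x zeroR)

/-- A set of reals is infinite time semi-decidable when it is the halting set
of some machine. -/
def ITTMSemiDecidable (A : Set R) : Prop :=
  ∃ M : Machine, A = {x : R | M.halts x}

/-- The binary relation on ℕ coded by the real `x`:
`n ◁ k ⟺ x(⟨n,k⟩) = 1` where `⟨·,·⟩` is the pairing function. -/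
def rel (x : R) (n k : ℕ) : Prop := x (Nat.pair n k) = true

/-- The field of the relation coded by `x`. -/
def field (x : R) : Set ℕ := {n | ∃ k, rel x n k ∨ rel x k n}

/-- The relation coded by `x`, restricted to its field. -/
def relOn (x : R) : field x → field x → Prop := fun a b => rel x a.1 b.1

/-- The real `x` codes a well-order of (a subset of) ℕ, namely its field. -/
def codesWellOrder (x : R) : Prop := IsWellOrder (field x) (relOn x)

/-- The set of reals coding well-orders. -/
def WO : Set R := {x | codesWellOrder x}

/-- The real `x` codes a well-order of order type `α`. -/
def codesOrdinal (x : R) (α : Ordinal) : Prop :=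
  ∃ h : codesWellOrder x, @Ordinal.type _ (relOn x) h = α

/-- An ordinal is clockable when some machine on input 0 halts exactly at
stage `α`. -/
def Clockable (α : Ordinal) : Prop := ∃ M : Machine, M.haltsAt zeroR α

/-- A real is writable when it is the output of some machine on input 0. -/
def WritableReal (x : R) : Prop := ∃ M : Machine, M.outputs zeroR x

/-- An ordinal is writable when some writable real codes a well-order of that
order type. -/
def WritableOrdinal (α : Ordinal) : Prop :=
  ∃ x : R, WritableReal x ∧ codesOrdinal x α

/-- A real is eventually writable when some machine on input 0 never halts,
but from some stage onward the content of its output tape is exactly `x`. -/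
def EventuallyWritableReal (x : R) : Prop :=
  ∃ M : Machine, ¬ M.halts zeroR ∧ ∃ α : Ordinal, ∀ β ≥ α, (M.snap zeroR β).tape 2 = x

/-- An ordinal is eventually writable when some eventually writable real codes
a well-order of that order type. -/
def EventuallyWritableOrdinal (α : Ordinal) : Prop :=
  ∃ x : R, EventuallyWritableReal x ∧ codesOrdinal x α

/-- A snapshot of an oracle computation: as before, but with a fourth
(read-only) oracle tape, tape 3. -/
structure OSnapshot (Q : ℕ) where
  state : Fin (Q + 1)
  head : ℕ
  tape : Fin 4 → ℕ → Bool

/-- An infinite time Turing machine program with an oracle tape: the head also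
reads the oracle tape cell, but can write only on tapes 0, 1, 2. -/
structure OMachine where
  Q : ℕ
  start : Fin (Q + 1)
  limit : Fin (Q + 1)
  halt : Fin (Q + 1)
  trans : Fin (Q + 1) × (Fin 4 → Bool) → Fin (Q + 1) × (Fin 3 → Bool) × Bool

namespace OMachine

/-- The initial snapshot with oracle `y` and input `x`. -/
def init (M : OMachine) (y x : R) : OSnapshot M.Q where
  state := M.start
  head := 0
  tape := fun i n => if i = 0 then x n else if i = 3 then y n else false

/-- One step of oracle computation: the oracle tape is read-only. -/
def stepSnap (M : OMachine) (s : OSnapshot M.Q) : OSnapshot M.Q :=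
  let t := M.trans (s.state, fun i => s.tape i s.head)
  { state := t.1
    head := if t.2.2 then s.head + 1 else s.head - 1
    tape := fun i n =>
      if h : (i : ℕ) < 3 then
        (if n = s.head then t.2.1 ⟨i, h⟩ else s.tape i n)
      else s.tape i n }

/-- The snapshot of the computation of oracle machine `M` with oracle `y` on
input `x` at ordinal stage `α` (limit stages via `limsup`, as before; the
oracle tape never changes). -/
noncomputable def snap (M : OMachine) (y x : R) : Ordinal.{0} → OSnapshot M.Q :=
  WellFounded.fix Ordinal.lt_wf fun α ih =>
    if _h0 : α = 0 then M.init y x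
    else if hs : ∃ β, β < α ∧ α = β + 1 then
      M.stepSnap (ih hs.choose hs.choose_spec.1)
    else
      { state := M.limit
        head := 0
        tape := fun i n =>
          decide (∀ β < α, ∃ γ, β ≤ γ ∧ ∃ hγ : γ < α, (ih γ hγ).tape i n = true) }

/-- The oracle machine is in the halt state at stage `α`. -/
def haltedAt (M : OMachine) (y x : R) (α : Ordinal) : Prop :=
  (M.snap y x α).state = M.halt

/-- The oracle computation halts exactly at stage `α`. -/
def haltsAt (M : OMachine) (y x : R) (α : Ordinal) : Prop :=
  M.haltedAt y x α ∧ ∀ β < α, ¬ M.haltedAt y x β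

/-- The oracle computation `φ_M^y(x)` halts. -/
def halts (M : OMachine) (y x : R) : Prop := ∃ α, M.haltedAt y x α

/-- `φ_M^y(x)` halts with output `z`. -/
def outputs (M : OMachine) (y x z : R) : Prop :=
  ∃ α, M.haltsAt y x α ∧ (M.snap y x α).tape 2 = z

end OMachine

end ITTM

namespace ITTM

/-- The first component of the pair coded by the real `w`. -/
def leftR (w : R) : R := fun n => w (2 * n)

/-- The second component of the pair coded by the real `w`. -/
def rightR (w : R) : R := fun n => w (2 * n + 1)

/-- The set of reals coding (via the pair coding `w(2n) = y(n)`,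
`w(2n+1) = z(n)`) the pairs in a set `A ⊆ 2^ℕ × 2^ℕ`; a set of pairs of reals
is called decidable (or semi-decidable) when this set of codes is. -/
def pairCodes (A : Set (R × R)) : Set R :=
  {w : R | (leftR w, rightR w) ∈ A}

/-- The infinite time reducibility relation on reals:
`x ≤∞ y` iff `x = φ_p^y(0)` for some oracle program `p`. -/
def reducibilityRel : Set (R × R) :=
  {q : R × R | ∃ M : OMachine, M.outputs q.2 zeroR q.1}

end ITTM

namespace ITTM

section Stages

theorem not_exists_succ_of_isSuccLimit {α : Ordinal.{0}} (h : Order.IsSuccLimit α) :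
    ¬ ∃ β, β < α ∧ α = β + 1 := by
  rintro ⟨β, hβ, rfl⟩
  have := h.succ_lt hβ
  rw [Order.succ_eq_add_one] at this
  exact lt_irrefl _ this

namespace Machine

theorem snap_zero (M : Machine) (x : R) : M.snap x 0 = M.init x := by
  rw [snap, WellFounded.fix_eq]; simp

theorem snap_succ (M : Machine) (x : R) (α : Ordinal) :
    M.snap x (α + 1) = M.stepSnap (M.snap x α) := by
  have hs : ∃ β, β < α + 1 ∧ α + 1 = β + 1 := ⟨α, lt_add_one α, rfl⟩
  have h := hs.choose_spec.2
  rw [snap, WellFounded.fix_eq, dif_neg (by simp), dif_pos hs]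
  have : hs.choose = α := (Order.add_one_inj.mp h).symm
  exact congrArg (fun β => M.stepSnap (M.snap x β)) this

theorem snap_limit (M : Machine) (x : R) {α : Ordinal} (h : Order.IsSuccLimit α) :
    M.snap x α = ⟨M.limit, 0, fun i n =>
      decide (∀ β < α, ∃ γ, β ≤ γ ∧ γ < α ∧ (M.snap x γ).tape i n = true)⟩ := by
  rw [snap, WellFounded.fix_eq, dif_neg (show ¬ α = 0 from h.ne_bot),
    dif_neg (not_exists_succ_of_isSuccLimit h)]
  simp only [exists_prop]

end Machine

namespace OMachine

theorem snap_zero (M : OMachine) (y x : R) : M.snap y x 0 = M.init y x := by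
  rw [snap, WellFounded.fix_eq]; simp

theorem snap_succ (M : OMachine) (y x : R) (α : Ordinal) :
    M.snap y x (α + 1) = M.stepSnap (M.snap y x α) := by
  have hs : ∃ β, β < α + 1 ∧ α + 1 = β + 1 := ⟨α, lt_add_one α, rfl⟩
  have h := hs.choose_spec.2
  rw [snap, WellFounded.fix_eq, dif_neg (by simp), dif_pos hs]
  have : hs.choose = α := (Order.add_one_inj.mp h).symm
  exact congrArg (fun β => M.stepSnap (M.snap y x β)) this

theorem snap_limit (M : OMachine) (y x : R) {α : Ordinal} (h : Order.IsSuccLimit α) :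
    M.snap y x α = ⟨M.limit, 0, fun i n =>
      decide (∀ β < α, ∃ γ, β ≤ γ ∧ γ < α ∧ (M.snap y x γ).tape i n = true)⟩ := by
  rw [snap, WellFounded.fix_eq, dif_neg (show ¬ α = 0 from h.ne_bot),
    dif_neg (not_exists_succ_of_isSuccLimit h)]
  simp only [exists_prop]

theorem snap_oracle (M : OMachine) (y x : R) (α : Ordinal) : (M.snap y x α).tape 3 = y := by
  induction α using Ordinal.limitRecOn with
  | zero => rw [snap_zero]; rfl
  | add_one α ih => rw [snap_succ]; funext n; simpa [stepSnap] using congrFun ih n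
  | limit α hα ih =>
    rw [snap_limit _ _ _ hα]
    funext n
    rw [Bool.eq_iff_iff, decide_eq_true_iff]
    constructor
    · intro h
      obtain ⟨γ, -, hγ, e⟩ := h 0 hα.bot_lt
      rwa [ih γ hγ] at e
    · intro h β hβ
      exact ⟨β, le_rfl, hβ, by rw [ih β hβ, h]⟩

end OMachine

end Stages

/-- A machine with a read-only input tape and two work tapes, whose start state is also its
limit state. -/
structure Core where
  S : Type
  fin : Fintype S
  start : S
  halt : S
  trans : S → Bool → Bool → Bool → S × Bool × Bool × Bool

/-- A configuration of a `Core` with state set `S`. -/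
structure Conf (S : Type) where
  st : S
  head : ℕ
  t1 : R
  t2 : R

namespace Core

/-- One step of computation with input `w`. -/
def step (K : Core) (w : R) (c : Conf K.S) : Conf K.S :=
  let t := K.trans c.st (w c.head) (c.t1 c.head) (c.t2 c.head)
  ⟨t.1, if t.2.2.2 then c.head + 1 else c.head - 1,
    fun n => if n = c.head then t.2.1 else c.t1 n,
    fun n => if n = c.head then t.2.2.1 else c.t2 n⟩

/-- The transfinite sequence `c` is the computation of `K` on input `w`. -/
structure IsRun (K : Core) (w : R) (c : Ordinal.{0} → Conf K.S) : Prop where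
  zero : c 0 = ⟨K.start, 0, zeroR, zeroR⟩
  succ : ∀ α, c (α + 1) = K.step w (c α)
  limit : ∀ α, Order.IsSuccLimit α → (c α).st = K.start ∧ (c α).head = 0 ∧
    ∀ n, (c α).t2 n = true ↔ ∀ β < α, ∃ γ, β ≤ γ ∧ γ < α ∧ (c γ).t2 n = true

theorem exists_equiv (K : Core) : ∃ Q : ℕ, Nonempty (K.S ≃ Fin (Q + 1)) := by
  have := K.fin
  have hpos : 0 < Fintype.card K.S := Fintype.card_pos_iff.mpr ⟨K.start⟩
  refine ⟨Fintype.card K.S - 1, ⟨(Fintype.equivFin K.S).trans (finCongr (by omega))⟩⟩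

/-- Every core is realised by a machine on three tapes. -/
theorem exists_machine (K : Core) : ∃ M : Machine, ∀ w, ∃ c, K.IsRun w c ∧
    ∀ α, (M.haltedAt w α ↔ (c α).st = K.halt) := by
  obtain ⟨Q, ⟨e⟩⟩ := K.exists_equiv
  let M : Machine := ⟨Q, e K.start, e K.start, e K.halt, fun p =>
    let t := K.trans (e.symm p.1) (p.2 0) (p.2 1) (p.2 2)
    (e t.1, ![p.2 0, t.2.1, t.2.2.1], t.2.2.2)⟩
  refine ⟨M, fun w => ?_⟩
  have h0 : ∀ α, (M.snap w α).tape 0 = w := by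
    intro α
    induction α using Ordinal.limitRecOn with
    | zero => rw [Machine.snap_zero]; rfl
    | add_one α ih =>
      rw [Machine.snap_succ]; funext n
      have := congrFun ih n
      simp only [Machine.stepSnap, M]
      split_ifs with h
      · subst h; simpa using this
      · exact this
    | limit α hα ih =>
      rw [Machine.snap_limit _ _ hα]
      funext n
      rw [Bool.eq_iff_iff, decide_eq_true_iff]
      constructor
      · intro h
        obtain ⟨γ, -, hγ, e⟩ := h 0 hα.bot_lt
        rwa [ih γ hγ] at e
      · intro h β hβ
        exact ⟨β, le_rfl, hβ, by rw [ih β hβ, h]⟩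
  refine ⟨fun α => ⟨e.symm (M.snap w α).state, (M.snap w α).head, (M.snap w α).tape 1,
    (M.snap w α).tape 2⟩, ⟨?_, ?_, ?_⟩, ?_⟩
  · simp [Machine.snap_zero, Machine.init, M]; rfl
  · intro α
    have := congrFun (h0 α) (M.snap w α).head
    simp only [Machine.snap_succ, Machine.stepSnap, step, M] at this ⊢
    simp [this]
  · intro α hα
    simp [Machine.snap_limit _ _ hα, M]
  · intro α
    simp [Machine.haltedAt, M, Equiv.symm_apply_eq]

/-- Every core is realised by an oracle machine that reads its input from the oracle tape. -/
theorem exists_omachine (K : Core) : ∃ M : OMachine, ∀ w, ∃ c, K.IsRun w c ∧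
    ∀ α, (M.haltedAt w zeroR α ↔ (c α).st = K.halt) ∧ (M.snap w zeroR α).tape 2 = (c α).t2 := by
  obtain ⟨Q, ⟨e⟩⟩ := K.exists_equiv
  let M : OMachine := ⟨Q, e K.start, e K.start, e K.halt, fun p =>
    let t := K.trans (e.symm p.1) (p.2 3) (p.2 1) (p.2 2)
    (e t.1, ![p.2 0, t.2.1, t.2.2.1], t.2.2.2)⟩
  refine ⟨M, fun w => ?_⟩
  have h0 : ∀ α, (M.snap w zeroR α).tape 3 = w := M.snap_oracle w zeroR
  refine ⟨fun α => ⟨e.symm (M.snap w zeroR α).state, (M.snap w zeroR α).head,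
    (M.snap w zeroR α).tape 1, (M.snap w zeroR α).tape 2⟩, ⟨?_, ?_, ?_⟩, ?_⟩
  · simp [OMachine.snap_zero, OMachine.init, M]
    rfl
  · intro α
    have := congrFun (h0 α) (M.snap w zeroR α).head
    simp only [OMachine.snap_succ, OMachine.stepSnap, step, M] at this ⊢
    simp [this]
  · intro α hα
    simp [OMachine.snap_limit _ _ _ hα, M]
  · intro α
    simp [OMachine.haltedAt, M, Equiv.symm_apply_eq]

end Core

namespace Core

/-- A finite computation path of `K` on input `w` that avoids the halting state before its end,
and along which the content of the second work tape satisfies `P`. -/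
inductive Path (K : Core) (w : R) (P : R → Prop) : Conf K.S → Conf K.S → Prop
  | refl (c) : Path K w P c c
  | head {c c'} : c.st ≠ K.halt → P c.t2 → Path K w P (K.step w c) c' → Path K w P c c'

namespace Path

variable {K : Core} {w : R} {P : R → Prop}

theorem trans {c₁ c₂ c₃ : Conf K.S} (h : Path K w P c₁ c₂) (h' : Path K w P c₂ c₃) :
    Path K w P c₁ c₃ := by
  induction h with
  | refl => exact h'
  | head a b _ ih => exact .head a b (ih h')

theorem mono {P' : R → Prop} (hP : ∀ y, P y → P' y) {c₁ c₂ : Conf K.S}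
    (h : Path K w P c₁ c₂) : Path K w P' c₁ c₂ := by
  induction h with
  | refl => exact .refl _
  | head a b _ ih => exact .head a (hP _ b) ih

theorem single {c₁ c₂ : Conf K.S} (h : c₁.st ≠ K.halt) (h' : P c₁.t2) (e : K.step w c₁ = c₂) :
    Path K w P c₁ c₂ := .head h h' (e ▸ .refl _)

theorem exists_iterate {c₁ c₂ : Conf K.S} (h : Path K w P c₁ c₂) :
    ∃ t, (K.step w)^[t] c₁ = c₂ ∧
      ∀ s < t, ((K.step w)^[s] c₁).st ≠ K.halt ∧ P ((K.step w)^[s] c₁).t2 := by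
  induction h with
  | refl => exact ⟨0, rfl, by simp⟩
  | head a b _ ih =>
    obtain ⟨t, ht, hs⟩ := ih
    refine ⟨t + 1, ht, fun s hst => ?_⟩
    cases s with
    | zero => exact ⟨a, b⟩
    | succ s => exact hs s (by omega)

end Path

end Core

/-- A machine whose head moves over blocks of `b` consecutive cells. -/
structure BlockMachine (b : ℕ) where
  Q : Type
  fin : Fintype Q
  qlim : Q
  qhalt : Q
  trans : Q → (Fin b → Bool × Bool × Bool) → Q × (Fin b → Bool × Bool) × Bool

namespace BlockMachine

variable {b : ℕ} (T : BlockMachine b)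

/-- Physical states: reading a block from left to right, writing it from right to left, and
moving on to the next block. -/
abbrev PState (Q : Type) (b : ℕ) : Type :=
  (Q × Fin (b + 1) × (Fin b → Bool × Bool × Bool)) ⊕
    (Q × Bool × Fin (b + 1) × (Fin b → Bool × Bool)) ⊕ (Q × Fin (b + 1) × Bool)

/-- The physical state beginning the treatment of a block in state `q`. -/
def atState {Q : Type} (b : ℕ) (q : Q) : PState Q b := .inl (q, 0, fun _ => (false, false, false))

/-- The physical state with `k` moves left to do. -/
noncomputable def moveState {Q : Type} {b : ℕ} (q : Q) (k : Fin (b + 1)) (d : Bool) : PState Q b :=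
  if k = 0 then atState b q else .inr (.inr (q, k, d))

/-- The core simulating `T` cell by cell. -/
noncomputable def core : Core where
  S := PState T.Q b
  fin := by
    have := T.fin
    infer_instance
  start := atState b T.qlim
  halt := atState b T.qhalt
  trans := fun s x y z =>
    match s with
    | .inl (q, i, buf) =>
      let buf' : Fin b → Bool × Bool × Bool := fun j => if (j : ℕ) = i then (x, y, z) else buf j
      if (i : ℕ) + 1 < b then (.inl (q, i + 1, buf'), y, z, true)
      else
        let t := T.trans q buf'
        (.inr (.inl (t.1, t.2.2, Fin.last b, t.2.1)), y, z, true)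
    | .inr (.inl (q, d, i, out)) =>
      let o := if h : (i : ℕ) < b then out ⟨i, h⟩ else (y, z)
      if (i : ℕ) = 0 then (moveState q (Fin.last b - 1) d, o.1, o.2, d)
      else (.inr (.inl (q, d, i - 1, out)), o.1, o.2, false)
    | .inr (.inr (q, k, d)) => (moveState q (k - 1) d, y, z, d)

/-- The content of a tape after rewriting block `n`. -/
noncomputable def update (n : ℕ) (out : Fin b → Bool) (t : R) : R := fun p =>
  if h : b * n ≤ p ∧ p - b * n < b then out ⟨p - b * n, h.2⟩ else t p

/-- The content of a tape after rewriting block `n` from offset `i` on. -/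
noncomputable def updateFrom (n i : ℕ) (out : Fin b → Bool) (t : R) : R := fun p =>
  if h : b * n ≤ p ∧ p - b * n < b ∧ i ≤ p - b * n then out ⟨p - b * n, h.2.1⟩ else t p

theorem path_move {w : R} {P : R → Prop} {q : T.Q} {d : Bool} {t₁ t₂ : R} (hP : P t₂) (k : ℕ)
    (hk : k < b + 1) (hd : ℕ) :
    T.core.Path w P ⟨moveState q ⟨k, hk⟩ d, hd, t₁, t₂⟩
      ⟨atState b q, if d then hd + k else hd - k, t₁, t₂⟩ := by
  induction k generalizing hd with
  | zero =>
    simp only [moveState]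
    simpa using Core.Path.refl _
  | succ k ih =>
    have e : moveState (b := b) q ⟨k + 1, hk⟩ d = .inr (.inr (q, ⟨k + 1, hk⟩, d)) := by
      rw [moveState, if_neg]; simp [Fin.ext_iff]
    rw [e]
    refine .head ?_ hP ?_
    · simp [core, atState]
    · have e' : (⟨k + 1, hk⟩ : Fin (b + 1)) - 1 = ⟨k, by omega⟩ := by
        rw [sub_eq_iff_eq_add, Fin.ext_iff, Fin.val_add]
        simp only [Fin.val_one', Nat.add_mod_mod]
        rw [Nat.mod_eq_of_lt hk]
      have : T.core.step w ⟨.inr (.inr (q, ⟨k + 1, hk⟩, d)), hd, t₁, t₂⟩ =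
          ⟨moveState q ⟨k, by omega⟩ d, if d then hd + 1 else hd - 1, t₁, t₂⟩ := by
        simp only [Core.step, core, e']
        congr 1 <;> (funext n; split_ifs with h <;> simp_all)
      rw [this]
      convert ih (by omega) (if d then hd + 1 else hd - 1) using 2
      cases d <;> simp <;> omega

theorem path_write {w : R} {q : T.Q} {d : Bool} {t₁ t₂ : R} {n : ℕ} (hb : 0 < b)
    (out : Fin b → Bool × Bool) (i : ℕ) (hi : i < b + 1) :
    T.core.Path w (fun y => ∀ p, y p = t₂ p ∨ y p = update n (fun j => (out j).2) t₂ p)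
      ⟨.inr (.inl (q, d, ⟨i, hi⟩, out)), b * n + i, updateFrom n (i + 1) (fun j => (out j).1) t₁,
        updateFrom n (i + 1) (fun j => (out j).2) t₂⟩
      ⟨atState b q, b * (if d then n + 1 else n - 1), update n (fun j => (out j).1) t₁,
        update n (fun j => (out j).2) t₂⟩ := by
  have hP : ∀ i, ∀ p, updateFrom n i (fun j => (out j).2) t₂ p = t₂ p ∨
      updateFrom n i (fun j => (out j).2) t₂ p = update n (fun j => (out j).2) t₂ p := by
    intro i p
    simp only [updateFrom, update]
    split_ifs with h1 h2 h2 <;> simp_all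
  have hU : ∀ (o : Fin b → Bool) t i, i < b + 1 → (fun p => if p = b * n + i then
      (if h : i < b then o ⟨i, h⟩ else updateFrom n (i + 1) o t (b * n + i))
        else updateFrom n (i + 1) o t p) = updateFrom n i o t := by
    intro o t i hi
    funext p
    simp only [updateFrom]
    by_cases hp : p = b * n + i
    · subst hp
      by_cases h : i < b
      · simp [h]
      · simp [h]
    · rw [if_neg hp]
      have : (b * n ≤ p ∧ p - b * n < b ∧ i + 1 ≤ p - b * n) ↔
        (b * n ≤ p ∧ p - b * n < b ∧ i ≤ p - b * n) := by omega
      simp only [this]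
  induction i with
  | zero =>
    refine .head (by simp [core, atState]) (hP _) ?_
    have e : Fin.last b - 1 = ⟨b - 1, by omega⟩ := by
      rw [sub_eq_iff_eq_add, Fin.ext_iff, Fin.val_add]
      simp only [Fin.val_one', Nat.add_mod_mod, Fin.val_last]
      rw [Nat.sub_add_cancel hb, Nat.mod_eq_of_lt (by omega)]
    have : T.core.step w ⟨.inr (.inl (q, d, ⟨0, hi⟩, out)), b * n + 0,
        updateFrom n (0 + 1) (fun j => (out j).1) t₁,
        updateFrom n (0 + 1) (fun j => (out j).2) t₂⟩ =
        ⟨moveState q ⟨b - 1, by omega⟩ d, if d then b * n + 1 else b * n - 1,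
          update n (fun j => (out j).1) t₁, update n (fun j => (out j).2) t₂⟩ := by
      have e0 : ∀ o : Fin b → Bool, ∀ t, update n o t = updateFrom n 0 o t := by
        intro o t; funext p; simp [update, updateFrom]
      rw [e0, e0, ← hU _ t₁ 0 (by omega), ← hU _ t₂ 0 (by omega)]
      simp [Core.step, core, e, hb]
    rw [this]
    convert T.path_move _ (b - 1) (by omega) (if d then b * n + 1 else b * n - 1) using 2
    · cases d
      · simp only [Bool.false_eq_true, if_false, Nat.mul_sub]
        omega
      · simp only [if_true, Nat.mul_add]; omega
    · intro p; exact .inr rfl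
  | succ i ih =>
    refine .head (by simp [core, atState]) (hP _) ?_
    convert ih (by omega) using 1
    have e : (⟨i + 1, hi⟩ : Fin (b + 1)) - 1 = ⟨i, by omega⟩ := by
      rw [sub_eq_iff_eq_add, Fin.ext_iff, Fin.val_add]
      simp only [Fin.val_one', Nat.add_mod_mod]
      rw [Nat.mod_eq_of_lt hi]
    rw [← hU _ t₁ (i + 1) hi, ← hU _ t₂ (i + 1) hi]
    simp only [Core.step, core, e]
    by_cases h : i + 1 < b
    · simp [h]
    · simp [h]

/-- The content of block `n`. -/
def block (w t₁ t₂ : R) (n : ℕ) (j : Fin b) : Bool × Bool × Bool :=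
  (w (b * n + j), t₁ (b * n + j), t₂ (b * n + j))

theorem path_read {w : R} {q : T.Q} (hq : q ≠ T.qhalt) {P : R → Prop} {t₁ t₂ : R} (hP : P t₂)
    (n : ℕ) (i : ℕ) (hi : i < b + 1) (hib : i < b) :
    T.core.Path w P ⟨atState b q, b * n, t₁, t₂⟩
      ⟨.inl (q, ⟨i, hi⟩, fun j => if (j : ℕ) < i then block w t₁ t₂ n j else
        (false, false, false)), b * n + i, t₁, t₂⟩ := by
  induction i with
  | zero => simpa [atState] using Core.Path.refl _
  | succ i ih =>
    refine (ih (by omega) (by omega)).trans (.single ?_ hP ?_)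
    · simp only [core, atState, ne_eq, Sum.inl.injEq, Prod.mk.injEq, not_and]
      exact fun h => absurd h hq
    · have e : (⟨i, by omega⟩ : Fin (b + 1)) + 1 = ⟨i + 1, hi⟩ := by
        rw [Fin.ext_iff, Fin.val_add]
        simp only [Fin.val_one', Nat.add_mod_mod]
        rw [Nat.mod_eq_of_lt hi]
      simp only [Core.step, core, hib, if_true, e, add_assoc]
      congr 1
      · congr 3
        funext j
        by_cases h : (j : ℕ) = i
        · simp [h, block]
        · have : (j : ℕ) < i + 1 ↔ (j : ℕ) < i := by omega
          simp [h, this]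
      · funext p; split_ifs with h <;> simp [h]
      · funext p; split_ifs with h <;> simp [h]

/-- One step of a block machine is simulated by a finite path of its core. -/
theorem path_step {w : R} {q q' : T.Q} (hq : q ≠ T.qhalt) (hb : 0 < b) (t₁ t₂ : R) (n : ℕ)
    {out : Fin b → Bool × Bool} {d : Bool}
    (h : T.trans q (block w t₁ t₂ n) = (q', out, d)) :
    T.core.Path w (fun y => ∀ p, y p = t₂ p ∨ y p = update n (fun j => (out j).2) t₂ p)
      ⟨atState b q, b * n, t₁, t₂⟩
      ⟨atState b q', b * (if d then n + 1 else n - 1), update n (fun j => (out j).1) t₁,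
        update n (fun j => (out j).2) t₂⟩ := by
  refine (T.path_read hq (fun p => .inl rfl) n (b - 1) (by omega) (by omega)).trans ?_
  refine .head ?_ (fun p => .inl rfl) ?_
  · simp only [core, atState, ne_eq, Sum.inl.injEq, Prod.mk.injEq, not_and]
    exact fun h => absurd h hq
  · convert T.path_write hb out b (by omega) using 1
    have e0 : ∀ o : Fin b → Bool, ∀ t, updateFrom n (b + 1) o t = t := by
      intro o t; funext p; simp only [updateFrom]; rw [dif_neg]; omega
    have e1 : (fun j : Fin b => if (j : ℕ) = b - 1 then
        (w (b * n + (b - 1)), t₁ (b * n + (b - 1)), t₂ (b * n + (b - 1)))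
        else if (j : ℕ) < b - 1 then block w t₁ t₂ n j else (false, false, false)) =
        block w t₁ t₂ n := by
      funext j
      have := j.2
      by_cases h : (j : ℕ) = b - 1
      · simp [h, block]
      · rw [if_neg h, if_pos (by omega)]
    rw [e0, e0]
    simp only [Core.step, core, show ¬ (b - 1 + 1 < b) by omega, if_false, e1, h, if_true]
    congr 1
    · omega
    · funext p; split_ifs with h <;> simp [h]
    · funext p; split_ifs with h <;> simp [h]

end BlockMachine

/-- The tape whose `n`-th block of length `b` is `Y n`. -/
def flat {b : ℕ} [NeZero b] (Y : ℕ → Fin b → Bool) : R := fun p => Y (p / b) (Fin.ofNat b p)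

/-- The tape carrying the bits of `A` at the multiples of `b`, and zeros elsewhere. -/
noncomputable def spread (b : ℕ) [NeZero b] (A : R) : R :=
  flat (b := b) fun n j => if j = 0 then A n else false

section Flat

variable {b : ℕ} [NeZero b]

theorem flat_apply (Y : ℕ → Fin b → Bool) (n : ℕ) (j : Fin b) : flat Y (b * n + j) = Y n j := by
  have hb : 0 < b := NeZero.pos b
  simp only [flat]
  congr
  · rw [Nat.mul_add_div hb, Nat.div_eq_of_lt j.2, add_zero]
  · rw [Fin.ext_iff, Fin.val_ofNat, Nat.mul_add_mod, Nat.mod_eq_of_lt j.2]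

theorem exists_eq_flat (t : R) : ∃ Y : ℕ → Fin b → Bool, t = flat Y := by
  refine ⟨fun n j => t (b * n + j), ?_⟩
  funext p
  simp only [flat, Fin.val_ofNat, Nat.div_add_mod]

theorem spread_mul (A : R) (n : ℕ) : spread b A (b * n) = A n := by
  simpa [spread] using flat_apply (fun n (j : Fin b) => if j = 0 then A n else false) n 0

theorem spread_apply (A : R) (p : ℕ) :
    spread b A p = if p % b = 0 then A (p / b) else false := by
  simp only [spread, flat, Fin.ext_iff, Fin.val_ofNat, Fin.val_zero]

namespace BlockMachine

variable (T : BlockMachine b)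

/-- The configuration in state `q` at block `n`. -/
def conf (q : T.Q) (n : ℕ) (Y Z : ℕ → Fin b → Bool) : Conf T.core.S :=
  ⟨atState b q, b * n, flat Y, flat Z⟩

theorem update_flat (n : ℕ) (f : Fin b → Bool) (Y Y' : ℕ → Fin b → Bool) (h : Y' n = f)
    (h' : ∀ i, i ≠ n → Y' i = Y i) : update n f (flat Y) = flat Y' := by
  have hb : 0 < b := NeZero.pos b
  subst h
  funext p
  have hp := Nat.div_add_mod p b
  have hm := Nat.mod_lt p hb
  by_cases e : p / b = n
  · rw [e] at hp
    simp only [update, flat, e]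
    rw [dif_pos ⟨by omega, by omega⟩]
    congr
    omega
  · simp only [update, flat]
    rw [dif_neg, h' _ e]
    rintro ⟨h1, h2⟩
    apply e
    rw [Nat.div_eq_iff hb]
    constructor
    · rw [mul_comm]; exact h1
    · have : (n + 1) * b = b * n + b := by ring
      rw [mul_comm]; omega

theorem path_conf {w : R} {q q' : T.Q} (hq : q ≠ T.qhalt) {n n' : ℕ} {Y Z Y' Z' : ℕ → Fin b → Bool}
    {y z : Fin b → Bool} {d : Bool}
    (h : T.trans q (fun j => (w (b * n + j), Y n j, Z n j)) = (q', fun j => (y j, z j), d))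
    (hn : n' = if d then n + 1 else n - 1)
    (hY : Y' n = y) (hY' : ∀ i, i ≠ n → Y' i = Y i)
    (hZ : Z' n = z) (hZ' : ∀ i, i ≠ n → Z' i = Z i) :
    T.core.Path w (fun y => ∀ p, y p = flat Z p ∨ y p = flat Z' p)
      (T.conf q n Y Z) (T.conf q' n' Y' Z') := by
  have hb : 0 < b := NeZero.pos b
  have := T.path_step (w := w) hq hb (flat Y) (flat Z) n (q' := q')
    (out := fun j => (y j, z j)) (d := d) (by
      rw [← h]; congr; funext j; simp only [block, flat_apply])
  rw [update_flat n _ Y Y' hY hY', update_flat n _ Z Z' hZ hZ'] at this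
  subst hn
  exact this

end BlockMachine

end Flat

/-- The elementary actions of a register program. -/
inductive Act
  | inc
  | dec
  | rdw (o : ℕ)
  | rdA
  | rdB
  | wrA (v : Bool)
  | wrB (v : Bool)

/-- An instruction: an action, the register it refers to, and the two possible next labels. -/
structure Instr where
  act : Act
  c : ℕ
  nt : ℕ
  nf : ℕ

/-- The store of a register program: registers and two arrays of bits. -/
structure Store where
  reg : ℕ → ℕ
  A : R
  B : R

/-- The effect of an action on a store, together with the resulting bit. -/
noncomputable def Act.sem (w : R) (b : ℕ) (a : Act) (c : ℕ) (σ : Store) : Store × Bool :=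
  match a with
  | .inc => (⟨fun i => if i = c then σ.reg c + 1 else σ.reg i, σ.A, σ.B⟩, true)
  | .dec => (⟨fun i => if i = c then σ.reg c - 1 else σ.reg i, σ.A, σ.B⟩, decide (σ.reg c ≠ 0))
  | .rdw o => (σ, w (b * σ.reg c + o))
  | .rdA => (σ, σ.A (σ.reg c))
  | .rdB => (σ, σ.B (σ.reg c))
  | .wrA v => (⟨σ.reg, fun i => if i = σ.reg c then v else σ.A i, σ.B⟩, true)
  | .wrB v => (⟨σ.reg, σ.A, fun i => if i = σ.reg c then v else σ.B i⟩, true)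

/-- The action only refers to registers below `m` and to offsets below `b`. -/
def Act.Bounded (b m : ℕ) (a : Act) (c : ℕ) : Prop :=
  c < m ∧ match a with
    | .rdw o => o < b
    | _ => True

/-- Phases of the execution of an instruction. -/
inductive Phase
  | scan (moved : Bool)
  | inc2
  | dec2
  | ret (v : Bool)

noncomputable instance : Fintype Phase :=
  Fintype.ofInjective (β := Fin 4 × Bool)
    (fun
      | .scan v => (0, v)
      | .inc2 => (1, false)
      | .dec2 => (2, false)
      | .ret v => (3, v))
    (by rintro (_ | _ | _ | _) (_ | _ | _ | _) h <;> simp_all)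

/-- States of the block machine executing a register program. -/
inductive RState (N : ℕ)
  | lim
  | halt
  | run (ph : Phase) (pc : Fin N)

noncomputable instance (N : ℕ) : Fintype (RState N) :=
  Fintype.ofInjective (β := Option (Option (Phase × Fin N)))
    (fun
      | .lim => none
      | .halt => some none
      | .run ph pc => some (some (ph, pc)))
    (by rintro (_ | _ | _) (_ | _ | _) h <;> simp_all)

/-- The offset of register `c` in each block. -/
def regOff (m c : ℕ) : Fin (m + 2) := Fin.ofNat _ (c + 2)

theorem regOff_ne_zero {m c : ℕ} (hc : c < m) : regOff m c ≠ 0 := by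
  rw [regOff, Ne, Fin.ext_iff, Fin.val_ofNat, Nat.mod_eq_of_lt (by omega)]; simp

theorem regOff_ne_one {m c : ℕ} (hc : c < m) : regOff m c ≠ 1 := by
  rw [regOff, Ne, Fin.ext_iff, Fin.val_ofNat, Nat.mod_eq_of_lt (by omega)]; simp

theorem regOff_inj {m c c' : ℕ} (hc : c < m) (hc' : c' < m) :
    regOff m c = regOff m c' ↔ c = c' := by
  rw [regOff, regOff, Fin.ext_iff, Fin.val_ofNat, Fin.val_ofNat, Nat.mod_eq_of_lt (by omega),
    Nat.mod_eq_of_lt (by omega)]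
  omega

/-- The block machine executing a register program with `m` registers and `N` instructions. -/
noncomputable def regMachine (m N : ℕ) [NeZero N] (code : ℕ → Instr) : BlockMachine (m + 2) where
  Q := RState N
  fin := inferInstance
  qlim := .lim
  qhalt := .halt
  trans := fun q blk =>
    match q with
    | .lim =>
      if (blk 0).2.2 then (.halt, fun j => (blk j).2, true)
      else (.run (.scan false) (Fin.ofNat N 0),
        fun j => (if j = 1 then (blk j).2.1 else decide (j = 0), (blk j).2.2), false)
    | .halt => (.halt, fun j => (blk j).2, true)
    | .run ph p =>
      let i := code p
      let o := regOff m i.c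
      match ph with
      | .scan mv =>
        let y : Fin (m + 2) → Bool := fun j => if mv ∧ j = 0 then false else (blk j).2.1
        if (blk o).2.1 then (.run (.scan true) p, fun j => (y j, (blk j).2.2), true)
        else match i.act with
          | .inc => (.run .inc2 p, fun j => (if j = o then true else y j, (blk j).2.2), true)
          | .dec => (.run (if mv then .dec2 else .ret false) p,
              fun j => (y j, (blk j).2.2), false)
          | .rdw k => (.run (.ret (blk (Fin.ofNat _ k)).1) p, fun j => (y j, (blk j).2.2), false)
          | .rdA => (.run (.ret (blk 0).2.2) p, fun j => (y j, (blk j).2.2), false)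
          | .rdB => (.run (.ret (blk 1).2.1) p, fun j => (y j, (blk j).2.2), false)
          | .wrA v => (.run (.ret true) p,
              fun j => (y j, if j = 0 then v else (blk j).2.2), false)
          | .wrB v => (.run (.ret true) p,
              fun j => (if j = 1 then v else y j, (blk j).2.2), false)
      | .inc2 => (.run (.ret true) p,
          fun j => (if j = o ∨ j = 0 then false else (blk j).2.1, (blk j).2.2), false)
      | .dec2 => (.run (.ret true) p,
          fun j => (if j = o then false else (blk j).2.1, (blk j).2.2), false)
      | .ret v =>
        if (blk 0).2.1 then (.run (.scan false) (Fin.ofNat N (if v then i.nt else i.nf)),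
          fun j => ((blk j).2.1, (blk j).2.2), false)
        else (.run (.ret v) p, fun j => ((blk j).2.1, (blk j).2.2), false)

/-- The scratch tape with blocks `Y` represents the store `σ`. -/
structure Represents (m : ℕ) (σ : Store) (Y : ℕ → Fin (m + 2) → Bool) : Prop where
  mark : Y 0 0 = true
  ones : ∀ c < m, ∀ i < σ.reg c, Y i (regOff m c) = true
  zero : ∀ c < m, Y (σ.reg c) (regOff m c) = false
  bits : ∀ k, Y k 1 = σ.B k

/-- Each bit of the tape is a bit of `spread b A` or of `spread b A'`. -/
def Between (b : ℕ) [NeZero b] (A A' : R) (y : R) : Prop :=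
  ∀ p, y p = spread b A p ∨ y p = spread b A' p

namespace regMachine

variable {m N : ℕ} [NeZero N] {code : ℕ → Instr} {w : R}

/-- The configuration at the beginning of the instruction with label `l`. -/
noncomputable def atLabel (m N : ℕ) [NeZero N] (code : ℕ → Instr) (l : ℕ)
    (Y : ℕ → Fin (m + 2) → Bool) (A : R) : Conf (regMachine m N code).core.S :=
  (regMachine m N code).conf (.run (.scan false) (Fin.ofNat N l)) 0 Y
    fun n j => if j = 0 then A n else false

/-- Clear the origin marks of the blocks strictly between `0` and `n`. -/
noncomputable def clear (n : ℕ) (Y : ℕ → Fin (m + 2) → Bool) : ℕ → Fin (m + 2) → Bool := fun i j =>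
  if j = 0 ∧ 0 < i ∧ i < n then false else Y i j

theorem path_scan {P : R → Prop} {l : ℕ} (hl : l < N) {Y Z : ℕ → Fin (m + 2) → Bool} (hP : P (flat Z)) (n : ℕ)
    (hn : ∀ i < n, Y i (regOff m (code l).c) = true) (hc : (code l).c < m) :
    (regMachine m N code).core.Path w P
      ((regMachine m N code).conf (.run (.scan false) (Fin.ofNat N l)) 0 Y Z)
      ((regMachine m N code).conf (.run (.scan (decide (0 < n))) (Fin.ofNat N l)) n
        (clear n Y) Z) := by
  have hl' : (Fin.ofNat N l : ℕ) = l := by simp [Nat.mod_eq_of_lt hl]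
  have ho := regOff_ne_zero hc
  induction n with
  | zero =>
    have : clear 0 Y = Y := by funext i j; simp [clear]
    rw [this]
    exact .refl _
  | succ n ih =>
    refine (ih fun i hi => hn i (by omega)).trans ?_
    refine Core.Path.mono (P := fun y => ∀ p, y p = flat Z p ∨ y p = flat Z p)
      (fun y hy => ?_) (BlockMachine.path_conf _ (by rintro ⟨⟩)
        (y := clear (n + 1) Y n) (z := Z n) (d := true) ?_ ?_ rfl ?_ rfl ?_)
    · have : y = flat Z := funext fun p => (hy p).elim id id
      rwa [this]
    · have h1 : clear n Y n (regOff m (code l).c) = true := by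
        simp only [clear, ho, false_and, if_false]; exact hn n (by omega)
      simp only [regMachine, hl', h1, if_true]
      simp [clear]
      funext j
      grind
    · simp
    · intro i hi; funext j; simp only [clear]; grind
    · intro i hi; rfl

theorem path_ret {P : R → Prop} {l : ℕ} (hl : l < N) {Y Z : ℕ → Fin (m + 2) → Bool} (hP : P (flat Z)) (v : Bool) (n : ℕ)
    (h0 : Y 0 0 = true) (hn : ∀ i, 0 < i → i ≤ n → Y i 0 = false) :
    (regMachine m N code).core.Path w P
      ((regMachine m N code).conf (.run (.ret v) (Fin.ofNat N l)) n Y Z)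
      ((regMachine m N code).conf (.run (.scan false)
        (Fin.ofNat N (if v then (code l).nt else (code l).nf))) 0 Y Z) := by
  have hl' : (Fin.ofNat N l : ℕ) = l := by simp [Nat.mod_eq_of_lt hl]
  have key : ∀ {q q' n n'}, q ≠ RState.halt → (regMachine m N code).trans q
      (fun j => (w ((m + 2) * n + j), Y n j, Z n j)) = (q', fun j => (Y n j, Z n j), false) →
      n' = n - 1 → (regMachine m N code).core.Path w P
      ((regMachine m N code).conf q n Y Z) ((regMachine m N code).conf q' n' Y Z) := by
    intro q q' n n' hq h hn'
    refine Core.Path.mono (P := fun y => ∀ p, y p = flat Z p ∨ y p = flat Z p)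
      (fun y hy => ?_) (BlockMachine.path_conf _ hq
        (y := Y n) (z := Z n) (d := false) h ?_ rfl ?_ rfl ?_)
    · have : y = flat Z := funext fun p => (hy p).elim id id
      rwa [this]
    · simpa using hn'
    · intro i hi; rfl
    · intro i hi; rfl
  induction n with
  | zero =>
    refine key (by rintro ⟨⟩) ?_ rfl
    simp only [regMachine, h0, if_true, hl']
  | succ n ih =>
    refine (key (by rintro ⟨⟩) ?_ rfl).trans (ih fun i h1 h2 => hn i h1 (by omega))
    simp only [regMachine, hn (n + 1) (by omega) le_rfl, Bool.false_eq_true, if_false]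

end regMachine

theorem Between.left {b : ℕ} [NeZero b] {A A' : R} : Between b A A' (spread b A) := fun _ => .inl rfl

theorem Between.right {b : ℕ} [NeZero b] {A A' : R} : Between b A A' (spread b A') :=
  fun _ => .inr rfl

namespace regMachine

variable {m N : ℕ} [NeZero N] {code : ℕ → Instr} {w : R}

theorem Represents.clear {σ : Store} {Y : ℕ → Fin (m + 2) → Bool} (h : Represents m σ Y) (n : ℕ) :
    Represents m σ (clear n Y) := by
  have ho : ∀ c < m, regOff m c ≠ 0 := fun c hc => regOff_ne_zero hc
  refine ⟨?_, fun c hc i hi => ?_, fun c hc => ?_, fun k => ?_⟩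
  · simpa [regMachine.clear] using h.mark
  · simpa [regMachine.clear, ho c hc] using h.ones c hc i hi
  · simpa [regMachine.clear, ho c hc] using h.zero c hc
  · simpa [regMachine.clear] using h.bits k

theorem path_act {l : ℕ} (hl : l < N) {σ σ' : Store} {v : Bool} {y z : Fin (m + 2) → Bool}
    {Y Y' : ℕ → Fin (m + 2) → Bool} (hc : (code l).c < m) (hσ : Represents m σ Y)
    (hσ' : Represents m σ' Y')
    (h : (regMachine m N code).trans
      (.run (.scan (decide (0 < σ.reg (code l).c))) (Fin.ofNat N l))
      (fun j => (w ((m + 2) * σ.reg (code l).c + j), regMachine.clear (σ.reg (code l).c) Y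
        (σ.reg (code l).c) j, if j = 0 then σ.A (σ.reg (code l).c) else false)) =
      (.run (.ret v) (Fin.ofNat N l), fun j => (y j, z j), false))
    (hY : Y' (σ.reg (code l).c) = y)
    (hY' : ∀ i, i ≠ σ.reg (code l).c → Y' i = regMachine.clear (σ.reg (code l).c) Y i)
    (hZ : (fun j => if j = 0 then σ'.A (σ.reg (code l).c) else false) = z)
    (hZ' : ∀ i, i ≠ σ.reg (code l).c → σ'.A i = σ.A i) :
    (regMachine m N code).core.Path w (Between (m + 2) σ.A σ'.A) (atLabel m N code l Y σ.A)
      (atLabel m N code (if v then (code l).nt else (code l).nf) Y' σ'.A) := by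
  refine (path_scan hl Between.left (σ.reg (code l).c) (hσ.ones _ hc) hc).trans ?_
  refine Core.Path.trans (BlockMachine.path_conf _ (by rintro ⟨⟩)
      (y := y) (z := z) (d := false) h rfl hY hY' hZ ?_) (path_ret hl Between.right v _ hσ'.mark ?_)
  · intro i hi; funext j; rw [hZ' i hi]
  · simp only [Bool.false_eq_true, if_false]
    intro i h1 h2
    rw [hY' i (by omega)]
    simp only [regMachine.clear]
    rw [if_pos]
    exact ⟨trivial, h1, by omega⟩

theorem path_instr {l : ℕ} (hl : l < N) {σ : Store} {Y : ℕ → Fin (m + 2) → Bool}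
    (hb : (code l).act.Bounded (m + 2) m (code l).c) (hσ : Represents m σ Y) :
    ∃ Y', Represents m ((code l).act.sem w (m + 2) (code l).c σ).1 Y' ∧
      (regMachine m N code).core.Path w
        (Between (m + 2) σ.A ((code l).act.sem w (m + 2) (code l).c σ).1.A)
        (atLabel m N code l Y σ.A)
        (atLabel m N code (if ((code l).act.sem w (m + 2) (code l).c σ).2 then (code l).nt
          else (code l).nf) Y' ((code l).act.sem w (m + 2) (code l).c σ).1.A) := by
  obtain ⟨hc, hb⟩ := hb
  have hl' : (Fin.ofNat N l : ℕ) = l := by simp [Nat.mod_eq_of_lt hl]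
  have ho : ∀ c < m, regOff m c ≠ 0 := fun c hc => regOff_ne_zero hc
  have ho1 : ∀ c < m, regOff m c ≠ 1 := fun c hc => regOff_ne_one hc
  have hoo : ∀ c < m, ∀ c' < m, regOff m c = regOff m c' ↔ c = c' :=
    fun c hc c' hc' => regOff_inj hc hc'
  set k := σ.reg (code l).c with hk
  have hz := Represents.clear hσ k
  have hz' := Represents.clear hσ (k + 1)
  have hbit := hz.zero _ hc
  rw [← hk] at hbit
  have hcl : ∀ j, (if decide (0 < k) = true ∧ j = 0 then false else clear k Y k j) =
      clear (k + 1) Y k j := by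
    intro j; simp only [regMachine.clear]; grind
  have hcl' : ∀ i, i ≠ k → clear (k + 1) Y i = clear k Y i := by
    intro i hi; funext j; simp only [regMachine.clear]; grind
  cases ha : (code l).act with
  | rdw o =>
    rw [ha] at hb
    have hoo : (Fin.ofNat (m + 2) o : ℕ) = o := by simp [Nat.mod_eq_of_lt hb]
    refine ⟨clear (k + 1) Y, hz', path_act hl hc hσ hz' ?_ rfl hcl' rfl fun _ _ => rfl⟩
    simp only [regMachine, hl', ← hk, hbit, ha, hcl, Bool.false_eq_true, if_false, Act.sem, hoo]
  | rdA =>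
    refine ⟨clear (k + 1) Y, hz', path_act hl hc hσ hz' ?_ rfl hcl' rfl fun _ _ => rfl⟩
    simp only [regMachine, hl', ← hk, hbit, ha, hcl, Bool.false_eq_true, if_false, Act.sem, if_true]
  | rdB =>
    refine ⟨clear (k + 1) Y, hz', path_act hl hc hσ hz' ?_ rfl hcl' rfl fun _ _ => rfl⟩
    simp only [regMachine, hl', ← hk, hbit, ha, hcl, Bool.false_eq_true, if_false, Act.sem,
      hz.bits k]
  | wrA v =>
    refine ⟨clear (k + 1) Y, ⟨hz'.mark, hz'.ones, hz'.zero, hz'.bits⟩,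
      path_act hl hc hσ (σ' := (Act.sem w (m + 2) (.wrA v) (code l).c σ).1)
        ⟨hz'.mark, hz'.ones, hz'.zero, hz'.bits⟩ ?_ rfl hcl' rfl ?_⟩
    · simp only [regMachine, hl', ← hk, hbit, ha, hcl, Bool.false_eq_true, if_false, Act.sem]
      congr 2
      funext j
      by_cases h : j = 0 <;> simp [h]
    · intro i hi; simp [Act.sem, hi]
  | wrB v =>
    let Y' : ℕ → Fin (m + 2) → Bool := fun i j => if i = k ∧ j = 1 then v else clear (k + 1) Y i j
    have hr : Represents m (Act.sem w (m + 2) (.wrB v) (code l).c σ).1 Y' := by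
      refine ⟨?_, fun c hc i hi => ?_, fun c hc => ?_, fun k => ?_⟩
      · simpa [Y'] using hz'.mark
      · simpa [Y', ho1 c hc] using hz'.ones c hc i hi
      · simpa [Y', ho1 c hc, Act.sem] using hz'.zero c hc
      · simp only [Y', Act.sem, hz'.bits, and_true, ← hk]
    refine ⟨Y', hr, path_act hl hc hσ hr (y := Y' k) ?_ rfl ?_ rfl fun _ _ => rfl⟩
    · simp only [regMachine, hl', ← hk, hbit, ha, hcl, Bool.false_eq_true, if_false, Act.sem]
      simp [Y']
    · intro i hi; funext j; simp only [Y', show i ≠ k from hi, hcl' i hi, false_and, if_false, ← hk]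
  | inc =>
    let Y₁ : ℕ → Fin (m + 2) → Bool := fun i j =>
      if i = k ∧ j = regOff m (code l).c then true else clear (k + 1) Y i j
    let Y' : ℕ → Fin (m + 2) → Bool := fun i j =>
      if i = k + 1 ∧ (j = regOff m (code l).c ∨ j = 0) then false else Y₁ i j
    have hr : Represents m (Act.sem w (m + 2) .inc (code l).c σ).1 Y' := by
      refine ⟨?_, fun c hc' i hi => ?_, fun c hc' => ?_, fun k => ?_⟩
      · simp [Y', Y₁, (ho _ hc).symm]; exact hz'.mark
      · simp only [Y', Y₁, ho c hc', or_false]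
        simp only [hoo _ hc' _ hc]
        simp only [Act.sem] at hi
        by_cases e : c = (code l).c
        · subst e
          simp only [if_true, ← hk] at hi
          simp only [and_true]
          rw [if_neg (by omega)]
          split_ifs with h
          · rfl
          · exact hz'.ones _ hc i (by omega)
        · simp only [e, and_false, if_false] at hi ⊢
          exact hz'.ones _ hc' i hi
      · simp only [Y', Y₁, ho c hc', or_false, Act.sem]
        simp only [hoo _ hc' _ hc]
        by_cases e : c = (code l).c
        · simp [e, ← hk]
        · simp only [e, and_false, if_false]
          exact hz'.zero _ hc'
      · simp [Y', Y₁, (ho1 _ hc).symm, Act.sem, hz'.bits]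
    refine ⟨Y', hr, ?_⟩
    refine (path_scan hl Between.left k (hσ.ones _ hc) hc).trans ?_
    refine Core.Path.trans (BlockMachine.path_conf _ (by rintro ⟨⟩)
      (q' := RState.run .inc2 (Fin.ofNat N l)) (n' := k + 1) (Y' := Y₁) (y := Y₁ k)
      (Z' := fun n j => if j = 0 then σ.A n else false) (d := true) ?_ rfl rfl ?_ rfl
        fun _ _ => rfl) ?_
    · simp only [regMachine, hl', hbit, ha, hcl, Bool.false_eq_true, if_false]
      simp [Y₁]
    · intro i hi; funext j; simp [Y₁, hi, hcl' i hi]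
    refine Core.Path.trans (BlockMachine.path_conf _ (by rintro ⟨⟩)
      (q' := RState.run (.ret true) (Fin.ofNat N l)) (n' := k) (Y' := Y') (y := Y' (k + 1))
      (Z' := fun n j => if j = 0 then σ.A n else false) (d := false) ?_ rfl rfl ?_ rfl
        fun _ _ => rfl) ?_
    · simp only [regMachine, hl']
      simp [Y']
    · intro i hi; funext j; simp [Y', hi]
    refine path_ret hl Between.right true k hr.mark ?_
    intro i h1 h2
    simp only [Y', Y₁, (ho _ hc).symm, and_false, if_false, regMachine.clear, true_and]
    simp [h1, show i < k + 1 by omega]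
  | dec =>
    by_cases h0 : k = 0
    · have hs : Represents m (Act.sem w (m + 2) .dec (code l).c σ).1 (clear (k + 1) Y) := by
        refine ⟨hz'.mark, fun c hc' i hi => ?_, fun c hc' => ?_, hz'.bits⟩
        · simp only [Act.sem, ← hk] at hi
          split_ifs at hi with h
          · omega
          · exact hz'.ones c hc' i hi
        · simp only [Act.sem, ← hk]
          split_ifs with h
          · subst h; rw [h0]; have := hz'.zero _ hc; rwa [← hk, h0] at this
          · exact hz'.zero c hc'
      refine ⟨clear (k + 1) Y, hs, path_act hl hc hσ hs ?_ rfl hcl' rfl fun _ _ => rfl⟩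
      simp only [regMachine, hl', ← hk, hbit, ha, hcl, Bool.false_eq_true, if_false, Act.sem]
      simp [h0]
    · obtain ⟨k', hk'⟩ : ∃ k', k = k' + 1 := ⟨k - 1, by omega⟩
      let Y' : ℕ → Fin (m + 2) → Bool := fun i j =>
        if i = k' ∧ j = regOff m (code l).c then false else clear (k + 1) Y i j
      have hr : Represents m (Act.sem w (m + 2) .dec (code l).c σ).1 Y' := by
        refine ⟨?_, fun c hc' i hi => ?_, fun c hc' => ?_, fun k => ?_⟩
        · simp [Y', (ho _ hc).symm]; exact hz'.mark
        · simp only [Y']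
          simp only [hoo _ hc' _ hc]
          simp only [Act.sem] at hi
          by_cases e : c = (code l).c
          · subst e
            simp only [if_true, ← hk] at hi
            rw [if_neg (by omega)]
            exact hz'.ones _ hc i (by omega)
          · simp only [e, and_false, if_false] at hi ⊢
            exact hz'.ones _ hc' i hi
        · simp only [Y', Act.sem]
          simp only [hoo _ hc' _ hc]
          by_cases e : c = (code l).c
          · simp [e, ← hk, hk']
          · simp only [e, and_false, if_false]
            exact hz'.zero _ hc'
        · simp [Y', (ho1 _ hc).symm, Act.sem, hz'.bits]
      refine ⟨Y', hr, ?_⟩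
      refine (path_scan hl Between.left k (hσ.ones _ hc) hc).trans ?_
      refine Core.Path.trans (BlockMachine.path_conf _ (by rintro ⟨⟩)
        (q' := RState.run .dec2 (Fin.ofNat N l)) (n' := k') (Y' := clear (k + 1) Y)
        (y := clear (k + 1) Y k)
        (Z' := fun n j => if j = 0 then σ.A n else false) (d := false) ?_ ?_ rfl hcl' rfl
          fun _ _ => rfl) ?_
      · simp only [regMachine, hl', hbit, ha, hcl, Bool.false_eq_true, if_false]
        simp [hk']
      · simp [hk']
      refine Core.Path.trans (BlockMachine.path_conf _ (by rintro ⟨⟩)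
        (q' := RState.run (.ret true) (Fin.ofNat N l)) (n' := k' - 1) (Y' := Y') (y := Y' k')
        (Z' := fun n j => if j = 0 then σ.A n else false) (d := false) ?_ rfl rfl ?_ rfl
          fun _ _ => rfl) ?_
      · simp only [regMachine, hl']
        simp [Y']
      · intro i hi; funext j; simp [Y', hi]
      have : (Act.sem w (m + 2) .dec (code l).c σ).2 = true := by simp [Act.sem, ← hk, h0]
      rw [this]
      refine path_ret hl Between.right true (k' - 1) hr.mark ?_
      intro i h1 h2
      simp only [Y', (ho _ hc).symm, and_false, if_false, regMachine.clear, true_and]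
      simp [h1, show i < k + 1 by omega]

end regMachine

/-- Structured register programs; `loop c s` decrements register `c` and executes `s` as long
as the register is not zero. -/
inductive Stmt
  | act (a : Act) (c : ℕ)
  | seq (s t : Stmt)
  | ite (a : Act) (c : ℕ) (s t : Stmt)
  | loop (c : ℕ) (s : Stmt)

namespace Stmt

/-- The number of instructions of a compiled statement. -/
def len : Stmt → ℕ
  | act _ _ => 1
  | seq s t => s.len + t.len
  | ite _ _ s t => 1 + s.len + t.len
  | loop _ s => 1 + s.len

/-- All registers are below `m` and all offsets below `b`. -/
def Bounded (b m : ℕ) : Stmt → Prop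
  | act a c => a.Bounded b m c
  | seq s t => s.Bounded b m ∧ t.Bounded b m
  | ite a c s t => a.Bounded b m c ∧ s.Bounded b m ∧ t.Bounded b m
  | loop c s => c < m ∧ s.Bounded b m

theorem Bounded.mono {b b' m m' : ℕ} (hb : b ≤ b') (hm : m ≤ m') {s : Stmt} (h : s.Bounded b m) :
    s.Bounded b' m' := by
  have hA : ∀ a c, Act.Bounded b m a c → Act.Bounded b' m' a c := by
    rintro a c ⟨h1, h2⟩
    refine ⟨by omega, ?_⟩
    cases a <;> simp_all; omega
  induction s with
  | act a c => exact hA a c h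
  | seq s t ihs iht => exact ⟨ihs h.1, iht h.2⟩
  | ite a c s t ihs iht => exact ⟨hA a c h.1, ihs h.2.1, iht h.2.2⟩
  | loop c s ih => exact ⟨h.1.trans_le hm, ih h.2⟩

/-- The compiled statement occupies the labels from `base` on, and continues at `exit`. -/
def Loaded (code : ℕ → Instr) : Stmt → ℕ → ℕ → Prop
  | act a c, base, exit => code base = ⟨a, c, exit, exit⟩
  | seq s t, base, exit => s.Loaded code base (base + s.len) ∧ t.Loaded code (base + s.len) exit
  | ite a c s t, base, exit => code base = ⟨a, c, base + 1, base + 1 + s.len⟩ ∧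
      s.Loaded code (base + 1) exit ∧ t.Loaded code (base + 1 + s.len) exit
  | loop c s, base, exit => code base = ⟨.dec, c, base + 1, exit⟩ ∧ s.Loaded code (base + 1) base

theorem exists_loaded (s : Stmt) (base exit : ℕ) :
    ∃ code₀ : ℕ → Instr, ∀ code : ℕ → Instr,
      (∀ i, base ≤ i → i < base + s.len → code i = code₀ i) → s.Loaded code base exit := by
  induction s generalizing base exit with
  | act a c => exact ⟨fun _ => ⟨a, c, exit, exit⟩, fun code h => h base le_rfl (by simp [len])⟩
  | seq s t ihs iht =>
    obtain ⟨f, hf⟩ := ihs base (base + s.len)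
    obtain ⟨g, hg⟩ := iht (base + s.len) exit
    refine ⟨fun i => if i < base + s.len then f i else g i, fun code h => ⟨hf _ ?_, hg _ ?_⟩⟩
    · intro i h1 h2
      refine (h i h1 (by simp only [len]; omega)).trans ?_
      beta_reduce
      rw [if_pos h2]
    · intro i h1 h2
      refine (h i (by omega) (by simp only [len]; omega)).trans ?_
      beta_reduce
      rw [if_neg (by omega)]
  | ite a c s t ihs iht =>
    obtain ⟨f, hf⟩ := ihs (base + 1) exit
    obtain ⟨g, hg⟩ := iht (base + 1 + s.len) exit
    refine ⟨fun i => if i = base then ⟨a, c, base + 1, base + 1 + s.len⟩ else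
      if i < base + 1 + s.len then f i else g i, fun code h => ⟨?_, hf _ ?_, hg _ ?_⟩⟩
    · refine (h base le_rfl (by simp only [len]; omega)).trans ?_
      beta_reduce
      rw [if_pos rfl]
    · intro i h1 h2
      refine (h i (by omega) (by simp only [len]; omega)).trans ?_
      beta_reduce
      rw [if_neg (by omega), if_pos h2]
    · intro i h1 h2
      refine (h i (by omega) (by simp only [len]; omega)).trans ?_
      beta_reduce
      rw [if_neg (by omega), if_neg (by omega)]
  | loop c s ih =>
    obtain ⟨f, hf⟩ := ih (base + 1) base
    refine ⟨fun i => if i = base then ⟨.dec, c, base + 1, exit⟩ else f i,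
      fun code h => ⟨?_, hf _ ?_⟩⟩
    · refine (h base le_rfl (by simp only [len]; omega)).trans ?_
      beta_reduce
      rw [if_pos rfl]
    · intro i h1 h2
      refine (h i (by omega) (by simp only [len]; omega)).trans ?_
      beta_reduce
      rw [if_neg (by omega)]

/-- Big-step execution, during which the first array always satisfies `Z`. -/
inductive Exec (w : R) (b : ℕ) (Z : R → Prop) : Stmt → Store → Store → Prop
  | act {a c σ} : Z σ.A → Z (a.sem w b c σ).1.A → Exec w b Z (.act a c) σ (a.sem w b c σ).1
  | seq {s t σ τ ρ} : Exec w b Z s σ τ → Exec w b Z t τ ρ → Exec w b Z (.seq s t) σ ρ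
  | ite_true {a c s t σ ρ} : Z σ.A → (a.sem w b c σ).2 = true →
      Exec w b Z s (a.sem w b c σ).1 ρ → Exec w b Z (.ite a c s t) σ ρ
  | ite_false {a c s t σ ρ} : Z σ.A → (a.sem w b c σ).2 = false →
      Exec w b Z t (a.sem w b c σ).1 ρ → Exec w b Z (.ite a c s t) σ ρ
  | loop_zero {c s σ} : Z σ.A → σ.reg c = 0 → Exec w b Z (.loop c s) σ (Act.dec.sem w b c σ).1
  | loop_succ {c s σ τ ρ} : Z σ.A → σ.reg c ≠ 0 → Exec w b Z s (Act.dec.sem w b c σ).1 τ →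
      Exec w b Z (.loop c s) τ ρ → Exec w b Z (.loop c s) σ ρ

theorem Exec.left {w : R} {b : ℕ} {Z : R → Prop} {s : Stmt} {σ σ' : Store}
    (h : Exec w b Z s σ σ') : Z σ.A := by
  induction h <;> assumption

/-- The bits of the tape come from two arrays satisfying `Z`. -/
def Mixed (b : ℕ) [NeZero b] (Z : R → Prop) (y : R) : Prop :=
  ∃ A A', Z A ∧ Z A' ∧ Between b A A' y

open regMachine in
theorem Exec.path {m N : ℕ} [NeZero N] {code : ℕ → Instr} {w : R} {Z : R → Prop} {s : Stmt}
    {σ σ' : Store} (h : Exec w (m + 2) Z s σ σ') {base exit : ℕ} (hl : s.Loaded code base exit)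
    (hN : base + s.len ≤ N) (hb : s.Bounded (m + 2) m) {Y : ℕ → Fin (m + 2) → Bool}
    (hY : Represents m σ Y) :
    ∃ Y', Represents m σ' Y' ∧ (regMachine m N code).core.Path w (Mixed (m + 2) Z)
      (atLabel m N code base Y σ.A) (atLabel m N code exit Y' σ'.A) := by
  have key : ∀ {a c nt nf base σ} {Y : ℕ → Fin (m + 2) → Bool}, base < N →
      code base = ⟨a, c, nt, nf⟩ → a.Bounded (m + 2) m c → Represents m σ Y →
      Z σ.A → Z (a.sem w (m + 2) c σ).1.A →
      ∃ Y', Represents m (a.sem w (m + 2) c σ).1 Y' ∧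
        (regMachine m N code).core.Path w (Mixed (m + 2) Z) (atLabel m N code base Y σ.A)
          (atLabel m N code (if (a.sem w (m + 2) c σ).2 then nt else nf) Y'
            (a.sem w (m + 2) c σ).1.A) := by
    intro a c nt nf base σ Y hN hcode hb hY hZ hZ'
    obtain ⟨Y', h1, h2⟩ := path_instr (w := w) (code := code) hN (by rw [hcode]; exact hb) hY
    rw [hcode] at h1 h2
    exact ⟨Y', h1, h2.mono fun y hy => ⟨_, _, hZ, hZ', hy⟩⟩
  induction h generalizing base exit Y with
  | act h1 h2 =>
    obtain ⟨Y', h3, h4⟩ := key (by simp only [len] at hN; omega) hl hb hY h1 h2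
    refine ⟨Y', h3, ?_⟩
    simpa using h4
  | seq _ _ ih1 ih2 =>
    simp only [len] at hN
    obtain ⟨Y₁, h1, h2⟩ := ih1 hl.1 (by omega) hb.1 hY
    obtain ⟨Y₂, h3, h4⟩ := ih2 hl.2 (by omega) hb.2 h1
    exact ⟨Y₂, h3, h2.trans h4⟩
  | ite_true hZ ht hE ih =>
    simp only [len] at hN
    obtain ⟨Y₁, h1, h2⟩ := key (by omega) hl.1 hb.1 hY hZ hE.left
    obtain ⟨Y₂, h3, h4⟩ := ih hl.2.1 (by omega) hb.2.1 h1
    rw [ht] at h2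
    exact ⟨Y₂, h3, h2.trans h4⟩
  | ite_false hZ ht hE ih =>
    simp only [len] at hN
    obtain ⟨Y₁, h1, h2⟩ := key (by omega) hl.1 hb.1 hY hZ hE.left
    obtain ⟨Y₂, h3, h4⟩ := ih hl.2.2 (by omega) hb.2.2 h1
    rw [ht] at h2
    exact ⟨Y₂, h3, h2.trans h4⟩
  | loop_zero hZ h0 =>
    simp only [len] at hN
    obtain ⟨Y₁, h1, h2⟩ := key (by omega) hl.1 ⟨hb.1, trivial⟩ hY hZ hZ
    refine ⟨Y₁, h1, ?_⟩
    simpa [Act.sem, h0] using h2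
  | loop_succ hZ h0 hE hE' ih1 ih2 =>
    have hN' := hN
    simp only [len] at hN
    obtain ⟨Y₁, h1, h2⟩ := key (by omega) hl.1 ⟨hb.1, trivial⟩ hY hZ hE.left
    obtain ⟨Y₂, h3, h4⟩ := ih1 hl.2 (by omega) hb.2 h1
    obtain ⟨Y₃, h5, h6⟩ := ih2 hl hN' hb h3
    refine ⟨Y₃, h5, ?_⟩
    have h7 : decide (_ ≠ 0) = true := decide_eq_true h0
    simp only [Act.sem, h7, if_true] at h2
    exact (h2.trans h4).trans h6

/-- Execution from `σ` terminates in a store satisfying `Q`. -/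
def Wp (w : R) (b : ℕ) (Z : R → Prop) (s : Stmt) (σ : Store) (Q : Store → Prop) : Prop :=
  ∃ σ', Exec w b Z s σ σ' ∧ Q σ'

namespace Wp

variable {w : R} {b : ℕ} {Z : R → Prop} {s t : Stmt} {σ : Store} {Q Q' : Store → Prop} {a : Act}
  {c : ℕ}

theorem mono (h : Wp w b Z s σ Q) (hQ : ∀ τ, Q τ → Q' τ) : Wp w b Z s σ Q' :=
  h.imp fun _ hτ => ⟨hτ.1, hQ _ hτ.2⟩

theorem seq (h : Wp w b Z s σ fun τ => Wp w b Z t τ Q) : Wp w b Z (.seq s t) σ Q := by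
  obtain ⟨τ, h1, ρ, h2, h3⟩ := h
  exact ⟨ρ, .seq h1 h2, h3⟩

theorem act (h : Z σ.A) (h' : Z (a.sem w b c σ).1.A) (hQ : Q (a.sem w b c σ).1) :
    Wp w b Z (.act a c) σ Q := ⟨_, .act h h', hQ⟩

theorem ite (h : Z σ.A) (ht : (a.sem w b c σ).2 = true → Wp w b Z s (a.sem w b c σ).1 Q)
    (hf : (a.sem w b c σ).2 = false → Wp w b Z t (a.sem w b c σ).1 Q) :
    Wp w b Z (.ite a c s t) σ Q := by
  cases e : (a.sem w b c σ).2
  · obtain ⟨ρ, h1, h2⟩ := hf e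
    exact ⟨ρ, .ite_false h e h1, h2⟩
  · obtain ⟨ρ, h1, h2⟩ := ht e
    exact ⟨ρ, .ite_true h e h1, h2⟩

/-- The rule for loops, with an invariant `I` depending on the value of the loop register. -/
theorem loop (I : ℕ → Store → Prop) (hZ : ∀ n τ, I n τ → Z τ.A)
    (hI : I (σ.reg c) σ)
    (hs : ∀ n τ, τ.reg c = n + 1 → I (n + 1) τ → Wp w b Z s
      ⟨fun i => if i = c then n else τ.reg i, τ.A, τ.B⟩ fun ρ => ρ.reg c = n ∧ I n ρ)
    (hQ : ∀ τ, τ.reg c = 0 → I 0 τ → Q τ) :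
    Wp w b Z (.loop c s) σ Q := by
  generalize hn : σ.reg c = n at hI
  induction n generalizing σ with
  | zero =>
    refine ⟨_, .loop_zero (hZ _ _ hI) hn, ?_⟩
    have : (Act.dec.sem w b c σ).1 = σ := by
      simp only [Act.sem, hn]
      have : (fun i => if i = c then 0 - 1 else σ.reg i) = σ.reg := by
        funext i; split_ifs with h <;> simp [h, hn]
      rw [this]
    rw [this]
    exact hQ _ hn hI
  | succ n ih =>
    obtain ⟨τ, h1, h2, h3⟩ := hs n σ hn hI
    obtain ⟨ρ, h4, h5⟩ := ih h2 h3
    refine ⟨ρ, .loop_succ (hZ _ _ hI) (by omega) ?_ h4, h5⟩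
    simpa [Act.sem, hn] using h1

end Wp
end Stmt
namespace Stmt

/-- The statement stores `F` of the registers in register `out`, and leaves both arrays and all
other registers below `m` unchanged. -/
def Computes (s : Stmt) (m out : ℕ) (F : (ℕ → ℕ) → ℕ) : Prop :=
  ∀ w b Z σ, Z σ.A → Wp w b Z s σ fun τ => τ.A = σ.A ∧ τ.B = σ.B ∧ τ.reg out = F σ.reg ∧
    ∀ c < m, c ≠ out → τ.reg c = σ.reg c

/-- Reset a register. -/
def setZero (c : ℕ) : Stmt := .loop c (.act .rdA c)

theorem computes_setZero (m c : ℕ) : (setZero c).Computes m c fun _ => 0 := by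
  intro w b Z σ hZ
  refine Wp.loop (fun _ τ => τ.A = σ.A ∧ τ.B = σ.B ∧ ∀ i, i ≠ c → τ.reg i = σ.reg i)
    (fun n τ h => h.1 ▸ hZ) ⟨rfl, rfl, fun _ _ => rfl⟩ ?_ ?_
  · rintro n τ hn ⟨h1, h2, h3⟩
    refine Wp.act (by simpa [h1] using hZ) (by simpa [Act.sem, h1] using hZ) ?_
    refine ⟨by simp [Act.sem], h1, h2, fun i hi => ?_⟩
    simpa [Act.sem, hi] using h3 i hi
  · rintro τ h0 ⟨h1, h2, h3⟩
    exact ⟨h1, h2, h0, fun i _ hi => h3 i hi⟩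

/-- Copy register `x` to register `y`, using register `t`. -/
def copy (x y t : ℕ) : Stmt :=
  .seq (setZero y) (.seq (setZero t) (.seq (.loop x (.seq (.act .inc y) (.act .inc t)))
    (.loop t (.act .inc x))))

theorem computes_copy {m x y : ℕ} (hx : x < m) (hy : y < m) (hxy : x ≠ y) :
    (copy x y m).Computes m y fun ρ => ρ x := by
  intro w b Z σ hZ
  refine (Wp.mono (computes_setZero (m + 1) y w b Z σ hZ) ?_).seq
  rintro σ₁ ⟨a1, b1, c1, d1⟩
  rw [← a1] at hZ
  refine (Wp.mono (computes_setZero (m + 1) m w b Z σ₁ hZ) ?_).seq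
  rintro σ₂ ⟨a2, b2, c2, d2⟩
  rw [← a2] at hZ
  refine Wp.seq (Wp.loop (fun n τ => τ.A = σ₂.A ∧ τ.B = σ₂.B ∧ τ.reg y + n = σ.reg x ∧
    τ.reg m + n = σ.reg x ∧ ∀ i < m, i ≠ x → i ≠ y → τ.reg i = σ₂.reg i)
    (fun n τ h => h.1 ▸ hZ) ?_ ?_ ?_)
  · have e1 := d1 x (by omega) hxy
    dsimp only at c1 c2
    have e2 := d2 x (by omega) (by omega)
    have e3 := d2 y (by omega) (by omega)
    exact ⟨rfl, rfl, by omega, by omega, fun _ _ _ _ => rfl⟩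
  · rintro n τ hn ⟨h1, h2, h3, h4, h5⟩
    have hZ' : Z τ.A := h1 ▸ hZ
    refine Wp.seq (Wp.act hZ' hZ' (Wp.act hZ' hZ' ?_))
    refine ⟨?_, h1, h2, ?_, ?_, fun i h6 h7 h8 => ?_⟩
    · simp [Act.sem, hxy, show x ≠ m by omega]
    · simp [Act.sem, hxy.symm, show y ≠ m by omega]; omega
    · simp [Act.sem, show m ≠ x by omega, show m ≠ y by omega]; omega
    · simp [Act.sem, show i ≠ m by omega, h7, h8]; exact h5 i h6 h7 h8
  · rintro τ h0 ⟨h1, h2, h3, h4, h5⟩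
    have hZ' : Z τ.A := h1 ▸ hZ
    refine Wp.loop (fun n ρ => ρ.A = τ.A ∧ ρ.B = τ.B ∧ ρ.reg x + n = σ.reg x ∧
      ∀ i < m, i ≠ x → ρ.reg i = τ.reg i) (fun n τ h => h.1 ▸ hZ') ?_ ?_ ?_
    · exact ⟨rfl, rfl, by omega, fun _ _ _ => rfl⟩
    · rintro n ρ hn ⟨g1, g2, g3, g4⟩
      have hZ'' : Z ρ.A := g1 ▸ hZ'
      refine Wp.act hZ'' hZ'' ⟨?_, g1, g2, ?_, fun i h6 h7 => ?_⟩
      · simp [Act.sem, show m ≠ x by omega]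
      · simp [Act.sem, show x ≠ m by omega]; omega
      · simp [Act.sem, h7, show i ≠ m by omega]; exact g4 i h6 h7
    · rintro ρ g0 ⟨g1, g2, g3, g4⟩
      refine ⟨by rw [g1, h1, a2, a1], by rw [g2, h2, b2, b1], ?_, fun i hi hiy => ?_⟩
      · rw [g4 y hy hxy.symm]; omega
      · by_cases hix : i = x
        · subst hix; omega
        · rw [g4 i hi hix, h5 i hi hix hiy, d2 i (by omega) (by omega), d1 i (by omega) hiy]

theorem bounded_copy {m x y t M : ℕ} (hx : x < M) (hy : y < M) (ht : t < M) :
    (copy x y t).Bounded m M := by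
  simp [copy, setZero, Bounded, Act.Bounded, hx, hy, ht]

/-- Every primitive recursive function is computed by a statement. -/
theorem exists_computes {n : ℕ} {f : List.Vector ℕ n → ℕ} (hf : Nat.Primrec' f) (m : ℕ)
    (ins : Fin n → ℕ) (out : ℕ) (hins : ∀ i, ins i < m) (hout : out < m)
    (hne : ∀ i, ins i ≠ out) :
    ∃ s : Stmt, ∃ M, s.Bounded 0 M ∧
      s.Computes m out fun ρ => f (List.Vector.ofFn fun i => ρ (ins i)) := by
  induction hf generalizing m out with
  | zero =>
    exact ⟨setZero out, out + 1, by simp [setZero, Bounded, Act.Bounded], computes_setZero _ _⟩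
  | @succ =>
    refine ⟨.seq (copy (ins 0) out m) (.act .inc out), m + 1, ⟨bounded_copy
      (by have := hins 0; omega) (by omega) (by omega), by omega, trivial⟩, ?_⟩
    intro w b Z σ hZ
    refine (Wp.mono (computes_copy (hins 0) hout (hne 0) w b Z σ hZ) ?_).seq
    rintro τ ⟨h1, h2, h3, h4⟩
    have hZ' : Z τ.A := h1 ▸ hZ
    refine Wp.act hZ' hZ' ⟨h1, h2, ?_, fun c hc hc' => ?_⟩
    · simp [Act.sem, h3]
    · simp [Act.sem, hc', h4 c hc hc']
  | get i =>
    refine ⟨copy (ins i) out m, m + 1, bounded_copy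
      (by have := hins i; omega) (by omega) (by omega), ?_⟩
    simpa using computes_copy (hins i) hout (hne i)
  | @comp k n f g hf hg ihf ihg =>
    have key : ∀ j ≤ n, ∃ s : Stmt, ∃ M, s.Bounded 0 M ∧ ∀ w b Z σ, Z σ.A → Wp w b Z s σ
        fun τ => τ.A = σ.A ∧ τ.B = σ.B ∧ (∀ c < m, τ.reg c = σ.reg c) ∧
          ∀ i : Fin n, (i : ℕ) < j →
            τ.reg (m + i) = g i (List.Vector.ofFn fun i => σ.reg (ins i)) := by
      intro j hj
      induction j with
      | zero =>
        refine ⟨.act .rdA 0, 1, ⟨by omega, trivial⟩, fun w b Z σ hZ => Wp.act hZ hZ ?_⟩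
        exact ⟨rfl, rfl, fun _ _ => rfl, fun i hi => by omega⟩
      | succ j ih =>
        obtain ⟨s, M, hb, hs⟩ := ih (by omega)
        obtain ⟨t, M', hb', ht⟩ := ihg ⟨j, by omega⟩ (m + n) ins (m + j)
          (fun i => by have := hins i; omega) (by omega) (fun i => by have := hins i; omega)
        refine ⟨.seq s t, max M M', ⟨hb.mono le_rfl (by simp), hb'.mono le_rfl (by simp)⟩, ?_⟩
        intro w b Z σ hZ
        refine (Wp.mono (hs w b Z σ hZ) ?_).seq
        rintro τ ⟨h1, h2, h3, h4⟩
        have hZ' : Z τ.A := h1 ▸ hZ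
        refine Wp.mono (ht w b Z τ hZ') ?_
        rintro ρ ⟨g1, g2, g3, g4⟩
        refine ⟨g1.trans h1, g2.trans h2, fun c hc => ?_, fun i hi => ?_⟩
        · rw [g4 c (by omega) (by omega), h3 c hc]
        · by_cases e : (i : ℕ) = j
          · obtain ⟨i, hi'⟩ := i
            dsimp only at e
            subst e
            rw [g3]
            simp only [h3 _ (hins _)]
          · rw [g4 _ (by omega) (by omega), h4 i (by omega)]
    obtain ⟨s, M, hb, hs⟩ := key n le_rfl
    obtain ⟨t, M', hb', ht⟩ := ihf (m + n) (fun i => m + i) out (fun i => by omega) (by omega)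
      (fun i => by omega)
    refine ⟨.seq s t, max M M', ⟨hb.mono le_rfl (by simp), hb'.mono le_rfl (by simp)⟩, ?_⟩
    intro w b Z σ hZ
    refine (Wp.mono (hs w b Z σ hZ) ?_).seq
    rintro τ ⟨h1, h2, h3, h4⟩
    refine Wp.mono (ht w b Z τ (h1 ▸ hZ)) ?_
    rintro ρ ⟨g1, g2, g3, g4⟩
    refine ⟨g1.trans h1, g2.trans h2, ?_, fun c hc hc' => ?_⟩
    · rw [g3]; simp only [h4 _ (Fin.is_lt _)]
    · rw [g4 c (by omega) hc', h3 c hc]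
  | @prec n f g hf hg ihf ihg =>
    obtain ⟨s, M, hbs, hs⟩ := ihf (m + 5) (fun i => ins i.succ) (m + 2)
      (fun i => by have := hins i.succ; omega) (by omega) (fun i => by have := hins i.succ; omega)
    obtain ⟨t, M', hbt, ht⟩ := ihg (m + 5)
      (Fin.cons (m + 1) (Fin.cons (m + 2) fun i => ins i.succ)) (m + 3)
      (by
        intro i
        refine Fin.cases ?_ (fun i => Fin.cases ?_ (fun i => ?_) i) i
        · simp
        · simp
        · have := hins i.succ; simp; omega) (by omega)
      (by
        intro i
        refine Fin.cases ?_ (fun i => Fin.cases ?_ (fun i => ?_) i) i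
        · simp
        · simp
        · have := hins i.succ; simp; omega)
    refine ⟨.seq (copy (ins 0) m (m + 5)) (.seq (setZero (m + 1)) (.seq s
      (.seq (.loop m (.seq t (.seq (copy (m + 3) (m + 2) (m + 5)) (.act .inc (m + 1)))))
        (copy (m + 2) out (m + 5))))), max (max M M') (m + 6), ?_, ?_⟩
    · refine ⟨bounded_copy ?_ ?_ ?_, ⟨?_, ?_, trivial⟩, hbs.mono le_rfl ?_,
        ⟨?_, hbt.mono le_rfl ?_, bounded_copy ?_ ?_ ?_, ?_, trivial⟩, bounded_copy ?_ ?_ ?_⟩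
      all_goals try omega
      have := hins 0
      omega
    intro w b Z σ hZ
    refine (Wp.mono (computes_copy (m := m + 5) (by have := hins 0; omega) (by omega)
      (by have := hins 0; omega) w b Z σ hZ) ?_).seq
    rintro σ₁ ⟨a1, b1, c1, d1⟩
    rw [← a1] at hZ
    refine (Wp.mono (computes_setZero (m + 5) (m + 1) w b Z σ₁ hZ) ?_).seq
    rintro σ₂ ⟨a2, b2, c2, d2⟩
    rw [← a2] at hZ
    refine (Wp.mono (hs w b Z σ₂ hZ) ?_).seq
    rintro σ₃ ⟨a3, b3, c3, d3⟩
    rw [← a3] at hZ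
    dsimp only at c1 c2 c3
    set v : List.Vector ℕ n := List.Vector.ofFn fun i => σ.reg (ins i.succ) with hv
    let rec' : ℕ → ℕ := fun k => Nat.rec (f v) (fun y IH => g (y ::ᵥ IH ::ᵥ v)) k
    have hm : ∀ c < m, σ₃.reg c = σ.reg c := fun c hc => by
      rw [d3 c (by omega) (by omega), d2 c (by omega) (by omega), d1 c (by omega) (by omega)]
    refine Wp.seq (Wp.loop (fun k τ => τ.A = σ₃.A ∧ τ.B = σ₃.B ∧ (∀ c < m, τ.reg c = σ.reg c) ∧
      ∃ j, j + k = σ.reg (ins 0) ∧ τ.reg (m + 1) = j ∧ τ.reg (m + 2) = rec' j)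
      (fun n τ h => h.1 ▸ hZ) ?_ ?_ ?_)
    · refine ⟨rfl, rfl, hm, 0, ?_, ?_, ?_⟩
      · rw [d3 m (by omega) (by omega), d2 m (by omega) (by omega), c1]; omega
      · rw [d3 _ (by omega) (by omega), c2]
      · rw [c3]
        have : ∀ i : Fin n, σ₂.reg (ins i.succ) = σ.reg (ins i.succ) := fun i => by
          have := hins i.succ
          rw [d2 _ (by omega) (by omega), d1 _ (by omega) (by omega)]
        simp only [this]
        rfl
    · rintro k τ hk ⟨h1, h2, h3, j, h4, h5, h6⟩
      rw [← h1] at hZ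
      refine Wp.seq (Wp.mono (ht w b Z ⟨_, τ.A, _⟩ hZ) ?_)
      rintro τ₁ ⟨e1, f1, g1, i1⟩
      dsimp only at e1 f1
      rw [← e1] at hZ
      refine (Wp.mono (computes_copy (m := m + 5) (x := m + 3) (y := m + 2) (by omega) (by omega)
        (by omega) w b Z τ₁ hZ) ?_).seq
      rintro τ₂ ⟨e2, f2, g2, i2⟩
      rw [← e2] at hZ
      refine Wp.act hZ hZ ⟨?_, ?_, ?_, fun c hc => ?_, j + 1, by omega, ?_, ?_⟩
      · simp only [Act.sem]
        rw [if_neg (by omega), i2 m (by omega) (by omega), i1 m (by omega) (by omega)]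
        simp
      · simp only [Act.sem, e2, e1, h1]
      · simp only [Act.sem, f2, f1, h2]
      · simp only [Act.sem]
        rw [if_neg (by omega), i2 c (by omega) (by omega), i1 c (by omega) (by omega)]
        dsimp only
        rw [if_neg (by omega), h3 c hc]
      · simp only [Act.sem, if_true]
        rw [i2 _ (by omega) (by omega), i1 _ (by omega) (by omega)]
        dsimp only
        rw [if_neg (by omega), h5]
      · simp only [Act.sem]
        dsimp only at g1 g2
        rw [if_neg (by omega), g2, g1]
        change _ = g (j ::ᵥ rec' j ::ᵥ v)
        congr 1
        rw [List.Vector.ofFn, List.Vector.ofFn]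
        simp only [Fin.cons_zero, Fin.cons_succ]
        rw [if_neg (by omega), if_neg (by omega), h5, h6, hv]
        have : ∀ i : Fin n, (if ins i.succ = m then k else τ.reg (ins i.succ)) =
            σ.reg (ins i.succ) := fun i => by
          have := hins i.succ
          rw [if_neg (by omega), h3 _ this]
        simp only [this]
    · rintro τ h0 ⟨h1, h2, h3, j, h4, h5, h6⟩
      rw [← h1] at hZ
      refine Wp.mono (computes_copy (m := m + 5) (x := m + 2) (y := out) (by omega) (by omega)
        (by omega) w b Z τ hZ) ?_
      rintro τ₁ ⟨e1, f1, g1, i1⟩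
      refine ⟨by rw [e1, h1, a3, a2, a1], by rw [f1, h2, b3, b2, b1], ?_, fun c hc hc' => ?_⟩
      · dsimp only at g1 ⊢
        rw [g1, h6, List.Vector.ofFn]
        simp only [add_zero] at h4
        simp [rec', h4, hv]
      · rw [i1 c (by omega) hc', h3 c hc]

end Stmt

/-- The code of the list `[f (k - 1), …, f 0]`. -/
def load (f : R) : ℕ → ℕ
  | 0 => 0
  | k + 1 => Nat.succ (Nat.pair (f k).toNat (load f k))

theorem load_congr {f g : R} {k : ℕ} (h : ∀ i < k, f i = g i) : load f k = load g k := by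
  induction k with
  | zero => rfl
  | succ k ih => rw [load, load, h k (by omega), ih fun i hi => h i (by omega)]

namespace Stmt

/-- A statement pushing the element `v` to the list coded by register `c`. -/
theorem exists_push (c v : ℕ) (hc : c < 8) : ∃ s : Stmt, ∃ M, s.Bounded 0 M ∧
    s.Computes 8 c fun ρ => Nat.succ (Nat.pair v (ρ c)) := by
  have hp : Primrec fun x : List.Vector ℕ 1 => Nat.succ (Nat.pair v (x.get 0)) :=
    Primrec.succ.comp (Primrec₂.natPair.comp (Primrec.const v)
      (Primrec.vector_get.comp Primrec.id (Primrec.const 0)))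
  obtain ⟨s, M, hb, hs⟩ := exists_computes (Nat.Primrec'.of_prim hp) 9 (fun _ => c) 8
    (fun _ => by omega) (by omega) (fun _ => by omega)
  refine ⟨.seq s (copy 8 c 9), max M 10, ⟨hb.mono le_rfl (by omega), bounded_copy (by omega)
    (by omega) (by omega)⟩, fun w b Z σ hZ => ((hs w b Z σ hZ).mono ?_).seq⟩
  rintro τ ⟨h1, h2, h3, h4⟩
  refine (computes_copy (m := 9) (x := 8) (y := c) (by omega) (by omega) (by omega) w b Z τ
    (h1 ▸ hZ)).mono ?_
  rintro ρ ⟨g1, g2, g3, g4⟩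
  refine ⟨g1.trans h1, g2.trans h2, ?_, fun i hi hic => ?_⟩
  · dsimp only at g3 h3
    rw [g3, h3]
    simp
  · rw [g4 i (by omega) hic, h4 i (by omega) (by omega)]

/-- Push the bit returned by the action `a` on register `7` to the list in register `c`. -/
theorem exists_push_bit (c : ℕ) (hc : c < 8) : ∃ s : Act → Stmt, ∃ M, 8 ≤ M ∧
    (∀ b a, Act.Bounded b M a 7 → (s a).Bounded b M) ∧
    ∀ w b Z a σ, Z σ.A → (a.sem w b 7 σ).1 = σ → Wp w b Z (s a) σ fun τ =>
      τ.A = σ.A ∧ τ.B = σ.B ∧ τ.reg c = Nat.succ (Nat.pair (a.sem w b 7 σ).2.toNat (σ.reg c)) ∧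
      ∀ i < 8, i ≠ c → τ.reg i = σ.reg i := by
  obtain ⟨s, M, hb, hs⟩ := exists_push c 1 hc
  obtain ⟨t, M', hb', ht⟩ := exists_push c 0 hc
  refine ⟨fun a => .ite a 7 s t, max (max M M') 8, by omega, fun b a ha =>
    ⟨ha, hb.mono (by omega) (by omega), hb'.mono (by omega) (by omega)⟩, ?_⟩
  intro w b Z a σ hZ ha
  refine Wp.ite hZ (fun h => ?_) fun h => ?_
  · rw [ha, h]
    exact hs w b Z σ hZ
  · rw [ha, h]
    exact ht w b Z σ hZ

/-- Load the first array elements from `B` into register `3`. -/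
theorem exists_loadB : ∃ s : Stmt, ∃ M, s.Bounded 0 M ∧ ∀ w b Z σ, Z σ.A → Wp w b Z s σ
    fun τ => τ.A = σ.A ∧ τ.B = σ.B ∧ τ.reg 0 = σ.reg 0 ∧ τ.reg 1 = σ.reg 1 ∧
      τ.reg 3 = load σ.B (σ.reg 1) := by
  obtain ⟨s, M, hM, hb, hs⟩ := exists_push_bit 3 (by omega)
  refine ⟨.seq (setZero 3) (.seq (copy 1 2 8) (.seq (setZero 7) (.loop 2
    (.seq (s .rdB) (.act .inc 7))))), max M 10, ⟨⟨by omega, by omega, trivial⟩, bounded_copy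
      (by omega) (by omega) (by omega), ⟨by omega, by omega, trivial⟩, by omega,
      (hb 0 .rdB ⟨by omega, trivial⟩).mono le_rfl (by omega), by omega, trivial⟩, ?_⟩
  intro w b Z σ hZ
  refine ((computes_setZero 8 3 w b Z σ hZ).mono ?_).seq
  rintro σ₁ ⟨a1, b1, c1, d1⟩
  rw [← a1] at hZ
  refine ((computes_copy (m := 8) (x := 1) (y := 2) (by omega) (by omega) (by omega)
    w b Z σ₁ hZ).mono ?_).seq
  rintro σ₂ ⟨a2, b2, c2, d2⟩
  rw [← a2] at hZ
  refine ((computes_setZero 8 7 w b Z σ₂ hZ).mono ?_).seq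
  rintro σ₃ ⟨a3, b3, c3, d3⟩
  rw [← a3] at hZ
  dsimp only at c1 c2 c3
  refine Wp.loop (fun n τ => τ.A = σ₃.A ∧ τ.B = σ.B ∧ τ.reg 0 = σ.reg 0 ∧ τ.reg 1 = σ.reg 1 ∧
    τ.reg 7 + n = σ.reg 1 ∧ τ.reg 3 = load σ.B (τ.reg 7)) (fun n τ h => h.1 ▸ hZ) ?_ ?_ ?_
  · refine ⟨rfl, by rw [b3, b2, b1], ?_, ?_, ?_, ?_⟩
    · rw [d3, d2, d1] <;> omega
    · rw [d3, d2, d1] <;> omega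
    · rw [d3 2, c2, c3, d1] <;> omega
    · rw [d3, d2, c1, c3] <;> first | rfl | omega
  · rintro n τ hn ⟨h1, h2, h3, h4, h5, h6⟩
    rw [← h1] at hZ
    refine Wp.seq (Wp.mono (hs w b Z .rdB ⟨_, τ.A, _⟩ hZ rfl) ?_)
    rintro ρ ⟨g1, g2, g3, g4⟩
    dsimp only [Act.sem] at g1 g2 g3 g4
    have e7 := g4 7 (by omega) (by omega)
    rw [if_neg (by omega)] at e7
    rw [← g1] at hZ
    refine Wp.act hZ hZ ⟨?_, g1.trans h1, g2.trans h2, ?_, ?_, ?_, ?_⟩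
    · simp [Act.sem, g4]
    · simpa [Act.sem, g4] using h3
    · simpa [Act.sem, g4] using h4
    · simp [Act.sem, g4]; omega
    · simp [Act.sem, g3, e7, load, h6, h2]
  · rintro τ h0 ⟨h1, h2, h3, h4, h5, h6⟩
    refine ⟨by rw [h1, a3, a2, a1], h2, h3, h4, ?_⟩
    rw [h6, ← h5, add_zero]

/-- Load blocks of `b` bits of the input into register `4`. -/
theorem exists_loadw : ∃ s : ℕ → Stmt, ∃ M, (∀ b, (s b).Bounded b M) ∧
    ∀ w b Z σ, Z σ.A → Wp w b Z (s b) σ fun τ => τ.A = σ.A ∧ τ.B = σ.B ∧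
      τ.reg 0 = σ.reg 0 ∧ τ.reg 1 = σ.reg 1 ∧ τ.reg 3 = σ.reg 3 ∧
      τ.reg 4 = load w (b * σ.reg 1) := by
  obtain ⟨s, M, hM, hb, hs⟩ := exists_push_bit 4 (by omega)
  have key : ∃ t : ℕ → Stmt, (∀ b, (t b).Bounded b M) ∧ ∀ k w b Z σ, Z σ.A →
      σ.reg 4 = load w (b * σ.reg 7) → Wp w b Z (t k) σ fun τ => τ.A = σ.A ∧ τ.B = σ.B ∧
        τ.reg 4 = load w (b * σ.reg 7 + k) ∧ ∀ i < 8, i ≠ 4 → τ.reg i = σ.reg i := by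
    refine ⟨fun k => Nat.rec (.act .rdA 0) (fun k t => .seq t (s (.rdw k))) k, fun k => ?_,
      fun k w b Z σ hZ h => ?_⟩
    · induction k with
      | zero => exact ⟨by omega, trivial⟩
      | succ k ih => exact ⟨ih.mono (by omega) le_rfl, hb _ _ ⟨by omega, by omega⟩⟩
    · induction k with
      | zero => exact Wp.act hZ hZ ⟨rfl, rfl, h, fun _ _ _ => rfl⟩
      | succ k ih =>
        refine (ih.mono ?_).seq
        rintro τ ⟨h1, h2, h3, h4⟩
        refine (hs w b Z (.rdw k) τ (h1 ▸ hZ) rfl).mono ?_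
        rintro ρ ⟨g1, g2, g3, g4⟩
        refine ⟨g1.trans h1, g2.trans h2, ?_, fun i hi hi' => by rw [g4 i hi hi', h4 i hi hi']⟩
        rw [g3, h3, ← add_assoc, load]
        simp only [Act.sem]
        rw [h4 7 (by omega) (by omega)]
  obtain ⟨t, hbt, ht⟩ := key
  refine ⟨fun b => .seq (setZero 4) (.seq (copy 1 2 8) (.seq (setZero 7) (.loop 2
    (.seq (t b) (.act .inc 7))))), max M 10, fun b => ⟨⟨by omega, by omega, trivial⟩, bounded_copy
      (by omega) (by omega) (by omega), ⟨by omega, by omega, trivial⟩, by omega,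
      (hbt b).mono le_rfl (by omega), by omega, trivial⟩, ?_⟩
  intro w b Z σ hZ
  refine ((computes_setZero 8 4 w b Z σ hZ).mono ?_).seq
  rintro σ₁ ⟨a1, b1, c1, d1⟩
  rw [← a1] at hZ
  refine ((computes_copy (m := 8) (x := 1) (y := 2) (by omega) (by omega) (by omega)
    w b Z σ₁ hZ).mono ?_).seq
  rintro σ₂ ⟨a2, b2, c2, d2⟩
  rw [← a2] at hZ
  refine ((computes_setZero 8 7 w b Z σ₂ hZ).mono ?_).seq
  rintro σ₃ ⟨a3, b3, c3, d3⟩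
  rw [← a3] at hZ
  dsimp only at c1 c2 c3
  refine Wp.loop (fun n τ => τ.A = σ₃.A ∧ τ.B = σ.B ∧ τ.reg 0 = σ.reg 0 ∧ τ.reg 1 = σ.reg 1 ∧
    τ.reg 3 = σ.reg 3 ∧ τ.reg 7 + n = σ.reg 1 ∧ τ.reg 4 = load w (b * τ.reg 7))
    (fun n τ h => h.1 ▸ hZ) ?_ ?_ ?_
  · refine ⟨rfl, by rw [b3, b2, b1], ?_, ?_, ?_, ?_, ?_⟩
    · rw [d3, d2, d1] <;> omega
    · rw [d3, d2, d1] <;> omega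
    · rw [d3, d2, d1] <;> omega
    · rw [d3 2, c2, c3, d1] <;> omega
    · rw [d3, d2, c1, c3] <;> first | rfl | omega
  · rintro n τ hn ⟨h1, h2, h3, h4, h5, h6, h7⟩
    rw [← h1] at hZ
    refine Wp.seq (Wp.mono (ht b w b Z ⟨_, τ.A, _⟩ hZ ?_) ?_)
    · simpa using h7
    rintro ρ ⟨g1, g2, g3, g4⟩
    dsimp only [Act.sem] at g1 g2 g3 g4
    have e7 := g4 7 (by omega) (by omega)
    rw [if_neg (by omega)] at e7
    rw [← g1] at hZ
    refine Wp.act hZ hZ ⟨?_, g1.trans h1, g2.trans h2, ?_, ?_, ?_, ?_, ?_⟩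
    · simp [Act.sem, g4]
    · simpa [Act.sem, g4] using h3
    · simpa [Act.sem, g4] using h4
    · simpa [Act.sem, g4] using h5
    · simp [Act.sem, g4]; omega
    · simp [Act.sem, g3, e7, mul_add]
  · rintro τ h0 ⟨h1, h2, h3, h4, h5, h6, h7⟩
    refine ⟨by rw [h1, a3, a2, a1], h2, h3, h4, h5, ?_⟩
    rw [h7, ← h6, add_zero]

/-- One round: save the array elements up to `L (r + 1)`, compute the value of `F`, and store it
at the position given by the round. -/
theorem exists_round {L : ℕ → ℕ} (hL : Primrec L) {F : ℕ → ℕ → ℕ → ℕ}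
    (hF : Primrec fun x : List.Vector ℕ 3 => F (x.get 0) (x.get 1) (x.get 2)) :
    ∃ s : ℕ → Stmt, ∃ M, (∀ b, (s b).Bounded b M) ∧ ∀ w b (Z : R → Prop) σ y, Z σ.A →
      (∀ k < σ.reg 1, σ.B k = y k) → (∀ k, σ.reg 1 ≤ k → σ.A k = y k) →
      σ.reg 1 ≤ L (σ.reg 0 + 1) →
      let v := decide (F (σ.reg 0) (load y (L (σ.reg 0 + 1))) (load w (b * L (σ.reg 0 + 1))) ≠ 0)
      let A' : R := fun i => if i = (σ.reg 0).unpair.1 then v else σ.A i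
      Z A' → Wp w b Z (s b) σ fun τ => τ.A = A' ∧ τ.reg 0 = σ.reg 0 + 1 ∧
        τ.reg 1 = L (σ.reg 0 + 1) ∧ ∀ k < L (σ.reg 0 + 1), τ.B k = y k := by
  have hD : Primrec fun x : List.Vector ℕ 2 => L (x.get 0 + 1) - x.get 1 :=
    Primrec.nat_sub.comp (hL.comp (Primrec.succ.comp
      (Primrec.vector_get.comp Primrec.id (Primrec.const 0))))
      (Primrec.vector_get.comp Primrec.id (Primrec.const 1))
  have hU : Primrec fun x : List.Vector ℕ 1 => (x.get 0).unpair.1 :=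
    Primrec.fst.comp (Primrec.unpair.comp (Primrec.vector_get.comp Primrec.id (Primrec.const 0)))
  obtain ⟨sD, MD, bD, cD⟩ := exists_computes (Nat.Primrec'.of_prim hD) 8 ![0, 1] 2
    (by intro i; fin_cases i <;> simp) (by omega) (by intro i; fin_cases i <;> simp)
  obtain ⟨sF, MF, bF, cF⟩ := exists_computes (Nat.Primrec'.of_prim hF) 8 ![0, 3, 4] 5
    (by intro i; fin_cases i <;> simp) (by omega) (by intro i; fin_cases i <;> simp)
  obtain ⟨sU, MU, bU, cU⟩ := exists_computes (Nat.Primrec'.of_prim hU) 8 ![0] 6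
    (by intro i; fin_cases i; simp) (by omega) (by intro i; fin_cases i; simp)
  obtain ⟨sB, MB, bB, cB⟩ := exists_loadB
  obtain ⟨sw, Mw, bw, cw⟩ := exists_loadw
  let M := max (max (max MD MF) (max MU MB)) (max Mw 10)
  refine ⟨fun b => .seq sD (.seq (.loop 2 (.ite .rdA 1 (.seq (.act (.wrB true) 1) (.act .inc 1))
    (.seq (.act (.wrB false) 1) (.act .inc 1)))) (.seq sB (.seq (sw b) (.seq sF (.seq sU
      (.seq (.ite .dec 5 (.act (.wrA true) 6) (.act (.wrA false) 6)) (.act .inc 0))))))), M,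
    fun b => ⟨bD.mono (by omega) (by omega), ⟨by omega, ⟨by omega, trivial⟩, ⟨⟨by omega, trivial⟩,
      by omega, trivial⟩, ⟨by omega, trivial⟩, by omega, trivial⟩, bB.mono (by omega) (by omega),
      (bw b).mono (by omega) (by omega), bF.mono (by omega) (by omega),
      bU.mono (by omega) (by omega), ⟨⟨by omega, trivial⟩, ⟨by omega, trivial⟩, by omega, trivial⟩,
      by omega, trivial⟩, ?_⟩
  intro w b Z σ y hZ hB hA hle v A' hZ'
  refine ((cD w b Z σ hZ).mono ?_).seq
  rintro σ₁ ⟨a1, b1, c1, d1⟩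
  have hZ1 := hZ
  rw [← a1] at hZ1
  replace c1 : σ₁.reg 2 = L (σ.reg 0 + 1) - σ.reg 1 := by simpa using c1
  refine Wp.seq (Wp.loop (fun n τ => τ.A = σ.A ∧ τ.reg 0 = σ.reg 0 ∧
    τ.reg 1 + n = L (σ.reg 0 + 1) ∧ σ.reg 1 ≤ τ.reg 1 ∧ ∀ k < τ.reg 1, τ.B k = y k)
    (fun n τ h => h.1 ▸ hZ) ?_ ?_ ?_)
  · have := d1 1 (by omega) (by omega)
    refine ⟨a1, d1 0 (by omega) (by omega), by omega, by omega, fun k hk => ?_⟩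
    rw [b1]
    exact hB k (by omega)
  · rintro n τ hn ⟨h1, h2, h3, h4, h5⟩
    have hZ2 := hZ
    rw [← h1] at hZ2
    have hk : ∀ v, τ.A (τ.reg 1) = v → ∀ k < τ.reg 1 + 1,
        (if k = τ.reg 1 then v else τ.B k) = y k := by
      intro v hv k hk
      split_ifs with e
      · rw [← hv, h1, e, hA _ h4]
      · exact h5 k (by omega)
    refine Wp.ite hZ2 (fun h => ?_) fun h => ?_
    all_goals
      refine Wp.seq (Wp.act hZ2 hZ2 (Wp.act hZ2 hZ2 ?_))
      replace h : τ.A (τ.reg 1) = _ := h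
      simp only [Act.sem]
      refine ⟨by simp, h1, by simpa using h2, by simp; omega, by simp; omega, ?_⟩
      simpa using hk _ h
  rintro σ₂ - ⟨a2, r2, l2, -, B2⟩
  rw [add_zero] at l2
  rw [← a2] at hZ
  refine ((cB w b Z σ₂ hZ).mono ?_).seq
  rintro σ₃ ⟨a3, b3, r3, l3, n3⟩
  rw [← a3] at hZ
  refine ((cw w b Z σ₃ hZ).mono ?_).seq
  rintro σ₄ ⟨a4, b4, r4, l4, n4, w4⟩
  rw [← a4] at hZ
  refine ((cF w b Z σ₄ hZ).mono ?_).seq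
  rintro σ₅ ⟨a5, b5, c5, d5⟩
  rw [← a5] at hZ
  refine ((cU w b Z σ₅ hZ).mono ?_).seq
  rintro σ₆ ⟨a6, b6, c6, d6⟩
  rw [← a6] at hZ
  have r6 : σ₆.reg 0 = σ.reg 0 := by
    rw [d6 0 (by omega) (by omega), d5 0 (by omega) (by omega), r4, r3, r2]
  have l6 : σ₆.reg 1 = L (σ.reg 0 + 1) := by
    rw [d6 1 (by omega) (by omega), d5 1 (by omega) (by omega), l4, l3, l2]
  have B6 : σ₆.B = σ₂.B := by rw [b6, b5, b4, b3]
  have A6 : σ₆.A = σ.A := by rw [a6, a5, a4, a3, a2]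
  have p6 : σ₆.reg 6 = (σ.reg 0).unpair.1 := by
    have : σ₅.reg 0 = σ.reg 0 := by rw [d5 0 (by omega) (by omega), r4, r3, r2]
    simp [c6, this]
  have v6 : decide (σ₆.reg 5 ≠ 0) = v := by
    have e1 : load σ₂.B (σ₂.reg 1) = load y (L (σ.reg 0 + 1)) := by
      rw [l2]; exact load_congr fun i hi => B2 i (by omega)
    rw [l2] at e1
    have e2 : σ₄.reg 0 = σ.reg 0 := by rw [r4, r3, r2]
    rw [d6 5 (by omega) (by omega), c5]
    simp only [v]
    congr 2
    simp [e2, n4, n3, e1, w4, l3, l2]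
  have fin : ∀ u, v = u → Wp w b Z (.act (.wrA u) 6) (Act.dec.sem w b 5 σ₆).1 fun τ =>
      Wp w b Z (.act .inc 0) τ fun τ => τ.A = A' ∧ τ.reg 0 = σ.reg 0 + 1 ∧
        τ.reg 1 = L (σ.reg 0 + 1) ∧ ∀ k < L (σ.reg 0 + 1), τ.B k = y k := by
    intro u hu
    have hA' : (fun i => if i = σ₆.reg 6 then u else σ₆.A i) = A' := by
      simp only [p6, A6, A', hu]
    have hs : ((Act.wrA u).sem w b 6 (Act.dec.sem w b 5 σ₆).1).1.A = A' := by
      rw [← hA']; simp [Act.sem]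
    refine Wp.act hZ (hs ▸ hZ') (Wp.act (hs ▸ hZ') (hs ▸ hZ') ⟨hs, ?_, ?_, ?_⟩)
    · simp [Act.sem, r6]
    · simp [Act.sem, l6]
    · intro k hk
      simpa [Act.sem, B6] using B2 k (by omega)
  refine Wp.seq (Wp.ite hZ (fun h => fin true ?_) fun h => fin false ?_)
  · rw [← v6]; exact h
  · rw [← v6]; exact h

end Stmt

theorem Core.exists_times {K : Core} {w : R} {P : ℕ → R → Prop} {c : ℕ → Conf K.S}
    (h : ∀ r, K.Path w (P r) (c r) (c (r + 1))) (hne : ∀ r, c r ≠ c (r + 1)) :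
    ∃ T : ℕ → ℕ, StrictMono T ∧ (∀ r, (K.step w)^[T r] (c 0) = c r) ∧
      ∀ t, ((K.step w)^[t] (c 0)).st ≠ K.halt ∧
        ∃ r, t < T (r + 1) ∧ P r ((K.step w)^[t] (c 0)).t2 := by
  choose d hd hs using fun r => (h r).exists_iterate
  have hpos : ∀ r, 0 < d r := by
    intro r
    rw [Nat.pos_iff_ne_zero]
    intro e
    have := hd r
    rw [e] at this
    exact hne r this
  let T : ℕ → ℕ := fun r => ∑ i ∈ Finset.range r, d i
  have hT : ∀ r, T (r + 1) = T r + d r := fun r => Finset.sum_range_succ _ _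
  have hmono : StrictMono T := strictMono_nat_of_lt_succ fun r => by
    have := hpos r
    rw [hT]; omega
  have hc : ∀ r, (K.step w)^[T r] (c 0) = c r := by
    intro r
    induction r with
    | zero => rfl
    | succ r ih => rw [hT, add_comm, Function.iterate_add_apply, ih, hd]
  refine ⟨T, hmono, hc, fun t => ?_⟩
  have hex : ∃ r, t < T (r + 1) := ⟨t, (Nat.lt_succ_self t).trans_le (hmono.id_le _)⟩
  have h1 := Nat.find_spec hex
  have h2 : T (Nat.find hex) ≤ t := by
    rcases e : Nat.find hex with _ | r
    · simp [T]
    · have := Nat.find_min hex (m := r) (by omega)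
      omega
  have h3 := hs (Nat.find hex) (t - T (Nat.find hex)) (by have := hT (Nat.find hex); omega)
  rw [← hc (Nat.find hex), ← Function.iterate_add_apply, Nat.sub_add_cancel h2] at h3
  exact ⟨h3.1, _, h1, h3.2⟩

section Rounds

variable (g : ℕ → R → Bool) (y : R)

/-- The array after `r` rounds: round `pair j s` stores the bit `g (pair j s) y` at `j`. -/
noncomputable def rounds : ℕ → R
  | 0 => y
  | r + 1 => fun j => if j = r.unpair.1 then g r y else rounds r j

theorem rounds_pair_succ (j s : ℕ) : rounds g y (Nat.pair j s + 1) j = g (Nat.pair j s) y := by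
  simp [rounds]

theorem rounds_of_le {r j : ℕ} (h : r ≤ j) : rounds g y r j = y j := by
  induction r with
  | zero => rfl
  | succ r ih =>
    have := Nat.unpair_left_le r
    simp only [rounds]
    rw [if_neg (by omega), ih (by omega)]

theorem exists_rounds_eq {j s₀ r : ℕ} (h : Nat.pair j s₀ < r) :
    ∃ s ≥ s₀, rounds g y r j = g (Nat.pair j s) y := by
  induction r with
  | zero => omega
  | succ r ih =>
    simp only [rounds]
    split_ifs with e
    · refine ⟨r.unpair.2, ?_, ?_⟩
      · by_contra hlt
        have := Nat.pair_lt_pair_right j (not_le.mp hlt)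
        rw [e, Nat.pair_unpair] at this
        rw [e] at h
        omega
      · rw [e, Nat.pair_unpair]
    · refine ih (lt_of_le_of_ne (by omega) ?_)
      rintro rfl
      simp at e

theorem rounds_eq_true {r j : ℕ} (h : rounds g y r j = true) :
    y j = true ∨ ∃ s, g (Nat.pair j s) y = true := by
  induction r with
  | zero => exact .inl h
  | succ r ih =>
    simp only [rounds] at h
    split_ifs at h with e
    · exact .inr ⟨r.unpair.2, by rw [e, Nat.pair_unpair, h]⟩
    · exact ih h

end Rounds

/-- The transfinite process in which each bit `j` of `y` is replaced by the limit superior of the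
bits `g (pair j s) y`. -/
noncomputable def flow (g : ℕ → R → Bool) (α : Ordinal.{0}) : R :=
  Ordinal.limitRecOn (motive := fun _ => R) α zeroR
    (fun _ y j => decide (∀ s₀, ∃ s ≥ s₀, g (Nat.pair j s) y = true))
    fun α _ ih j => decide (∀ β < α, ∃ γ, β ≤ γ ∧ ∃ hγ : γ < α,
      ih γ hγ j = true ∨ ∃ s, g (Nat.pair j s) (ih γ hγ) = true)

section Flow

variable {g : ℕ → R → Bool}

theorem flow_zero : flow g 0 = zeroR := Ordinal.limitRecOn_zero ..

theorem flow_succ (α : Ordinal) (j : ℕ) : flow g (α + 1) j = true ↔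
    ∀ s₀, ∃ s ≥ s₀, g (Nat.pair j s) (flow g α) = true := by
  rw [flow, Ordinal.limitRecOn_add_one, decide_eq_true_iff]
  rfl

theorem flow_limit {α : Ordinal} (hα : Order.IsSuccLimit α) (j : ℕ) : flow g α j = true ↔
    ∀ β < α, ∃ γ, β ≤ γ ∧ γ < α ∧
      (flow g γ j = true ∨ ∃ s, g (Nat.pair j s) (flow g γ) = true) := by
  rw [flow, Ordinal.limitRecOn_limit _ _ _ _ hα, decide_eq_true_iff]
  simp only [exists_prop]
  rfl

end Flow

/-- The configuration `c` of the core `K` starts a block of `ω` stages with array `y`. -/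
structure Core.Starts (K : Core) (b : ℕ) [NeZero b] (c : Conf K.S) (y : R) : Prop where
  st : c.st = K.start
  head : c.head = 0
  t2 : c.t2 = spread b y

/-- The core `K` performs the rounds of `g w` in each block of `ω` stages, until bit `0` of the
array is set. -/
structure Core.Realizes (K : Core) (b : ℕ) [NeZero b] (g : R → ℕ → R → Bool) : Prop where
  run : ∀ w y c, K.Starts b c y → y 0 = false → ∃ T : ℕ → ℕ, StrictMono T ∧
    (∀ r, ((K.step w)^[T r] c).t2 = spread b (rounds (g w) y r)) ∧
    ∀ t, ((K.step w)^[t] c).st ≠ K.halt ∧ ∃ r, t < T (r + 1) ∧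
      ∀ p, ((K.step w)^[t] c).t2 p = spread b (rounds (g w) y r) p ∨
        ((K.step w)^[t] c).t2 p = spread b (rounds (g w) y (r + 1)) p
  halt : ∀ w y c, K.Starts b c y → y 0 = true → ∃ t,
    ((K.step w)^[t] c).st = K.halt ∧ ((K.step w)^[t] c).t2 = spread b y ∧
    ∀ s < t, ((K.step w)^[s] c).st ≠ K.halt

/-- The bit written in round `r`, if `F` is computed from codes of the known bits. -/
noncomputable def roundBit (L : ℕ → ℕ) (F : ℕ → ℕ → ℕ → ℕ) (b : ℕ) (w : R) (r : ℕ) (y : R) : Bool :=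
  decide (F r (load y (L (r + 1))) (load w (b * L (r + 1))) ≠ 0)

open regMachine in
theorem exists_realizes {L : ℕ → ℕ} (hL : Primrec L) (hL0 : L 0 = 0) (hLm : Monotone L)
    (hLr : ∀ r, r ≤ L r) {F : ℕ → ℕ → ℕ → ℕ}
    (hF : Primrec fun x : List.Vector ℕ 3 => F (x.get 0) (x.get 1) (x.get 2)) :
    ∃ b, ∃ _ : NeZero b, ∃ K : Core, K.Realizes b (roundBit L F b) := by
  obtain ⟨s, M, hb, hs⟩ := Stmt.exists_round hL hF
  let m := max M 2
  obtain ⟨code, hcode⟩ := (s (m + 2)).exists_loaded 0 0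
  have hload := hcode code fun _ _ _ => rfl
  set N := (s (m + 2)).len + 1 with hN
  let T := regMachine m N code
  have hsb : (s (m + 2)).Bounded (m + 2) m := (hb _).mono le_rfl (by omega)
  have hconf : ∀ c y, T.core.Starts (m + 2) c y → ∃ Y,
      c = T.conf .lim 0 Y fun n j => if j = 0 then y n else false := by
    rintro ⟨st, head, t1, t2⟩ y ⟨h1, h2, h3⟩
    obtain ⟨Y, hY⟩ := exists_eq_flat (b := m + 2) t1
    dsimp only at h1 h2 h3
    exact ⟨Y, by rw [h1, h2, h3, hY]; rfl⟩
  refine ⟨m + 2, inferInstance, T.core, ?_, ?_⟩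
  · intro w y c hc hy
    let g := roundBit L F (m + 2) w
    let Inv : ℕ → Conf T.core.S → Prop := fun r c => ∃ σ Y, Represents m σ Y ∧ σ.reg 0 = r ∧
      σ.reg 1 = L r ∧ σ.A = rounds g y r ∧ (∀ k < L r, σ.B k = y k) ∧
      c = atLabel m N code 0 Y (rounds g y r)
    have hInv_t2 : ∀ r c, Inv r c → c.t2 = spread (m + 2) (rounds g y r) := by
      rintro r c ⟨σ, Y, -, -, -, -, -, rfl⟩
      rfl
    have hInv_ne : ∀ r c c', Inv r c → Inv (r + 1) c' → c ≠ c' := by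
      rintro r c c' ⟨σ, Y, h1, h2, -, -, -, rfl⟩ ⟨σ', Y', h1', h2', -, -, -, rfl⟩ e
      have e1 := congrFun (congrArg Conf.t1 e) ((m + 2) * r + regOff m 0)
      simp only [atLabel, BlockMachine.conf, flat_apply] at e1
      have e2 := h1.zero 0 (by omega)
      rw [h2, e1, h1'.ones 0 (by omega) r (by omega)] at e2
      simp at e2
    let P : ℕ → R → Prop := fun r => Between (m + 2) (rounds g y r) (rounds g y (r + 1))
    have hstep : ∀ r c, Inv r c → ∃ c', Inv (r + 1) c' ∧ T.core.Path w (P r) c c' := by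
      rintro r c ⟨σ, Y, h1, h2, h3, h4, h5, rfl⟩
      let Z : R → Prop := fun X => X = rounds g y r ∨ X = rounds g y (r + 1)
      have hA' : (fun i => if i = (σ.reg 0).unpair.1 then decide (F (σ.reg 0)
          (load y (L (σ.reg 0 + 1))) (load w ((m + 2) * L (σ.reg 0 + 1))) ≠ 0) else σ.A i) =
          rounds g y (r + 1) := by
        funext i
        rw [rounds, h4, h2]
        rfl
      obtain ⟨σ', hE, e1, e2, e3, e4⟩ := hs w (m + 2) Z σ y (.inl h4) (by rwa [h3])
        (fun k hk => by rw [h4, rounds_of_le]; have := hLr r; omega)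
        (by rw [h2, h3]; exact hLm (by omega)) (by rw [hA']; exact .inr rfl)
      rw [hA'] at e1
      rw [h2] at e2 e3 e4
      obtain ⟨Y', h6, h7⟩ := hE.path (N := N) hload (by omega) hsb h1
      rw [h4, e1] at h7
      refine ⟨_, ⟨σ', Y', h6, e2, e3, e1, e4, rfl⟩, h7.mono ?_⟩
      rintro X ⟨A, A', hA, hA', h⟩ p
      rcases h p with h | h
      · rcases hA with rfl | rfl
        exacts [.inl h, .inr h]
      · rcases hA' with rfl | rfl
        exacts [.inl h, .inr h]
    choose! nxt hnxt hpath using hstep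
    have hstart : ∃ c₀, Inv 0 c₀ ∧ T.core.Path w (P 0) c c₀ := by
      obtain ⟨Y, rfl⟩ := hconf c y hc
      let Y' : ℕ → Fin (m + 2) → Bool := fun i j =>
        if i = 0 then if j = 1 then Y 0 1 else decide (j = 0) else Y i j
      refine ⟨atLabel m N code 0 Y' y, ⟨⟨fun _ => 0, y, fun k => Y k 1⟩, Y', ⟨?_, ?_, ?_, ?_⟩, rfl,
        hL0.symm, rfl, by simp [hL0], rfl⟩, (T.path_conf (w := w) (by simp [T, regMachine])
          (y := Y' 0) (z := fun j => if j = 0 then y 0 else false) (d := false) ?_ rfl rfl ?_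
          rfl fun _ _ => rfl).mono ?_⟩
      · simp [Y']
      · simp
      · intro c hc
        simp [Y', regOff_ne_zero hc, regOff_ne_one hc]
      · intro k
        by_cases hk : k = 0
        · subst hk; simp [Y']
        · simp [Y', hk]
      · simp only [T, regMachine, hy, if_true, Bool.false_eq_true, if_false, Y']
        congr
        funext j
        by_cases h : j = 1
        · simp [h]
        · simp [h]
      · intro i hi
        simp [Y', hi]
      · intro z hz p
        exact .inl ((hz p).elim id id)
    obtain ⟨c₀, h0, hp0⟩ := hstart
    let cs : ℕ → Conf T.core.S := fun r => Nat.rec c₀ (fun r c => nxt r c) r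
    have hcs : ∀ r, Inv r (cs r) := by
      intro r
      induction r with
      | zero => exact h0
      | succ r ih => exact hnxt r _ ih
    let ds : ℕ → Conf T.core.S := fun r => if r = 0 then c else cs r
    have hd0 : ds 0 = c := rfl
    have hds : ∀ r, ds (r + 1) = cs (r + 1) := fun r => if_neg (by omega)
    obtain ⟨τ, hτ, h1, h2⟩ := Core.exists_times (K := T.core) (w := w) (P := P) (c := ds)
      (by
        rintro (_ | r)
        · exact hp0.trans (hpath 0 _ h0)
        · rw [hds, hds]
          exact hpath _ _ (hcs _))
      (by
        rintro (_ | r)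
        · obtain ⟨σ, Y, -, -, -, -, -, h⟩ := hcs (0 + 1)
          intro e
          have e' := congrArg Conf.st e
          rw [hd0, hds, hc.st, h] at e'
          simp [T, atLabel, BlockMachine.conf, BlockMachine.core, BlockMachine.atState,
            regMachine] at e'
        · rw [hds, hds]
          exact hInv_ne _ _ _ (hcs _) (hcs _))
    rw [hd0] at h1 h2
    refine ⟨τ, hτ, ?_, h2⟩
    rintro (_ | r)
    · rw [h1, hd0, hc.t2]; rfl
    · rw [h1, hds]
      exact hInv_t2 _ _ (hcs _)
  · intro w y c hc hy
    obtain ⟨Y, rfl⟩ := hconf c y hc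
    have := (T.path_conf (w := w) (q := .lim) (q' := .halt) (n := 0) (n' := 1) (Y := Y) (Y' := Y)
      (Z := fun n j => if j = 0 then y n else false) (Z' := fun n j => if j = 0 then y n else false)
      (by simp [T, regMachine]) (y := Y 0) (z := fun j => if j = 0 then y 0 else false) (d := true)
      (by simp [T, regMachine, hy]) rfl rfl (fun _ _ => rfl) rfl fun _ _ => rfl).exists_iterate
    obtain ⟨t, ht, hs⟩ := this
    exact ⟨t, by rw [ht]; rfl, by rw [ht]; rfl, fun s hst => (hs s hst).1⟩

open Ordinal in
theorem exists_eq_omega0_mul_add (α : Ordinal.{0}) : ∃ (η : Ordinal) (k : ℕ), α = ω * η + k := by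
  obtain ⟨k, hk⟩ := lt_omega0.mp (mod_lt α omega0_ne_zero)
  exact ⟨α / ω, k, by rw [← hk, div_add_mod]⟩

open Ordinal in
theorem omega0_mul_add_lt {η η' : Ordinal.{0}} (h : η < η') (k : ℕ) : ω * η + k < ω * η' := by
  refine lt_of_lt_of_le (add_lt_add_right (natCast_lt_omega0 k) _) ?_
  rw [← mul_add_one]
  exact mul_le_mul_right (Order.add_one_le_of_lt h) _

open Ordinal in
theorem isSuccLimit_omega0_mul {η : Ordinal.{0}} (h : η ≠ 0) : Order.IsSuccLimit (ω * η) :=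
  isSuccLimit_mul_left isSuccLimit_omega0 (pos_iff_ne_zero.mpr h)

/-- A cofinality condition below `ω * (η + 1)` in terms of natural numbers. -/
theorem forall_lt_omega0_mul_succ {η : Ordinal.{0}} {P : Ordinal.{0} → Prop} :
    (∀ β < Ordinal.omega0 * (η + 1), ∃ γ, β ≤ γ ∧ γ < Ordinal.omega0 * (η + 1) ∧ P γ) ↔
      ∀ n : ℕ, ∃ k ≥ n, P (Ordinal.omega0 * η + (k : ℕ)) := by
  constructor
  · intro h n
    obtain ⟨γ, h1, h2, h3⟩ := h (Ordinal.omega0 * η + n) (omega0_mul_add_lt (lt_add_one η) n)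
    obtain ⟨δ, k, rfl⟩ := exists_eq_omega0_mul_add γ
    have hδ : δ = η := by
      refine le_antisymm ?_ ?_
      · by_contra hlt
        rw [not_le] at hlt
        refine absurd h2 (not_lt.mpr ?_)
        exact (mul_le_mul_right (Order.add_one_le_of_lt hlt) _).trans (le_add_right le_rfl)
      · by_contra hlt
        rw [not_le] at hlt
        have := omega0_mul_add_lt hlt k
        exact absurd (h1.trans_lt this) (not_lt.mpr (le_add_right le_rfl))
    subst hδ
    refine ⟨k, ?_, h3⟩
    have := (add_le_add_iff_left _).mp h1
    exact_mod_cast this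
  · intro h β hβ
    obtain ⟨δ, n, rfl⟩ := exists_eq_omega0_mul_add β
    obtain ⟨k, hk, hP⟩ := h n
    refine ⟨_, ?_, omega0_mul_add_lt (lt_add_one η) k, hP⟩
    have hδ : δ ≤ η := by
      by_contra hlt
      rw [not_le] at hlt
      refine absurd hβ (not_lt.mpr ?_)
      exact (mul_le_mul_right (Order.add_one_le_of_lt hlt) _).trans (le_add_right le_rfl)
    exact add_le_add (mul_le_mul_right hδ _) (by exact_mod_cast hk)

/-- A cofinality condition below `ω * η` for a limit ordinal `η`, in terms of blocks. -/
theorem forall_lt_omega0_mul_limit {η : Ordinal.{0}} (hη : Order.IsSuccLimit η)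
    {P : Ordinal.{0} → Prop} :
    (∀ β < Ordinal.omega0 * η, ∃ γ, β ≤ γ ∧ γ < Ordinal.omega0 * η ∧ P γ) ↔
      ∀ β < η, ∃ γ, β ≤ γ ∧ γ < η ∧ ∃ k : ℕ, P (Ordinal.omega0 * γ + k) := by
  constructor
  · intro h β hβ
    obtain ⟨γ, h1, h2, h3⟩ := h (Ordinal.omega0 * β) (by simpa using omega0_mul_add_lt hβ 0)
    obtain ⟨δ, k, rfl⟩ := exists_eq_omega0_mul_add γ
    refine ⟨δ, ?_, ?_, k, h3⟩
    · by_contra hlt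
      exact absurd h1 (not_le.mpr (omega0_mul_add_lt (not_le.mp hlt) k))
    · by_contra hlt
      refine absurd h2 (not_lt.mpr ?_)
      exact (mul_le_mul_right (not_lt.mp hlt) _).trans (le_add_right le_rfl)
  · intro h β hβ
    obtain ⟨δ, n, rfl⟩ := exists_eq_omega0_mul_add β
    have hδ : δ < η := by
      by_contra hlt
      refine absurd hβ (not_lt.mpr ?_)
      exact (mul_le_mul_right (not_lt.mp hlt) _).trans (le_add_right le_rfl)
    have hδ' : δ + 1 < η := by simpa using hη.succ_lt hδ
    obtain ⟨γ, h1, h2, k, h3⟩ := h _ hδ'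
    refine ⟨_, ?_, omega0_mul_add_lt h2 k, h3⟩
    have : δ < γ := (lt_add_one δ).trans_le h1
    exact (omega0_mul_add_lt this n).le.trans (le_add_right le_rfl)

namespace Core

variable {K : Core} {w : R}

theorem IsRun.add_nat {c : Ordinal → Conf K.S} (h : K.IsRun w c) (α : Ordinal) (n : ℕ) :
    c (α + n) = (K.step w)^[n] (c α) := by
  induction n with
  | zero => simp
  | succ n ih => rw [Function.iterate_succ_apply', ← ih, ← h.succ, Nat.cast_succ, add_assoc]

open Ordinal in
theorem Realizes.starts {b : ℕ} [NeZero b] {g : R → ℕ → R → Bool} (hK : K.Realizes b g)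
    {c : Ordinal → Conf K.S} (h : K.IsRun w c) (α : Ordinal)
    (hα : ∀ β < α, flow (g w) β 0 = false) : K.Starts b (c (ω * α)) (flow (g w) α) := by
  induction α using WellFoundedLT.induction with
  | ind α ih =>
  have hst : ∀ β < α, K.Starts b (c (ω * β)) (flow (g w) β) := fun β hβ =>
    ih β hβ fun γ hγ => hα γ (hγ.trans hβ)
  have hrun := fun β (hβ : β < α) => hK.run w _ _ (hst β hβ) (hα β hβ)
  have hoff : ∀ β < α, ∀ (k : ℕ) p, p % b ≠ 0 → (c (ω * β + k)).t2 p = false := by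
    intro β hβ k p hp
    obtain ⟨T, -, -, hT⟩ := hrun β hβ
    obtain ⟨-, r, -, hr⟩ := hT k
    rw [h.add_nat]
    rcases hr p with e | e <;> rw [e, spread_apply, if_neg hp]
  rcases eq_or_ne α 0 with rfl | h0
  · rw [mul_zero, h.zero, flow_zero]
    refine ⟨rfl, rfl, ?_⟩
    funext p
    simp [spread_apply, zeroR]
  obtain ⟨h1, h2, h3⟩ := h.limit _ (isSuccLimit_omega0_mul h0)
  refine ⟨h1, h2, ?_⟩
  funext p
  rw [Bool.eq_iff_iff, h3 p, spread_apply]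
  rcases Ordinal.zero_or_succ_or_isSuccLimit α with rfl | ⟨β, rfl⟩ | hlim
  · exact absurd rfl h0
  · rw [Order.succ_eq_add_one] at *
    have hβ : β < β + 1 := lt_add_one β
    rw [forall_lt_omega0_mul_succ]
    split_ifs with hp
    · obtain ⟨T, hT1, hT2, hT3⟩ := hrun β hβ
      have hp' : p = b * (p / b) := by
        have := Nat.div_add_mod p b
        omega
      rw [flow_succ]
      simp only [h.add_nat]
      constructor
      · intro hc s₀
        obtain ⟨k, hk, hk'⟩ := hc (T (Nat.pair (p / b) s₀ + 1))
        obtain ⟨-, r, hr, hr'⟩ := hT3 k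
        have hr2 := hT1.lt_iff_lt.mp (hk.trans_lt hr)
        have := hr' p
        rw [hp', spread_mul, spread_mul, ← hp', hk'] at this
        rcases this with e | e
        · obtain ⟨s, hs, e'⟩ := exists_rounds_eq (g w) (flow (g w) β) (r := r) (j := p / b)
            (s₀ := s₀) (by omega)
          exact ⟨s, hs, by rw [← e', ← e]⟩
        · obtain ⟨s, hs, e'⟩ := exists_rounds_eq (g w) (flow (g w) β) (r := r + 1) (j := p / b)
            (s₀ := s₀) (by omega)
          exact ⟨s, hs, by rw [← e', ← e]⟩
      · intro hs n
        obtain ⟨s, hs, e⟩ := hs n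
        refine ⟨T (Nat.pair (p / b) s + 1), ?_, ?_⟩
        · have e1 := hT1.id_le (Nat.pair (p / b) s + 1)
          have e2 := Nat.right_le_pair (p / b) s
          simp only [id] at e1
          omega
        · rw [hT2, hp', spread_mul, ← hp', rounds_pair_succ, e]
    · simp only [hoff β hβ _ p hp]
      simp
  · rw [forall_lt_omega0_mul_limit hlim]
    split_ifs with hp
    · have hp' : p = b * (p / b) := by
        have := Nat.div_add_mod p b
        omega
      rw [flow_limit hlim]
      refine forall_congr' fun β => forall_congr' fun hβ => exists_congr fun γ =>
        and_congr_right fun _ => and_congr_right fun hγ => ?_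
      obtain ⟨T, hT1, hT2, hT3⟩ := hrun γ hγ
      simp only [h.add_nat]
      constructor
      · rintro ⟨k, hk⟩
        obtain ⟨-, r, hr, hr'⟩ := hT3 k
        have := hr' p
        rw [hp', spread_mul, spread_mul, ← hp', hk] at this
        rcases this with e | e <;> exact rounds_eq_true _ _ e.symm
      · rintro (e | ⟨s, e⟩)
        · refine ⟨T 0, ?_⟩
          rw [hT2, hp', spread_mul]
          exact e
        · refine ⟨T (Nat.pair (p / b) s + 1), ?_⟩
          rw [hT2, hp', spread_mul, ← hp', rounds_pair_succ, e]
    · simp only [iff_false, not_forall]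
      refine ⟨0, hlim.bot_lt, ?_⟩
      rintro ⟨γ, -, hγ, k, e⟩
      rw [hoff γ hγ k p hp] at e
      simp at e

open Ordinal in
theorem Realizes.not_halt {b : ℕ} [NeZero b] {g : R → ℕ → R → Bool} (hK : K.Realizes b g)
    {c : Ordinal → Conf K.S} (h : K.IsRun w c) {α : Ordinal}
    (hα : ∀ β < α, flow (g w) β 0 = false) {β : Ordinal} (hβ : β < ω * α) :
    (c β).st ≠ K.halt := by
  obtain ⟨δ, n, rfl⟩ := exists_eq_omega0_mul_add β
  have hδ : δ < α := by
    by_contra hlt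
    refine absurd hβ (not_lt.mpr ?_)
    exact (mul_le_mul_right (not_lt.mp hlt) _).trans (le_add_right le_rfl)
  obtain ⟨T, -, -, hT⟩ := hK.run w _ _ (hK.starts h δ fun γ hγ => hα γ (hγ.trans hδ)) (hα δ hδ)
  rw [h.add_nat]
  exact (hT n).1

open Ordinal in
/-- The core halts if bit `0` of the flow is ever set; the output is then the current array. -/
theorem Realizes.halts {b : ℕ} [NeZero b] {g : R → ℕ → R → Bool} (hK : K.Realizes b g)
    {c : Ordinal → Conf K.S} (h : K.IsRun w c) {α : Ordinal}
    (hα : ∀ β < α, flow (g w) β 0 = false) (h1 : flow (g w) α 0 = true) :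
    ∃ γ, (c γ).st = K.halt ∧ (∀ β < γ, (c β).st ≠ K.halt) ∧
      (c γ).t2 = spread b (flow (g w) α) := by
  obtain ⟨t, ht1, ht2, ht3⟩ := hK.halt w _ _ (hK.starts h α hα) h1
  refine ⟨ω * α + t, by rw [h.add_nat, ht1], fun β hβ => ?_, by rw [h.add_nat, ht2]⟩
  rcases lt_or_ge β (ω * α) with hlt | hge
  · exact hK.not_halt h hα hlt
  · obtain ⟨δ, rfl⟩ := exists_add_of_le hge
    have hδ := (add_lt_add_iff_left _).mp hβ
    obtain ⟨k, rfl⟩ := lt_omega0.mp (hδ.trans (natCast_lt_omega0 t))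
    rw [h.add_nat]
    exact ht3 k (by exact_mod_cast hδ)

/-- The core halts if and only if bit `0` of the flow is ever set. -/
theorem Realizes.halts_iff {b : ℕ} [NeZero b] {g : R → ℕ → R → Bool} (hK : K.Realizes b g)
    {c : Ordinal → Conf K.S} (h : K.IsRun w c) :
    (∃ γ, (c γ).st = K.halt) ↔ ∃ α, flow (g w) α 0 = true := by
  constructor
  · rintro ⟨γ, hγ⟩
    by_contra hne
    push Not at hne
    refine hK.not_halt h (α := γ + 1) (fun β _ => by simpa using hne β) (β := γ) ?_ hγ
    refine (lt_add_one γ).trans_le ?_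
    exact Ordinal.le_mul_right _ Ordinal.omega0_pos
  · rintro ⟨α, hα⟩
    obtain ⟨α, hα, hmin⟩ := Ordinal.lt_wf.has_min {α | flow (g w) α 0 = true} ⟨α, hα⟩
    obtain ⟨γ, hγ, -⟩ := hK.halts h (fun β hβ => by simpa using fun e => hmin β e hβ) hα
    exact ⟨γ, hγ⟩

end Core

/-- The bits of the list coded by `N`, in increasing order. -/
def unload (N : ℕ) : List ℕ := ((Encodable.decode N : Option (List ℕ)).getD []).reverse

theorem primrec_unload : Primrec unload :=
  Primrec.list_reverse.comp (Primrec.option_getD.comp Primrec.decode (Primrec.const []))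

theorem unload_load (f : R) (k : ℕ) : unload (load f k) = (List.range k).map fun i => (f i).toNat := by
  have : load f k = Encodable.encode ((List.range k).map fun i => (f i).toNat).reverse := by
    induction k with
    | zero => rfl
    | succ k ih =>
      rw [load, ih, List.range_succ, List.map_append, List.reverse_append]
      simp
  rw [this, unload, Encodable.encodek]
  simp

/-- The function `f` depends on finitely many bits of its real arguments, in a primitive recursive
way. The first argument is a numerical parameter. -/
def Loc {α β : Type} [Primcodable α] [Primcodable β] (f : ℕ → R → R → α → β) : Prop :=
  ∃ (F : (ℕ × ℕ × ℕ) × α → β) (m : ℕ × α → ℕ), Primrec F ∧ Primrec m ∧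
    ∀ b w y a k l, m (b, a) ≤ k → m (b, a) ≤ l → F ((b, load y k, load w l), a) = f b w y a

namespace Loc

variable {α β γ δ : Type} [Primcodable α] [Primcodable β] [Primcodable γ] [Primcodable δ]

theorem param : Loc fun b _ _ (_ : α) => b :=
  ⟨fun x => x.1.1, fun _ => 0, Primrec.fst.comp Primrec.fst, Primrec.const 0,
    fun _ _ _ _ _ _ _ _ => rfl⟩

theorem of_primrec {f : α → β} (hf : Primrec f) : Loc fun _ _ _ a => f a :=
  ⟨fun x => f x.2, fun _ => 0, hf.comp Primrec.snd, Primrec.const 0, fun _ _ _ _ _ _ _ _ => rfl⟩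

theorem readAt {f : ℕ × α → ℕ} (hf : Primrec f) : Loc fun b _ y a => y (f (b, a)) := by
  refine ⟨fun x => decide ((unload x.1.2.1).getD (f (x.1.1, x.2)) 0 = 1), fun a => f a + 1, ?_,
    Primrec.succ.comp hf, fun b w y a k l hk _ => ?_⟩
  · exact PrimrecPred.decide (Primrec.eq.comp ((Primrec.list_getD 0).comp (primrec_unload.comp
      (Primrec.fst.comp (Primrec.snd.comp Primrec.fst))) (hf.comp ((Primrec.fst.comp
        Primrec.fst).pair Primrec.snd))) (Primrec.const 1))
  · dsimp only
    rw [unload_load, List.getD_eq_getElem _ _ (by simpa using hk)]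
    cases h : y (f (b, a)) <;> simp [h]

theorem read {f : α → ℕ} (hf : Primrec f) : Loc fun _ _ y a => y (f a) :=
  readAt (hf.comp Primrec.snd)

theorem readInput {f : α → ℕ} (hf : Primrec f) : Loc fun _ w _ a => w (f a) := by
  refine ⟨fun x => decide ((unload x.1.2.2).getD (f x.2) 0 = 1), fun a => f a.2 + 1, ?_,
    Primrec.succ.comp (hf.comp Primrec.snd), fun b w y a k l _ hl => ?_⟩
  · exact PrimrecPred.decide (Primrec.eq.comp ((Primrec.list_getD 0).comp (primrec_unload.comp
      (Primrec.snd.comp (Primrec.snd.comp Primrec.fst))) (hf.comp Primrec.snd)) (Primrec.const 1))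
  · dsimp only
    rw [unload_load, List.getD_eq_getElem _ _ (by simpa using hl)]
    cases h : w (f a) <;> simp [h]

theorem pair {f : ℕ → R → R → α → β} {g : ℕ → R → R → α → γ} (hf : Loc f) (hg : Loc g) :
    Loc fun b w y a => (f b w y a, g b w y a) := by
  obtain ⟨F, m, hF, hm, h⟩ := hf
  obtain ⟨G, n, hG, hn, h'⟩ := hg
  refine ⟨fun x => (F x, G x), fun a => max (m a) (n a), hF.pair hG, Primrec.nat_max.comp hm hn,
    fun b w y a k l hk hl => ?_⟩
  dsimp only at hk hl ⊢
  rw [h _ _ _ _ _ _ (by omega) (by omega), h' _ _ _ _ _ _ (by omega) (by omega)]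

theorem map {f : ℕ → R → R → α → β} {g : β → γ} (hg : Primrec g) (hf : Loc f) :
    Loc fun b w y a => g (f b w y a) := by
  obtain ⟨F, m, hF, hm, h⟩ := hf
  refine ⟨fun x => g (F x), m, hg.comp hF, hm, fun b w y a k l hk hl => ?_⟩
  dsimp only
  rw [h _ _ _ _ _ _ hk hl]

theorem map₂ {f : ℕ → R → R → α → β} {g : ℕ → R → R → α → γ} {h : β → γ → δ} (hh : Primrec₂ h)
    (hf : Loc f) (hg : Loc g) : Loc fun b w y a => h (f b w y a) (g b w y a) :=
  (hf.pair hg).map hh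

theorem comp {f : ℕ → R → R → β → γ} (hf : Loc f) {g : α → β} (hg : Primrec g) :
    Loc fun b w y a => f b w y (g a) := by
  obtain ⟨F, m, hF, hm, h⟩ := hf
  exact ⟨fun x => F (x.1, g x.2), fun a => m (a.1, g a.2), hF.comp (Primrec.fst.pair
    (hg.comp Primrec.snd)), hm.comp (Primrec.fst.pair (hg.comp Primrec.snd)), fun b w y a k l hk hl => h _ _ _ _ _ _ hk hl⟩

theorem not {f : ℕ → R → R → α → Bool} (hf : Loc f) : Loc fun b w y a => !f b w y a :=
  hf.map Primrec.not

theorem and {f g : ℕ → R → R → α → Bool} (hf : Loc f) (hg : Loc g) :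
    Loc fun b w y a => f b w y a && g b w y a :=
  map₂ Primrec.and hf hg

theorem or {f g : ℕ → R → R → α → Bool} (hf : Loc f) (hg : Loc g) :
    Loc fun b w y a => f b w y a || g b w y a :=
  map₂ Primrec.or hf hg

theorem cond {f : ℕ → R → R → α → Bool} {g h : ℕ → R → R → α → β} (hf : Loc f) (hg : Loc g)
    (hh : Loc h) : Loc fun b w y a => bif f b w y a then g b w y a else h b w y a :=
  (hf.pair (hg.pair hh)).map (g := fun x : Bool × β × β => bif x.1 then x.2.1 else x.2.2)
    (Primrec.cond Primrec.fst (Primrec.fst.comp Primrec.snd) (Primrec.snd.comp Primrec.snd))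

theorem eq [DecidableEq β] {f g : ℕ → R → R → α → β} (hf : Loc f) (hg : Loc g) :
    Loc fun b w y a => decide (f b w y a = g b w y a) :=
  map₂ (h := fun x y => decide (x = y)) (PrimrecRel.decide Primrec.eq) hf hg

end Loc

/-- Every local rule, possibly with an unbounded search, is iterated transfinitely by a core. -/
theorem exists_realizes_of_loc {f : ℕ → R → R → ℕ × ℕ → Bool} (hf : Loc f) :
    ∃ b, ∃ _ : NeZero b, ∃ K : Core, ∃ g, K.Realizes b g ∧ ∀ w,
      (∀ α j, flow (g w) (α + 1) j = true ↔ ∃ u, f b w (flow (g w) α) (j, u) = true) ∧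
      ∀ α, Order.IsSuccLimit α → ∀ j, flow (g w) α j = true ↔
        ∀ β < α, ∃ γ, β ≤ γ ∧ γ < α ∧ flow (g w) γ j = true := by
  obtain ⟨F, m, hF, hm, h⟩ := hf
  let E : ℕ → ℕ → ℕ → ℕ := fun r NA NW =>
    let a := (r.unpair.1, r.unpair.2.unpair.1)
    let b := (unload NW).length / (unload NA).length
    bif decide (m (b, a) ≤ (unload NA).length) then (bif F ((b, NA, NW), a) then 1 else 0) else 0
  have hE : Primrec fun x : List.Vector ℕ 3 => E (x.get 0) (x.get 1) (x.get 2) := by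
    have hg : ∀ i, Primrec fun x : List.Vector ℕ 3 => x.get i := fun i =>
      Primrec.vector_get.comp Primrec.id (Primrec.const i)
    have hl : ∀ i, Primrec fun x : List.Vector ℕ 3 => (unload (x.get i)).length := fun i =>
      Primrec.list_length.comp (primrec_unload.comp (hg i))
    have hu := Primrec.unpair.comp (hg 0)
    have ha := (Primrec.fst.comp hu).pair (Primrec.fst.comp (Primrec.unpair.comp
      (Primrec.snd.comp hu)))
    have hb := Primrec.nat_div.comp (hl 2) (hl 1)
    refine Primrec.cond (PrimrecPred.decide (Primrec.nat_le.comp (hm.comp (hb.pair ha)) (hl 1)))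
      (Primrec.cond (hF.comp (Primrec.pair (Primrec.pair hb ((hg 1).pair (hg 2))) ha)) (Primrec.const 1) (Primrec.const 0)) (Primrec.const 0)
  obtain ⟨b, hb, K, hK⟩ := exists_realizes (L := id) Primrec.id rfl monotone_id (fun _ => le_rfl) hE
  refine ⟨b, hb, K, _, hK, fun w => ?_⟩
  have hbit : ∀ y j s, roundBit id E b w (Nat.pair j s) y = true ↔
      m (b, j, s.unpair.1) ≤ Nat.pair j s + 1 ∧ f b w y (j, s.unpair.1) = true := by
    intro y j s
    have hb1 : 1 ≤ b := Nat.one_le_iff_ne_zero.mpr hb.ne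
    simp only [roundBit, E, id, unload_load, List.length_map, List.length_range, Nat.unpair_pair,
      Nat.mul_div_cancel b (Nat.succ_pos _), decide_eq_true_eq]
    by_cases hle : m (b, j, s.unpair.1) ≤ Nat.pair j s + 1
    · rw [h b w y _ _ _ hle (hle.trans (Nat.le_mul_of_pos_left _ hb1))]
      cases hfb : f b w y (j, s.unpair.1) <;> simp [hle]
    · simp [hle]
  have hsucc : ∀ α j, flow (roundBit id E b w) (α + 1) j = true ↔
      ∃ u, f b w (flow (roundBit id E b w) α) (j, u) = true := by
    intro α j
    rw [flow_succ]
    constructor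
    · intro hs
      obtain ⟨s, -, hs⟩ := hs 0
      exact ⟨_, ((hbit _ _ _).mp hs).2⟩
    · rintro ⟨u, hu⟩ s₀
      refine ⟨Nat.pair u (max s₀ (m (b, j, u))), ?_, (hbit _ _ _).mpr ?_⟩
      · exact (le_max_left _ _).trans (Nat.right_le_pair _ _)
      · rw [Nat.unpair_pair]
        refine ⟨?_, hu⟩
        have h1 := Nat.right_le_pair u (max s₀ (m (b, j, u)))
        have h2 := Nat.right_le_pair j (Nat.pair u (max s₀ (m (b, j, u))))
        have h3 := le_max_right s₀ (m (b, j, u))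
        dsimp only
        omega
  refine ⟨hsucc, fun α hα j => ?_⟩
  rw [flow_limit hα]
  constructor
  · intro hc β hβ
    obtain ⟨γ, h1, h2, h3 | ⟨s, h3⟩⟩ := hc β hβ
    · exact ⟨γ, h1, h2, h3⟩
    · exact ⟨γ + 1, h1.trans (Order.le_succ γ), hα.succ_lt h2,
        (hsucc _ _).mpr ⟨_, ((hbit _ _ _).mp h3).2⟩⟩
  · intro hc β hβ
    obtain ⟨γ, h1, h2, h3⟩ := hc β hβ
    exact ⟨γ, h1, h2, .inl h3⟩

/-- Bit `k` of the list coded by the second component of `e`. -/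
def entryBit (e k : ℕ) : Bool := decide ((unload e.unpair.2).getD k 0 = 1)

/-- The entry of the transition table `N` for a given state and given cell values. -/
def entry (N : ℕ) (x : ℕ × Bool × Bool × Bool × Bool) : ℕ :=
  (unload N).getD (Encodable.encode x) 0

/-- The oracle machine with given states and transition table. -/
def tableMachine (Q s l h N : ℕ) : OMachine where
  Q := Q
  start := Fin.ofNat (Q + 1) s
  limit := Fin.ofNat (Q + 1) l
  halt := Fin.ofNat (Q + 1) h
  trans := fun x =>
    let e := entry N (x.1, x.2 0, x.2 1, x.2 2, x.2 3)
    (Fin.ofNat (Q + 1) e.unpair.1, fun i => entryBit e i, entryBit e 3)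

theorem exists_tableMachine_eq (M : OMachine) : ∃ Q s l h N, tableMachine Q s l h N = M := by
  obtain ⟨Q, s, l, h, t⟩ := M
  let idx : Fin (Q + 1) × (Fin 4 → Bool) → ℕ := fun x =>
    Encodable.encode ((x.1 : ℕ), x.2 0, x.2 1, x.2 2, x.2 3)
  have hidx : Function.Injective idx := by
    rintro ⟨q, f⟩ ⟨q', f'⟩ e
    have := Encodable.encode_injective e
    simp only [Prod.mk.injEq] at this
    obtain ⟨h, h0, h1, h2, h3⟩ := this
    refine Prod.ext (Fin.ext h) (funext fun i => ?_)
    fin_cases i <;> assumption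
  let code : Fin (Q + 1) × (Fin 3 → Bool) × Bool → ℕ := fun z =>
    Nat.pair z.1 (load (fun n => if h : n < 3 then z.2.1 ⟨n, h⟩ else z.2.2) 4)
  let U : ℕ → ℕ := fun i => if h : ∃ x, idx x = i then code (t h.choose) else 0
  have hU : ∀ x, U (idx x) = code (t x) := fun x => by
    have hx : ∃ x', idx x' = idx x := ⟨x, rfl⟩
    simp only [U, dif_pos hx, hidx hx.choose_spec]
  obtain ⟨m, hm⟩ : ∃ m, ∀ x, idx x < m := by
    obtain ⟨m, hm⟩ := (Set.finite_range idx).bddAbove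
    exact ⟨m + 1, fun x => Nat.lt_succ_of_le (hm ⟨x, rfl⟩)⟩
  have hentry : ∀ x, entry (Encodable.encode ((List.range m).map U).reverse)
      ((x.1 : ℕ), x.2 0, x.2 1, x.2 2, x.2 3) = code (t x) := by
    intro x
    rw [entry, unload, Encodable.encodek, Option.getD_some, List.reverse_reverse,
      List.getD_eq_getElem _ _ (by rw [List.length_map, List.length_range]; exact hm x),
      List.getElem_map, List.getElem_range]
    exact hU x
  have hbit : ∀ z k, k < 4 → entryBit (code z) k = if h : k < 3 then z.2.1 ⟨k, h⟩ else z.2.2 := by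
    intro z k hk
    simp only [entryBit, code, Nat.unpair_pair, unload_load]
    rw [List.getD_eq_getElem _ _ (by simpa using hk), List.getElem_map, List.getElem_range]
    cases e : (if h : k < 3 then z.2.1 ⟨k, h⟩ else z.2.2) <;> simp
  refine ⟨Q, s, l, h, Encodable.encode ((List.range m).map U).reverse, ?_⟩
  simp only [tableMachine, OMachine.mk.injEq, heq_eq_eq, true_and]
  refine ⟨by simp, by simp, by simp, ?_⟩
  funext x
  rw [hentry]
  refine Prod.ext ?_ (Prod.ext (funext fun i => ?_) ?_)
  · simp [code]
  · exact (hbit _ _ (by omega)).trans (dif_pos i.2)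
  · exact (hbit _ _ (by omega)).trans (dif_neg (by omega))

namespace Code

/-- The number of states, minus one, of the machine with code `p`. -/
def states (p : ℕ) : ℕ := p.unpair.1

/-- The start state of the machine with code `p`. -/
def start (p : ℕ) : ℕ := p.unpair.2.unpair.1 % (states p + 1)

/-- The limit state of the machine with code `p`. -/
def limit (p : ℕ) : ℕ := p.unpair.2.unpair.2.unpair.1 % (states p + 1)

/-- The halt state of the machine with code `p`. -/
def halt (p : ℕ) : ℕ := p.unpair.2.unpair.2.unpair.2.unpair.1 % (states p + 1)

/-- The transition table of the machine with code `p`. -/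
def table (p : ℕ) : ℕ := p.unpair.2.unpair.2.unpair.2.unpair.2

/-- The oracle machine with code `p`. -/
def machine (p : ℕ) : OMachine :=
  tableMachine p.unpair.1 p.unpair.2.unpair.1 p.unpair.2.unpair.2.unpair.1
    p.unpair.2.unpair.2.unpair.2.unpair.1 p.unpair.2.unpair.2.unpair.2.unpair.2

theorem exists_machine_eq (M : OMachine) : ∃ p, machine p = M := by
  obtain ⟨Q, s, l, h, N, rfl⟩ := exists_tableMachine_eq M
  exact ⟨Nat.pair Q (Nat.pair s (Nat.pair l (Nat.pair h N))), by simp [machine]⟩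

theorem start_eq (p : ℕ) : ((machine p).start : ℕ) = start p := rfl

theorem limit_eq (p : ℕ) : ((machine p).limit : ℕ) = limit p := rfl

theorem halt_eq (p : ℕ) : ((machine p).halt : ℕ) = halt p := rfl

theorem primrec_unpair_fst {α : Type} [Primcodable α] {f : α → ℕ} (hf : Primrec f) :
    Primrec fun a => (f a).unpair.1 :=
  Primrec.fst.comp (Primrec.unpair.comp hf)

theorem primrec_unpair_snd {α : Type} [Primcodable α] {f : α → ℕ} (hf : Primrec f) :
    Primrec fun a => (f a).unpair.2 :=
  Primrec.snd.comp (Primrec.unpair.comp hf)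

theorem primrec_states : Primrec states := primrec_unpair_fst Primrec.id

theorem primrec_start : Primrec start :=
  Primrec.nat_mod.comp (primrec_unpair_fst (primrec_unpair_snd Primrec.id))
    (Primrec.succ.comp primrec_states)

theorem primrec_limit : Primrec limit :=
  Primrec.nat_mod.comp (primrec_unpair_fst (primrec_unpair_snd (primrec_unpair_snd Primrec.id)))
    (Primrec.succ.comp primrec_states)

theorem primrec_halt : Primrec halt :=
  Primrec.nat_mod.comp (primrec_unpair_fst (primrec_unpair_snd (primrec_unpair_snd
    (primrec_unpair_snd Primrec.id)))) (Primrec.succ.comp primrec_states)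

theorem primrec_table : Primrec table :=
  primrec_unpair_snd (primrec_unpair_snd (primrec_unpair_snd (primrec_unpair_snd Primrec.id)))

end Code

theorem primrec_entryBit : Primrec₂ entryBit :=
  PrimrecPred.decide (Primrec.eq.comp ((Primrec.list_getD 0).comp (primrec_unload.comp
    (Code.primrec_unpair_snd Primrec.fst)) Primrec.snd) (Primrec.const 1))

theorem primrec_entry : Primrec₂ entry :=
  (Primrec.list_getD 0).comp (primrec_unload.comp Primrec.fst) (Primrec.encode.comp Primrec.snd)

/-- The address of component `k` of cell `n` in slot `c`. -/
def cell (c n k : ℕ) : ℕ := Nat.pair c (Nat.pair n k)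

theorem cell_inj {c n k c' n' k' : ℕ} : cell c n k = cell c' n' k' ↔ c = c' ∧ n = n' ∧ k = k' := by
  simp [cell, Nat.pair_eq_pair]

theorem exists_cell_eq (j : ℕ) : ∃ c n k, cell c n k = j :=
  ⟨j.unpair.1, j.unpair.2.unpair.1, j.unpair.2.unpair.2, by simp [cell]⟩

theorem primrec_cell {α : Type} [Primcodable α] {c n k : α → ℕ} (hc : Primrec c) (hn : Primrec n)
    (hk : Primrec k) : Primrec fun a => cell (c a) (n a) (k a) :=
  Primrec₂.natPair.comp hc (Primrec₂.natPair.comp hn hk)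

/-- Slot `c` of `y` has its head at `n` in state `q`, in a computation of the machine `p`. The
flags `e₁`, `e₂` are both unset at stage `0` and both set at limit stages. -/
def headState (p c : ℕ) (e₁ e₂ : Bool) (y : R) (n q : ℕ) : Bool :=
  bif e₁ then
    bif e₂ then decide (n = 0) && decide (q = Code.limit p) else y (cell c n (4 + q))
  else bif e₂ then y (cell c n (4 + q)) else decide (n = 0) && decide (q = Code.start p)

/-- Slot `c` of `y` has its head at `n`. -/
def headAt (c : ℕ) (e₁ e₂ : Bool) (y : R) (n : ℕ) : Bool :=
  bif e₁ then bif e₂ then decide (n = 0) else y (cell c n 3)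
  else bif e₂ then y (cell c n 3) else decide (n = 0)

/-- The applicable entry of the transition table in state `q` at `n`. -/
def slotEntry (p c : ℕ) (w y : R) (n q : ℕ) : ℕ :=
  entry (Code.table p) (q, y (cell c n 0), y (cell c n 1), y (cell c n 2), w (2 * n + 1))

/-- The head position after a move from `n`. -/
def moved (n : ℕ) (d : Bool) : ℕ := bif d then n + 1 else n - 1

/-- Component `k` of cell `n` in slot `c` after one step of the machine `p`, where `u` is a guess
of the current state and head position. -/
def slotRule (p c : ℕ) (e₁ e₂ : Bool) (w y : R) (n k u : ℕ) : Bool :=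
  bif decide (k < 3) then
    bif headAt c e₁ e₂ y n then
      headState p c e₁ e₂ y n u.unpair.1 && (bif decide (u.unpair.1 = Code.halt p) then
        y (cell c n k) else entryBit (slotEntry p c w y n u.unpair.1) k)
    else y (cell c n k)
  else headState p c e₁ e₂ y u.unpair.2 u.unpair.1 &&
    (decide (moved u.unpair.2 (entryBit (slotEntry p c w y u.unpair.2 u.unpair.1) 3) = n) &&
      (decide (k = 3) || decide ((slotEntry p c w y u.unpair.2 u.unpair.1).unpair.1 %
        (Code.states p + 1) + 4 = k)))

section Loc

variable {α : Type} [Primcodable α] {p c n k u q : α → ℕ}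

theorem loc_eq {f g : α → ℕ} (hf : Primrec f) (hg : Primrec g) :
    Loc fun _ _ _ a => decide (f a = g a) :=
  .eq (.of_primrec hf) (.of_primrec hg)

theorem loc_headState (hp : Primrec p) (hc : Primrec c) (hn : Primrec n) (hq : Primrec q)
    (fa fb : ℕ) : Loc fun _ _ y a => headState (p a) (c a) (y fa) (y fb) y (n a) (q a) := by
  have hy : Loc fun _ _ y a => y (cell (c a) (n a) (4 + q a)) :=
    .read (primrec_cell hc hn (Primrec.nat_add.comp (Primrec.const 4) hq))
  have h0 := loc_eq hn (Primrec.const 0)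
  have hb : Loc fun _ _ y (_ : α) => y fb := .read (Primrec.const fb)
  exact .cond (.read (Primrec.const fa))
    (.cond hb (.and h0 (loc_eq hq (Code.primrec_limit.comp hp))) hy)
    (.cond hb hy (.and h0 (loc_eq hq (Code.primrec_start.comp hp))))

theorem loc_headAt (hc : Primrec c) (hn : Primrec n) (fa fb : ℕ) :
    Loc fun _ _ y a => headAt (c a) (y fa) (y fb) y (n a) := by
  have hy : Loc fun _ _ y a => y (cell (c a) (n a) 3) :=
    .read (primrec_cell hc hn (Primrec.const 3))
  have h0 := loc_eq hn (Primrec.const 0)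
  have hb : Loc fun _ _ y (_ : α) => y fb := .read (Primrec.const fb)
  exact .cond (.read (Primrec.const fa)) (.cond hb h0 hy) (.cond hb hy h0)

theorem loc_slotEntry (hp : Primrec p) (hc : Primrec c) (hn : Primrec n) (hq : Primrec q) :
    Loc fun _ w y a => slotEntry (p a) (c a) w y (n a) (q a) := by
  have hy : ∀ i, Loc fun _ _ y a => y (cell (c a) (n a) i) := fun i =>
    .read (primrec_cell hc hn (Primrec.const i))
  have hw : Loc fun _ w _ a => w (2 * n a + 1) :=
    .readInput (Primrec.succ.comp (Primrec.nat_mul.comp (Primrec.const 2) hn))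
  exact .map₂ primrec_entry (.of_primrec (Code.primrec_table.comp hp))
    (.pair (.of_primrec hq) (.pair (hy 0) (.pair (hy 1) (.pair (hy 2) hw))))

theorem loc_slotRule (hp : Primrec p) (hc : Primrec c) (hn : Primrec n) (hk : Primrec k)
    (hu : Primrec u) (fa fb : ℕ) :
    Loc fun _ w y a => slotRule (p a) (c a) (y fa) (y fb) w y (n a) (k a) (u a) := by
  have hq := Code.primrec_unpair_fst hu
  have hm := Code.primrec_unpair_snd hu
  have he := loc_slotEntry hp hc hm hq
  have hy : Loc fun _ _ y a => y (cell (c a) (n a) (k a)) := .read (primrec_cell hc hn hk)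
  have hmv : Primrec₂ moved := Primrec.cond Primrec.snd (Primrec.succ.comp Primrec.fst)
    (Primrec.pred.comp Primrec.fst)
  have hst : Primrec fun x : ℕ × ℕ => x.2.unpair.1 % (Code.states x.1 + 1) + 4 :=
    Primrec.nat_add.comp (Primrec.nat_mod.comp (Code.primrec_unpair_fst Primrec.snd)
      (Primrec.succ.comp (Code.primrec_states.comp Primrec.fst))) (Primrec.const 4)
  refine .cond (.of_primrec (PrimrecPred.decide (Primrec.nat_lt.comp hk (Primrec.const 3))))
    (.cond (loc_headAt hc hn fa fb) (.and (loc_headState hp hc hn hq fa fb)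
      (.cond (loc_eq hq (Code.primrec_halt.comp hp)) hy
        (.map₂ primrec_entryBit (loc_slotEntry hp hc hn hq) (.of_primrec hk)))) hy)
    (.and (loc_headState hp hc hm hq fa fb) (.and (.eq (.map₂ hmv (.of_primrec hm)
      (.map₂ primrec_entryBit he (.of_primrec (Primrec.const 3)))) (.of_primrec hn))
      (.or (loc_eq hk (Primrec.const 3)) (.eq (.map (g := fun x : ℕ × ℕ => x.2.unpair.1 % (Code.states x.1 + 1) + 4) hst (.pair (.of_primrec hp) he))
        (.of_primrec hk)))))

end Loc

/-- Slot `c` of `y` represents the snapshot `s` of the machine `p` with oracle `rightR w`. -/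
structure SlotShows (p c : ℕ) (e₁ e₂ : Bool) (w y : R) (s : OSnapshot (Code.machine p).Q) :
    Prop where
  tape : ∀ (i : Fin 3) n, y (cell c n i) = s.tape i.castSucc n
  headState : ∀ n q, headState p c e₁ e₂ y n q = true ↔ n = s.head ∧ q = s.state
  headAt : ∀ n, headAt c e₁ e₂ y n = true ↔ n = s.head
  oracle : s.tape 3 = rightR w

namespace SlotShows

variable {p c : ℕ} {e₁ e₂ : Bool} {w y : R} {s : OSnapshot (Code.machine p).Q}

theorem trans_eq (h : SlotShows p c e₁ e₂ w y s) :
    (((Code.machine p).trans (s.state, fun i => s.tape i s.head)).1 : ℕ) =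
      (slotEntry p c w y s.head s.state).unpair.1 % (Code.states p + 1) ∧
    (∀ i, ((Code.machine p).trans (s.state, fun i => s.tape i s.head)).2.1 i =
      entryBit (slotEntry p c w y s.head s.state) i) ∧
    ((Code.machine p).trans (s.state, fun i => s.tape i s.head)).2.2 =
      entryBit (slotEntry p c w y s.head s.state) 3 := by
  have h0 := h.tape 0 s.head
  have h1 := h.tape 1 s.head
  have h2 := h.tape 2 s.head
  have h3 := congrFun h.oracle s.head
  simp only [Fin.val_zero, Fin.val_one, Fin.val_two] at h0 h1 h2
  simp only [rightR] at h3
  simp only [slotEntry, h0, h1, h2, ← h3]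
  exact ⟨rfl, fun _ => rfl, rfl⟩

theorem rule_tape (h : SlotShows p c e₁ e₂ w y s) (i : Fin 3) (n : ℕ) :
    (∃ u, slotRule p c e₁ e₂ w y n i u = true) ↔
      (if s.state = (Code.machine p).halt then s.tape i.castSucc n
        else ((Code.machine p).stepSnap s).tape i.castSucc n) = true := by
  simp only [slotRule, i.2, decide_true, cond_true, OMachine.stepSnap,
    Fin.val_castSucc, h.trans_eq.2.1]
  by_cases hn : n = s.head
  · subst hn
    rw [(h.headAt _).mpr rfl]
    simp only [cond_true, Bool.and_eq_true, h.headState, true_and, if_true]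
    have hst : (s.state = (Code.machine p).halt) ↔ (s.state : ℕ) = Code.halt p := by
      rw [← Code.halt_eq, Fin.ext_iff]
    constructor
    · rintro ⟨u, hu, hu'⟩
      rw [hu] at hu'
      by_cases hs : (s.state : ℕ) = Code.halt p
      · rw [if_pos (hst.mpr hs), ← h.tape]
        simpa [hs] using hu'
      · rw [if_neg (hst.not.mpr hs)]
        simpa [hs] using hu'
    · intro hu
      refine ⟨Nat.pair s.state 0, by simp, ?_⟩
      simp only [Nat.unpair_pair]
      by_cases hs : (s.state : ℕ) = Code.halt p
      · rw [if_pos (hst.mpr hs), ← h.tape] at hu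
        simpa [hs] using hu
      · rw [if_neg (hst.not.mpr hs)] at hu
        simpa [hs] using hu
  · have := (h.headAt n).not.mpr hn
    rw [Bool.not_eq_true] at this
    simp [this, hn, h.tape]

theorem rule_head (h : SlotShows p c e₁ e₂ w y s) (n : ℕ) :
    (∃ u, slotRule p c e₁ e₂ w y n 3 u = true) ↔
      n = ((Code.machine p).stepSnap s).head := by
  simp only [slotRule, OMachine.stepSnap, h.trans_eq.2.2]
  simp only [lt_irrefl, decide_false, cond_false, Bool.and_eq_true, h.headState, decide_eq_true_eq,
    decide_true, Bool.true_or, and_true]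
  constructor
  · rintro ⟨u, ⟨h1, h2⟩, rfl⟩
    rw [h1, h2, moved, Bool.cond_eq_ite]
  · rintro rfl
    exact ⟨Nat.pair s.state s.head, by simp [moved, Bool.cond_eq_ite]⟩

theorem rule_state (h : SlotShows p c e₁ e₂ w y s) (n q : ℕ) :
    (∃ u, slotRule p c e₁ e₂ w y n (4 + q) u = true) ↔
      n = ((Code.machine p).stepSnap s).head ∧ q = ((Code.machine p).stepSnap s).state := by
  simp only [slotRule, OMachine.stepSnap, h.trans_eq.1, h.trans_eq.2.2]
  have h3 : ¬ 4 + q < 3 := by omega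
  have h4 : ¬ 4 + q = 3 := by omega
  simp only [h3, h4, decide_false, cond_false, Bool.and_eq_true, h.headState, decide_eq_true_eq,
    Bool.false_or]
  constructor
  · rintro ⟨u, ⟨h1, h2⟩, h3, h4⟩
    rw [h1, h2] at h3 h4
    refine ⟨by rw [← h3, moved, Bool.cond_eq_ite], ?_⟩
    omega
  · rintro ⟨rfl, rfl⟩
    refine ⟨Nat.pair s.state s.head, by simp, by simp [moved, Bool.cond_eq_ite], ?_⟩
    simp only [Nat.unpair_pair]
    omega

end SlotShows

/-- The value of `Z` at the limit stage `δ` is the limit superior of its earlier values. -/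
def LimsupAt (Z : Ordinal.{0} → R) (δ : Ordinal.{0}) : Prop :=
  ∀ j, Z δ j = true ↔ ∀ β < δ, ∃ γ, β ≤ γ ∧ γ < δ ∧ Z γ j = true

theorem LimsupAt.eq_of_forall {Z : Ordinal.{0} → R} {δ β : Ordinal.{0}} (h : LimsupAt Z δ)
    (hβ : β < δ) {j : ℕ} {v : Bool} (hv : ∀ γ, β ≤ γ → γ < δ → Z γ j = v) : Z δ j = v := by
  cases v
  · rw [← Bool.not_eq_true, h]
    intro hc
    obtain ⟨γ, h1, h2, h3⟩ := hc β hβ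
    rw [hv γ h1 h2] at h3
    simp at h3
  · rw [h]
    intro γ hγ
    exact ⟨max β γ, le_max_right _ _, max_lt hβ hγ, hv _ (le_max_left _ _) (max_lt hβ hγ)⟩

/-- The flags at `f₁` and `f₂` count stages modulo two. -/
def FlagsAt (Z : Ordinal.{0} → R) (f₁ f₂ : ℕ) (δ : Ordinal.{0}) : Prop :=
  Z (δ + 1) f₁ = !(Z δ f₁ && !Z δ f₂) ∧ Z (δ + 1) f₂ = (Z δ f₁ && !Z δ f₂)

theorem flags_of_isSuccLimit {Z : Ordinal.{0} → R} {f₁ f₂ : ℕ} {δ : Ordinal.{0}}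
    (hδ : Order.IsSuccLimit δ) (hl : LimsupAt Z δ) (hf : ∀ β < δ, FlagsAt Z f₁ f₂ β) :
    Z δ f₁ = true ∧ Z δ f₂ = true := by
  have h1 : ∀ β < δ, β + 1 < δ := fun β hβ => hδ.succ_lt hβ
  have h2 : ∀ β : Ordinal.{0}, β ≤ β + 1 := fun β => Order.le_succ β
  have key : ∀ β < δ, (∃ γ, β ≤ γ ∧ γ < δ ∧ Z γ f₁ = true) ∧
      ∃ γ, β ≤ γ ∧ γ < δ ∧ Z γ f₂ = true := by
    intro β hβ
    obtain ⟨a1, b1⟩ := hf β hβ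
    obtain ⟨a2, b2⟩ := hf _ (h1 β hβ)
    obtain ⟨a3, b3⟩ := hf _ (h1 _ (h1 β hβ))
    have i1 := h1 _ hβ
    have i2 := h1 _ i1
    have i3 := h1 _ i2
    have j1 := h2 β
    have j2 := j1.trans (h2 _)
    have j3 := j2.trans (h2 _)
    rw [a1, b1] at a2 b2
    rw [a2, b2] at a3 b3
    cases ha : Z β f₁ <;> cases hb : Z β f₂ <;> rw [ha, hb] at a1 b1 a2 b2 a3 b3
    · exact ⟨⟨_, j1, i1, a1⟩, ⟨_, j2, i2, b2⟩⟩
    · exact ⟨⟨_, j1, i1, a1⟩, ⟨_, j2, i2, b2⟩⟩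
    · exact ⟨⟨_, j2, i2, a2⟩, ⟨_, j1, i1, b1⟩⟩
    · exact ⟨⟨_, j1, i1, a1⟩, ⟨_, j2, i2, b2⟩⟩
  exact ⟨(hl _).mpr fun β hβ => (key β hβ).1, (hl _).mpr fun β hβ => (key β hβ).2⟩

/-- A slot which follows the rules represents the snapshots of a computation, as long as the
latter does not halt. -/
theorem slotShows_of_rules {p c f₁ f₂ : ℕ} {w x : R} {Z : Ordinal.{0} → R} {κ : Ordinal.{0}}
    (hz₁ : Z 0 f₁ = false) (hz₂ : Z 0 f₂ = false)
    (hz : ∀ (i : Fin 3) n, Z 0 (cell c n i) = if i = 0 then x n else false)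
    (hf : ∀ δ < κ, FlagsAt Z f₁ f₂ δ)
    (hs : ∀ δ < κ, ∀ n k, Z (δ + 1) (cell c n k) = true ↔
      ∃ u, slotRule p c (Z δ f₁) (Z δ f₂) w (Z δ) n k u = true)
    (hl : ∀ δ ≤ κ, Order.IsSuccLimit δ → LimsupAt Z δ)
    (hh : ∀ δ < κ, ¬ (Code.machine p).haltedAt (rightR w) x δ) (δ : Ordinal.{0}) (hδ : δ ≤ κ) :
    SlotShows p c (Z δ f₁) (Z δ f₂) w (Z δ) ((Code.machine p).snap (rightR w) x δ) := by
  induction δ using WellFoundedLT.induction with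
  | ind δ ih =>
  rcases Ordinal.zero_or_succ_or_isSuccLimit δ with rfl | ⟨β, rfl⟩ | hlim
  · rw [hz₁, hz₂, OMachine.snap_zero]
    refine ⟨fun i n => ?_, fun n q => ?_, fun n => ?_, ?_⟩
    · rw [hz]
      fin_cases i <;> rfl
    · simp [headState, OMachine.init, Code.start_eq]
    · simp [headAt, OMachine.init]
    · rfl
  · rw [Order.succ_eq_add_one] at *
    have hβ : β < κ := (lt_add_one β).trans_le hδ
    have h := ih β (lt_add_one β) hβ.le
    have hhalt := hh β hβ
    rw [OMachine.haltedAt] at hhalt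
    have ho := OMachine.snap_oracle (Code.machine p) (rightR w) x (β + 1)
    obtain ⟨g1, g2⟩ := hf β hβ
    have hne : ∀ n q, headState p c (Z (β + 1) f₁) (Z (β + 1) f₂) (Z (β + 1)) n q =
        Z (β + 1) (cell c n (4 + q)) := fun n q => by
      rw [g1, g2, headState]
      cases Z β f₁ && !Z β f₂ <;> rfl
    have hne' : ∀ n, headAt c (Z (β + 1) f₁) (Z (β + 1) f₂) (Z (β + 1)) n =
        Z (β + 1) (cell c n 3) := fun n => by
      rw [g1, g2, headAt]
      cases Z β f₁ && !Z β f₂ <;> rfl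
    rw [OMachine.snap_succ] at *
    refine ⟨fun i n => ?_, fun n q => ?_, fun n => ?_, ho⟩
    · rw [Bool.eq_iff_iff, hs β hβ, h.rule_tape, if_neg hhalt]
    · rw [hne, hs β hβ, h.rule_state]
    · rw [hne', hs β hβ, h.rule_head]
  · obtain ⟨h1, h2⟩ := flags_of_isSuccLimit hlim (hl δ hδ hlim)
      fun β hβ => hf β (hβ.trans_le hδ)
    have ho := OMachine.snap_oracle (Code.machine p) (rightR w) x δ
    rw [h1, h2, OMachine.snap_limit _ _ _ hlim] at *
    refine ⟨fun i n => ?_, fun n q => ?_, fun n => ?_, ho⟩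
    · rw [Bool.eq_iff_iff, hl δ hδ hlim, decide_eq_true_eq]
      refine forall_congr' fun β => forall_congr' fun hβ => exists_congr fun γ =>
        and_congr_right fun _ => and_congr_right fun hγ => ?_
      rw [(ih γ hγ (hγ.le.trans hδ)).tape]
    · simp [headState, Code.limit_eq]
    · simp [headAt]

/-- The flag counting stages modulo two, and the flag which is its complement; at limit stages
both are set, and initially both are unset. -/
def evenFlag : ℕ := cell 0 0 1

/-- See `evenFlag`. -/
def oddFlag : ℕ := cell 0 0 2

/-- The flag recording that the machine `p` has halted. -/
def haltFlag (p : ℕ) : ℕ := cell 1 p 0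

/-- One step of the simultaneous simulation of all machines, the machine `p` in slot `p + 3`. -/
def simRule (w y : R) (c n k u : ℕ) : Bool :=
  bif decide (c = 0) then
    bif decide (k = 1) then !(y evenFlag && !y oddFlag) else y evenFlag && !y oddFlag
  else bif decide (c = 1) then
    y (haltFlag n) || headState n (n + 3) (y evenFlag) (y oddFlag) y u (Code.halt n)
  else bif y (haltFlag (c - 3)) && decide (k < 3) then y (cell c n k)
  else slotRule (c - 3) c (y evenFlag) (y oddFlag) w y n k u

theorem loc_simRule {α : Type} [Primcodable α] {c n k u : α → ℕ} (hc : Primrec c) (hn : Primrec n)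
    (hk : Primrec k) (hu : Primrec u) :
    Loc fun _ w y a => simRule w y (c a) (n a) (k a) (u a) := by
  have he : Loc fun _ _ y (_ : α) => y evenFlag := .read (Primrec.const _)
  have ho : Loc fun _ _ y (_ : α) => y oddFlag := .read (Primrec.const _)
  have hc3 := Primrec.nat_sub.comp hc (Primrec.const 3)
  have hH : ∀ {f : α → ℕ}, Primrec f → Loc fun _ _ y a => y (haltFlag (f a)) := fun hf =>
    .read (primrec_cell (Primrec.const 1) hf (Primrec.const 0))
  refine .cond (loc_eq hc (Primrec.const 0)) (.cond (loc_eq hk (Primrec.const 1))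
    (.not (.and he (.not ho))) (.and he (.not ho))) (.cond (loc_eq hc (Primrec.const 1))
    (.or (hH hn) (loc_headState hn (Primrec.nat_add.comp hn (Primrec.const 3)) hu
      (Code.primrec_halt.comp hn) _ _)) (.cond (.and (hH hc3) (.of_primrec
      (PrimrecPred.decide (Primrec.nat_lt.comp hk (Primrec.const 3)))))
      (.read (primrec_cell hc hn hk)) (loc_slotRule hc3 hc hn hk hu _ _)))

/-- Up to stage `κ`, the sequence `Y` simulates all machines with oracle `rightR w`. -/
structure Simulates (w : R) (Y : Ordinal.{0} → R) (κ : Ordinal.{0}) : Prop where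
  zero : Y 0 = zeroR
  rule : ∀ α < κ, ∀ c n k, c = 0 ∧ n = 0 ∧ (k = 1 ∨ k = 2) ∨ c = 1 ∧ k = 0 ∨ 3 ≤ c →
    (Y (α + 1) (cell c n k) = true ↔ ∃ u, simRule w (Y α) c n k u = true)
  limit : ∀ α ≤ κ, Order.IsSuccLimit α → LimsupAt Y α

namespace Simulates

variable {w : R} {Y : Ordinal.{0} → R} {κ : Ordinal.{0}}

theorem flagsAt (h : Simulates w Y κ) {α : Ordinal.{0}} (hα : α < κ) :
    FlagsAt Y evenFlag oddFlag α := by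
  constructor <;> rw [Bool.eq_iff_iff]
  · rw [evenFlag, h.rule α hα 0 0 1 (.inl ⟨rfl, rfl, .inl rfl⟩)]
    simp [simRule, evenFlag]
  · rw [oddFlag, h.rule α hα 0 0 2 (.inl ⟨rfl, rfl, .inr rfl⟩)]
    simp [simRule, oddFlag]

theorem haltFlag_succ (h : Simulates w Y κ) {α : Ordinal.{0}} (hα : α < κ) (p : ℕ) :
    Y (α + 1) (haltFlag p) = true ↔ Y α (haltFlag p) = true ∨
      ∃ n, headState p (p + 3) (Y α evenFlag) (Y α oddFlag) (Y α) n (Code.halt p) = true := by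
  rw [haltFlag, h.rule α hα 1 p 0 (.inr (.inl ⟨rfl, rfl⟩))]
  simp [simRule, haltFlag, exists_or]

theorem slotShows (h : Simulates w Y κ) (p : ℕ) (α : Ordinal.{0}) (hα : α ≤ κ)
    (hh : ∀ β < α, ¬ (Code.machine p).haltedAt (rightR w) zeroR β) :
    Y α (haltFlag p) = false ∧ SlotShows p (p + 3) (Y α evenFlag) (Y α oddFlag) w (Y α)
      ((Code.machine p).snap (rightR w) zeroR α) := by
  induction α using WellFoundedLT.induction with
  | ind α ih =>
  have ih' : ∀ β < α, Y β (haltFlag p) = false := fun β hβ =>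
    (ih β hβ (hβ.le.trans hα) fun γ hγ => hh γ (hγ.trans hβ)).1
  refine ⟨?_, ?_⟩
  · rcases Ordinal.zero_or_succ_or_isSuccLimit α with rfl | ⟨β, rfl⟩ | hlim
    · rw [h.zero]
      rfl
    · rw [Order.succ_eq_add_one] at *
      have hβ := lt_add_one β
      have hs := (ih β hβ (hβ.le.trans hα) fun γ hγ => hh γ (hγ.trans hβ)).2
      rw [← Bool.not_eq_true, h.haltFlag_succ (hβ.trans_le hα), ih' β hβ]
      rintro (h0 | ⟨n, hn⟩)
      · simp at h0
      · exact hh β hβ (Fin.ext ((hs.headState _ _).mp hn).2.symm)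
    · exact (h.limit α hα hlim).eq_of_forall hlim.bot_lt fun γ _ hγ => ih' γ hγ
  · refine slotShows_of_rules (κ := α) (by rw [h.zero]; rfl) (by rw [h.zero]; rfl) (fun i n => ?_)
      (fun δ hδ => h.flagsAt (hδ.trans_le hα)) (fun δ hδ n k => ?_)
      (fun δ hδ => h.limit δ (hδ.trans hα)) hh α le_rfl
    · rw [h.zero]
      simp [zeroR]
    · rw [h.rule δ (hδ.trans_le hα) _ n k (.inr (.inr (by omega)))]
      simp [simRule, ih' δ hδ]

/-- After halting, the halt flag is set and the output is kept. -/
theorem halted (h : Simulates w Y κ) {p : ℕ} {δ : Ordinal.{0}}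
    (hδ : (Code.machine p).haltsAt (rightR w) zeroR δ) (α : Ordinal.{0}) (hα : α ≤ κ)
    (hle : δ ≤ α) : (Y α (haltFlag p) = true ↔ δ < α) ∧ ∀ n,
      Y α (cell (p + 3) n 2) = ((Code.machine p).snap (rightR w) zeroR δ).tape 2 n := by
  have hs := h.slotShows p δ (hle.trans hα) hδ.2
  induction α using WellFoundedLT.induction with
  | ind α ih =>
  rcases hle.eq_or_lt with rfl | hlt
  · refine ⟨by simp [hs.1], fun n => hs.2.tape 2 n⟩
  rcases Ordinal.zero_or_succ_or_isSuccLimit α with rfl | ⟨β, rfl⟩ | hlim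
  · exact absurd hlt (not_lt.mpr zero_le)
  · rw [Order.succ_eq_add_one] at *
    have hβ := lt_add_one β
    have hδβ : δ ≤ β := Order.lt_add_one_iff.mp hlt
    obtain ⟨h1, h2⟩ := ih β hβ (hβ.le.trans hα) hδβ
    have hκ := hβ.trans_le hα
    simp only [hlt, iff_true]
    have hrule := fun n => h.rule β hκ (p + 3) n 2 (.inr (.inr (by omega)))
    rcases hδβ.eq_or_lt with rfl | hlt'
    · refine ⟨(h.haltFlag_succ hκ p).mpr (.inr ⟨_, (hs.2.headState _ _).mpr ⟨rfl, ?_⟩⟩),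
        fun n => ?_⟩
      · rw [show _ = _ from hδ.1]
        rfl
      · rw [Bool.eq_iff_iff, hrule]
        have h3 := hs.2.rule_tape 2 n
        rw [if_pos (show _ = _ from hδ.1)] at h3
        simpa [simRule, hs.1] using h3
    · refine ⟨(h.haltFlag_succ hκ p).mpr (.inl (h1.mpr hlt')), fun n => ?_⟩
      rw [Bool.eq_iff_iff, hrule, ← h2]
      simp [simRule, h1.mpr hlt']
  · simp only [hlt, iff_true]
    refine ⟨(h.limit α hα hlim).eq_of_forall (hlim.succ_lt hlt) fun γ h1 h2 => ?_,
      fun n => (h.limit α hα hlim).eq_of_forall hlt fun γ h1 h2 => ?_⟩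
    · exact (ih γ h2 (h2.le.trans hα) ((Order.le_succ δ).trans h1)).1.mpr
        ((Order.lt_succ δ).trans_le h1)
    · exact (ih γ h2 (h2.le.trans hα) h1).2 n

theorem haltFlag_eq_true_iff (h : Simulates w Y κ) {p : ℕ} {α : Ordinal.{0}} (hα : α ≤ κ) :
    Y α (haltFlag p) = true ↔ ∃ δ < α, (Code.machine p).haltsAt (rightR w) zeroR δ := by
  constructor
  · intro hH
    by_contra hne
    have hh : ∀ β < α, ¬ (Code.machine p).haltedAt (rightR w) zeroR β := by
      intro β
      induction β using WellFoundedLT.induction with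
      | ind β ih =>
      intro hβ hhalt
      exact hne ⟨β, hβ, hhalt, fun γ hγ => ih γ hγ (hγ.trans hβ)⟩
    rw [(h.slotShows p α hα hh).1] at hH
    simp at hH
  · rintro ⟨δ, hδ, hh⟩
    exact (h.halted hh α hα hδ.le).1.mpr hδ

end Simulates

/-- The rule searching for a machine computing `leftR w` with oracle `rightR w`. -/
def searchRule (w y : R) (c n k u : ℕ) : Bool :=
  bif decide (c = 0) && decide (k = 0) then y (cell 1 u 1) && !y (cell 1 u 2)
  else bif decide (c = 1) && decide (k = 1) then y (haltFlag n)
  else bif decide (c = 1) && decide (k = 2) then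
    y (haltFlag n) && decide (y (cell (n + 3) u 2) ≠ w (2 * u))
  else simRule w y c n k u

section Coordinates

variable {β : Type} [Primcodable β] {f : ℕ → R → R → ℕ × ℕ × ℕ × ℕ → β}

/-- Express a rule in terms of addresses. -/
theorem Loc.of_cells (hf : Loc f) : Loc fun b w y (a : ℕ × ℕ) =>
    f b w y (a.1.unpair.1, a.1.unpair.2.unpair.1, a.1.unpair.2.unpair.2, a.2) := by
  have h1 : Primrec fun a : ℕ × ℕ => a.1.unpair.2 := Code.primrec_unpair_snd Primrec.fst
  exact hf.comp ((Code.primrec_unpair_fst Primrec.fst).pair ((Code.primrec_unpair_fst h1).pair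
    ((Code.primrec_unpair_snd h1).pair Primrec.snd)))

end Coordinates

/-- Every local rule, given in terms of cells, is iterated transfinitely by a core. -/
theorem exists_realizes_of_cells {f : ℕ → R → R → ℕ → ℕ → ℕ → ℕ → Bool}
    (hf : Loc fun b w y (a : ℕ × ℕ × ℕ × ℕ) => f b w y a.1 a.2.1 a.2.2.1 a.2.2.2) :
    ∃ b, ∃ _ : NeZero b, ∃ K : Core, ∃ g, K.Realizes b g ∧ ∀ w,
      (∀ α c n k, flow (g w) (α + 1) (cell c n k) = true ↔
        ∃ u, f b w (flow (g w) α) c n k u = true) ∧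
      ∀ α, Order.IsSuccLimit α → LimsupAt (flow (g w)) α := by
  obtain ⟨b, hb, K, g, hK, h⟩ := exists_realizes_of_loc hf.of_cells
  refine ⟨b, hb, K, g, hK, fun w => ⟨fun α c n k => ?_, (h w).2⟩⟩
  rw [(h w).1]
  simp [cell]

theorem loc_searchRule : Loc fun (_ : ℕ) w y (a : ℕ × ℕ × ℕ × ℕ) =>
    searchRule w y a.1 a.2.1 a.2.2.1 a.2.2.2 := by
  have hc : Primrec fun a : ℕ × ℕ × ℕ × ℕ => a.1 := Primrec.fst
  have hn : Primrec fun a : ℕ × ℕ × ℕ × ℕ => a.2.1 := Primrec.fst.comp Primrec.snd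
  have hk : Primrec fun a : ℕ × ℕ × ℕ × ℕ => a.2.2.1 :=
    Primrec.fst.comp (Primrec.snd.comp Primrec.snd)
  have hu : Primrec fun a : ℕ × ℕ × ℕ × ℕ => a.2.2.2 :=
    Primrec.snd.comp (Primrec.snd.comp Primrec.snd)
  have hH : Loc fun (_ : ℕ) (_ y : R) (a : ℕ × ℕ × ℕ × ℕ) => y (haltFlag a.2.1) :=
    .read (primrec_cell (Primrec.const 1) hn (Primrec.const 0))
  have hr : ∀ i, Loc fun (_ : ℕ) (_ y : R) (a : ℕ × ℕ × ℕ × ℕ) => y (cell 1 a.2.2.2 i) := fun i =>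
    .read (primrec_cell (Primrec.const 1) hu (Primrec.const i))
  have hne : Loc fun (_ : ℕ) (w y : R) (a : ℕ × ℕ × ℕ × ℕ) =>
      decide (y (cell (a.2.1 + 3) a.2.2.2 2) ≠ w (2 * a.2.2.2)) := by
    have := Loc.not (.eq (.read (primrec_cell (Primrec.nat_add.comp hn (Primrec.const 3)) hu
      (Primrec.const 2))) (.readInput (Primrec.nat_mul.comp (Primrec.const 2) hu)))
    simpa only [ne_eq, decide_not] using this
  exact .cond (.and (loc_eq hc (Primrec.const 0)) (loc_eq hk (Primrec.const 0)))
    (.and (hr 1) (.not (hr 2)))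
    (.cond (.and (loc_eq hc (Primrec.const 1)) (loc_eq hk (Primrec.const 1))) hH
      (.cond (.and (loc_eq hc (Primrec.const 1)) (loc_eq hk (Primrec.const 2))) (.and hH hne)
        (loc_simRule hc hn hk hu)))

/-- The search succeeds if and only if `leftR w` is computable from `rightR w`. -/
theorem search_iff {w : R} {Y : Ordinal.{0} → R} (h0 : Y 0 = zeroR)
    (hs : ∀ α c n k, Y (α + 1) (cell c n k) = true ↔ ∃ u, searchRule w (Y α) c n k u = true)
    (hl : ∀ α, Order.IsSuccLimit α → LimsupAt Y α) :
    (∃ α, Y α 0 = true) ↔ ∃ M : OMachine, M.outputs (rightR w) zeroR (leftR w) := by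
  have hsim : ∀ κ, Simulates w Y κ := fun κ => by
    refine ⟨h0, fun α _ c n k hc => ?_, fun α _ => hl α⟩
    rw [hs]
    refine exists_congr fun u => ?_
    have h1 : ¬ (c = 0 ∧ k = 0) := by omega
    have h2 : ¬ (c = 1 ∧ k = 1) := by omega
    have h3 : ¬ (c = 1 ∧ k = 2) := by omega
    simp only [searchRule, ← Bool.decide_and, h1, h2, h3, decide_false, cond_false]
  have hz : ∀ j, ¬ Y 0 j = true := by simp [h0, zeroR]
  have hacc : ∀ α, Y (α + 1) 0 = true ↔ ∃ p, Y α (cell 1 p 1) = true ∧ Y α (cell 1 p 2) = false :=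
    fun α => by
      rw [show (0 : ℕ) = cell 0 0 0 from rfl, hs]
      simp [searchRule]
  have hC : ∀ α p, Y (α + 1) (cell 1 p 1) = true ↔ Y α (haltFlag p) = true := fun α p => by
    simp [hs, searchRule]
  have hD : ∀ α p, Y (α + 1) (cell 1 p 2) = true ↔
      Y α (haltFlag p) = true ∧ ∃ n, Y α (cell (p + 3) n 2) ≠ w (2 * n) := fun α p => by
    simp [hs, searchRule]
  have hCh : ∀ α p, Y α (cell 1 p 1) = true →
      ∃ δ, δ + 1 < α ∧ (Code.machine p).haltsAt (rightR w) zeroR δ := by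
    intro α p
    induction α using WellFoundedLT.induction with
    | ind α ih =>
    intro hα
    rcases Ordinal.zero_or_succ_or_isSuccLimit α with rfl | ⟨β, rfl⟩ | hlim
    · exact absurd hα (hz _)
    · rw [Order.succ_eq_add_one, hC] at *
      obtain ⟨δ, hδ, hh⟩ := ((hsim β).haltFlag_eq_true_iff le_rfl).mp hα
      exact ⟨δ, by simpa using hδ, hh⟩
    · obtain ⟨γ, -, hγ, hγ'⟩ := (hl α hlim _).mp hα 0 hlim.bot_lt
      obtain ⟨δ, hδ, hh⟩ := ih γ hγ hγ'
      exact ⟨δ, hδ.trans hγ, hh⟩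
  have hdead : ∀ p δ n, (Code.machine p).haltsAt (rightR w) zeroR δ →
      ((Code.machine p).snap (rightR w) zeroR δ).tape 2 n ≠ leftR w n →
      ∀ α, δ + 1 < α → Y α (cell 1 p 2) = true := by
    intro p δ n hh hne α
    induction α using WellFoundedLT.induction with
    | ind α ih =>
    intro hα
    rcases Ordinal.zero_or_succ_or_isSuccLimit α with rfl | ⟨β, rfl⟩ | hlim
    · exact absurd hα (not_lt.mpr zero_le)
    · rw [Order.succ_eq_add_one] at *
      have hδ : δ < β := by simpa using hα
      obtain ⟨h1, h2⟩ := (hsim β).halted hh β le_rfl hδ.le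
      rw [hD]
      exact ⟨h1.mpr hδ, n, by rw [h2]; exact hne⟩
    · exact (hl α hlim).eq_of_forall (hlim.succ_lt hα) fun γ h1 h2 =>
        ih γ h2 ((Order.lt_succ _).trans_le h1)
  constructor
  · rintro ⟨α, hα⟩
    induction α using WellFoundedLT.induction with
    | ind α ih =>
    rcases Ordinal.zero_or_succ_or_isSuccLimit α with rfl | ⟨β, rfl⟩ | hlim
    · exact absurd hα (hz _)
    · rw [Order.succ_eq_add_one, hacc] at hα
      obtain ⟨p, hp1, hp2⟩ := hα
      obtain ⟨δ, hδ, hh⟩ := hCh β p hp1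
      refine ⟨Code.machine p, δ, hh, funext fun n => ?_⟩
      by_contra hne
      rw [hdead p δ n hh hne β hδ] at hp2
      simp at hp2
    · obtain ⟨γ, -, hγ, hγ'⟩ := (hl α hlim _).mp hα 0 hlim.bot_lt
      exact ih γ hγ hγ'
  · rintro ⟨M, δ, hh, hout⟩
    obtain ⟨p, rfl⟩ := Code.exists_machine_eq M
    have hlt := lt_add_one δ
    obtain ⟨h1, h2⟩ := (hsim (δ + 1)).halted hh (δ + 1) le_rfl hlt.le
    refine ⟨δ + 1 + 1 + 1, (hacc _).mpr ⟨p, (hC _ _).mpr (h1.mpr hlt), ?_⟩⟩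
    rw [← Bool.not_eq_true, hD]
    rintro ⟨-, n, hn⟩
    rw [h2, hout] at hn
    exact hn rfl

theorem semiDecidable_reducibilityRel : ITTMSemiDecidable (pairCodes reducibilityRel) := by
  obtain ⟨b, hb, K, g, hK, h⟩ := exists_realizes_of_cells (f := fun _ => searchRule) loc_searchRule
  obtain ⟨M, hM⟩ := K.exists_machine
  refine ⟨M, Set.ext fun w => ?_⟩
  obtain ⟨c, hc, hhalt⟩ := hM w
  rw [Set.mem_ofPred_eq, Machine.halts]
  simp only [hhalt]
  rw [hK.halts_iff hc, search_iff flow_zero (h w).1 (h w).2]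
  rfl

/-- The flag recording that the simulation has started. -/
def startedFlag : ℕ := cell 0 0 7

/-- The flag recording a positive answer. -/
def yesFlag : ℕ := cell 0 0 5

/-- The flag recording a negative answer. -/
def noFlag : ℕ := cell 0 0 6

/-- A new question has to be asked. -/
def restart (y : R) : Bool := !y startedFlag || y yesFlag

/-- The diagonal against the outputs of the machines which have halted. -/
def diag (b : ℕ) (y : R) (p : ℕ) : Bool :=
  y (haltFlag p) && !y (cell (p + 3) (b * cell 1 p 3) 2)

/-- The real with bits `d p` in positions `b * cell 1 p 3`, and a set bit `0`. -/
noncomputable def diagReal (b : ℕ) (d : ℕ → Bool) : R :=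
  fun m => decide (m = 0 ∨ ∃ p, m = b * cell 1 p 3 ∧ d p = true)

/-- The rule asking the machine `e` about the diagonal, until it gives a negative answer. -/
def askRule (e b : ℕ) (w y : R) (c n k u : ℕ) : Bool :=
  bif y noFlag then
    bif decide (c = 1) && decide (k = 3) then y (cell 1 n 3)
    else decide (c = 0) && (decide (n = 0) && decide (k = 0))
  else bif decide (c = 2) then
    bif restart y then decide (k = 0) &&
      (decide (n = 0) || decide (n = 2 * (b * cell 1 u 3)) && diag b y u)
    else slotRule e 2 (y (cell 0 0 3)) (y (cell 0 0 4)) w y n k u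
  else bif decide (c = 1) && decide (k = 3) then bif restart y then diag b y n else y (cell 1 n 3)
  else bif decide (c = 0) && decide (k = 0) then false
  else bif decide (c = 0) && decide (k = 3) then
    !restart y && !(y (cell 0 0 3) && !y (cell 0 0 4))
  else bif decide (c = 0) && decide (k = 4) then
    !restart y && (y (cell 0 0 3) && !y (cell 0 0 4))
  else bif decide (c = 0) && decide (k = 5) then !restart y &&
    (headState e 2 (y (cell 0 0 3)) (y (cell 0 0 4)) y u (Code.halt e) && y (cell 2 0 2))
  else bif decide (c = 0) && decide (k = 6) then !restart y &&
    (headState e 2 (y (cell 0 0 3)) (y (cell 0 0 4)) y u (Code.halt e) && !y (cell 2 0 2))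
  else bif decide (c = 0) && decide (k = 7) then true
  else simRule w y c n k u

theorem loc_askRule (e : ℕ) : Loc fun (b : ℕ) w y (a : ℕ × ℕ × ℕ × ℕ) =>
    askRule e b w y a.1 a.2.1 a.2.2.1 a.2.2.2 := by
  have hc : Primrec fun a : ℕ × ℕ × ℕ × ℕ => a.1 := Primrec.fst
  have hn : Primrec fun a : ℕ × ℕ × ℕ × ℕ => a.2.1 := Primrec.fst.comp Primrec.snd
  have hk : Primrec fun a : ℕ × ℕ × ℕ × ℕ => a.2.2.1 :=
    Primrec.fst.comp (Primrec.snd.comp Primrec.snd)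
  have hu : Primrec fun a : ℕ × ℕ × ℕ × ℕ => a.2.2.2 :=
    Primrec.snd.comp (Primrec.snd.comp Primrec.snd)
  have hcd : ∀ i, Loc fun (_ : ℕ) (_ _ : R) (a : ℕ × ℕ × ℕ × ℕ) => decide (a.1 = i) := fun i =>
    loc_eq hc (Primrec.const i)
  have hkd : ∀ i, Loc fun (_ : ℕ) (_ _ : R) (a : ℕ × ℕ × ℕ × ℕ) => decide (a.2.2.1 = i) := fun i =>
    loc_eq hk (Primrec.const i)
  have hn0 := loc_eq hn (Primrec.const 0)
  have hr : ∀ i, Loc fun (_ : ℕ) (_ y : R) (_ : ℕ × ℕ × ℕ × ℕ) => y i := fun i =>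
    .read (Primrec.const i)
  have hrs : Loc fun (_ : ℕ) (_ y : R) (_ : ℕ × ℕ × ℕ × ℕ) => restart y :=
    .or (.not (hr _)) (hr _)
  have hdc : Loc fun (_ : ℕ) (_ y : R) (a : ℕ × ℕ × ℕ × ℕ) => y (cell 1 a.2.1 3) :=
    .read (primrec_cell (Primrec.const 1) hn (Primrec.const 3))
  have hdiag : ∀ {f : ℕ × ℕ × ℕ × ℕ → ℕ}, Primrec f → Loc fun b _ y a => diag b y (f a) := by
    intro f hf
    refine .and (.read (primrec_cell (Primrec.const 1) hf (Primrec.const 0))) (.not (.readAt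
      (f := fun x => cell (f x.2 + 3) (x.1 * cell 1 (f x.2) 3) 2) (primrec_cell ?_ ?_ ?_)))
    · exact Primrec.nat_add.comp (hf.comp Primrec.snd) (Primrec.const 3)
    · exact Primrec.nat_mul.comp Primrec.fst (primrec_cell (Primrec.const 1)
        (hf.comp Primrec.snd) (Primrec.const 3))
    · exact Primrec.const 2
  have hpos : Loc fun (b : ℕ) (_ _ : R) (a : ℕ × ℕ × ℕ × ℕ) =>
      decide (a.2.1 = 2 * (b * cell 1 a.2.2.2 3)) :=
    .eq (.of_primrec hn) (.map₂ Primrec.nat_mul (.of_primrec (Primrec.const 2))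
      (.map₂ Primrec.nat_mul .param (.of_primrec (primrec_cell (Primrec.const 1) hu
        (Primrec.const 3)))))
  have hhead := loc_headState (Primrec.const e) (Primrec.const 2) hu
    (Primrec.const (Code.halt e)) (cell 0 0 3) (cell 0 0 4)
  have hodd := Loc.and (hr (cell 0 0 3)) (.not (hr (cell 0 0 4)))
  exact .cond (hr _) (.cond (.and (hcd 1) (hkd 3)) hdc (.and (hcd 0) (.and hn0 (hkd 0))))
    (.cond (hcd 2) (.cond hrs (.and (hkd 0) (.or hn0 (.and hpos (hdiag hu))))
      (loc_slotRule (Primrec.const e) (Primrec.const 2) hn hk hu _ _))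
    (.cond (.and (hcd 1) (hkd 3)) (.cond hrs (hdiag hn) hdc)
    (.cond (.and (hcd 0) (hkd 0)) (.of_primrec (Primrec.const false))
    (.cond (.and (hcd 0) (hkd 3)) (.and (.not hrs) (.not hodd))
    (.cond (.and (hcd 0) (hkd 4)) (.and (.not hrs) hodd)
    (.cond (.and (hcd 0) (hkd 5)) (.and (.not hrs) (.and hhead (hr _)))
    (.cond (.and (hcd 0) (hkd 6)) (.and (.not hrs) (.and hhead (.not (hr _))))
    (.cond (.and (hcd 0) (hkd 7)) (.of_primrec (Primrec.const true))
      (loc_simRule hc hn hk hu)))))))))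

/-- The sequence `Y` follows `askRule`. -/
structure Asks (e b : ℕ) (w : R) (Y : Ordinal.{0} → R) : Prop where
  zero : Y 0 = zeroR
  rule : ∀ α c n k, Y (α + 1) (cell c n k) = true ↔ ∃ u, askRule e b w (Y α) c n k u = true
  limit : ∀ α, Order.IsSuccLimit α → LimsupAt Y α

namespace Asks

variable {e b : ℕ} {w : R} {Y : Ordinal.{0} → R} {α : Ordinal.{0}}

theorem simulates (h : Asks e b w Y) (hα : ∀ β < α, Y β noFlag = false) : Simulates w Y α := by
  refine ⟨h.zero, fun β hβ c n k hc => ?_, fun β _ => h.limit β⟩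
  rw [h.rule]
  refine exists_congr fun u => ?_
  have h1 : ¬ c = 2 := by omega
  have h2 : ¬ (c = 1 ∧ k = 3) := by omega
  have h3 : ∀ i, i = 0 ∨ 3 ≤ i → ¬ (c = 0 ∧ k = i) := by omega
  simp only [askRule, hα β hβ, ← Bool.decide_and, h1, h2, h3 0, h3 3, h3 4, h3 5, h3 6, h3 7,
    decide_false, cond_false, le_refl, true_or, or_true, Nat.reduceLeDiff]

theorem accept (h : Asks e b w Y) (hα : Y α noFlag = false) : Y (α + 1) 0 = false := by
  rw [← Bool.not_eq_true, show (0 : ℕ) = cell 0 0 0 from rfl, h.rule]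
  simp [askRule, hα]

theorem started (h : Asks e b w Y) (hα : Y α noFlag = false) : Y (α + 1) startedFlag = true := by
  rw [startedFlag, h.rule]
  simp [askRule, hα]

theorem yes (h : Asks e b w Y) (hα : Y α noFlag = false) : Y (α + 1) yesFlag = true ↔
    restart (Y α) = false ∧ (∃ n, headState e 2 (Y α (cell 0 0 3)) (Y α (cell 0 0 4)) (Y α) n
      (Code.halt e) = true) ∧ Y α (cell 2 0 2) = true := by
  rw [yesFlag, h.rule]
  simp [askRule, hα]

theorem no (h : Asks e b w Y) (hα : Y α noFlag = false) : Y (α + 1) noFlag = true ↔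
    restart (Y α) = false ∧ (∃ n, headState e 2 (Y α (cell 0 0 3)) (Y α (cell 0 0 4)) (Y α) n
      (Code.halt e) = true) ∧ Y α (cell 2 0 2) = false := by
  rw [show Y (α + 1) noFlag = Y (α + 1) (cell 0 0 6) from rfl, h.rule]
  simp [askRule, hα]

theorem diag (h : Asks e b w Y) (hα : Y α noFlag = false) (p : ℕ) : Y (α + 1) (cell 1 p 3) =
    bif restart (Y α) then ITTM.diag b (Y α) p else Y α (cell 1 p 3) := by
  rw [Bool.eq_iff_iff, h.rule]
  simp [askRule, hα]

theorem flags_restart (h : Asks e b w Y) (hα : Y α noFlag = false) (hr : restart (Y α) = true) :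
    Y (α + 1) (cell 0 0 3) = false ∧ Y (α + 1) (cell 0 0 4) = false := by
  simp only [← Bool.not_eq_true, h.rule]
  simp [askRule, hα, hr]

theorem flagsAt (h : Asks e b w Y) (hα : Y α noFlag = false) (hr : restart (Y α) = false) :
    FlagsAt Y (cell 0 0 3) (cell 0 0 4) α := by
  constructor <;> rw [Bool.eq_iff_iff, h.rule] <;> simp [askRule, hα, hr]

theorem slot_restart (h : Asks e b w Y) (hα : Y α noFlag = false) (hr : restart (Y α) = true)
    (i : Fin 3) (n : ℕ) : Y (α + 1) (cell 2 n i) =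
      if i = 0 then pairR (diagReal b (ITTM.diag b (Y α))) zeroR n else false := by
  rw [Bool.eq_iff_iff, h.rule]
  by_cases hi : i = 0
  · subst hi
    simp only [askRule, hα, hr, Fin.val_zero, decide_true, cond_true, cond_false, Bool.true_and,
      if_true, Bool.or_eq_true, Bool.and_eq_true, decide_eq_true_eq, pairR, diagReal, zeroR]
    rcases Nat.even_or_odd' n with ⟨m, rfl | rfl⟩
    · simp [exists_or]
    · have h1 : (2 * m + 1) % 2 ≠ 0 := by omega
      rw [if_neg h1]
      simp only [Bool.false_eq_true, iff_false, not_exists]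
      intro u
      omega
  · have : (i : ℕ) ≠ 0 := fun e => hi (Fin.ext e)
    simp [askRule, hα, hr, hi, this]

theorem slot (h : Asks e b w Y) (hα : Y α noFlag = false) (hr : restart (Y α) = false)
    (n k : ℕ) : Y (α + 1) (cell 2 n k) = true ↔
      ∃ u, slotRule e 2 (Y α (cell 0 0 3)) (Y α (cell 0 0 4)) w (Y α) n k u = true := by
  rw [h.rule]
  simp [askRule, hα, hr]

/-- After a negative answer, the diagonal is output. -/
theorem spread_eq [NeZero b] (h : Asks e b w Y) (hα : Y α noFlag = true) :
    spread b (Y (α + 1)) = diagReal b fun p => Y α (cell 1 p 3) := by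
  have hb : 0 < b := Nat.pos_of_ne_zero (NeZero.ne b)
  funext m
  rw [spread_apply, Bool.eq_iff_iff, diagReal, decide_eq_true_eq]
  have key : ∀ j, Y (α + 1) j = true ↔ j = 0 ∨ ∃ p, j = cell 1 p 3 ∧ Y α (cell 1 p 3) = true := by
    intro j
    obtain ⟨c, n, k, rfl⟩ := exists_cell_eq j
    rw [h.rule, show (0 : ℕ) = cell 0 0 0 from rfl]
    simp only [askRule, hα, cond_true, exists_const, cell_inj]
    by_cases hck : c = 1 ∧ k = 3
    · obtain ⟨rfl, rfl⟩ := hck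
      simp
    · rw [← Bool.decide_and, decide_eq_false hck]
      simp only [cond_false, Bool.and_eq_true, decide_eq_true_eq]
      refine ⟨fun hc => .inl hc, ?_⟩
      rintro (hc | ⟨p, ⟨h1, -, h2⟩, -⟩)
      · exact hc
      · exact absurd ⟨h1, h2⟩ hck
  split_ifs with hm
  · have hm' : m = b * (m / b) := (Nat.mul_div_cancel' (Nat.dvd_of_mod_eq_zero hm)).symm
    rw [key]
    refine or_congr ?_ (exists_congr fun p => and_congr_left fun _ => ?_)
    · constructor
      · intro h0
        rw [hm', h0, mul_zero]
      · rintro rfl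
        simp
    · constructor
      · intro h0
        rw [hm', h0]
      · rintro rfl
        rw [Nat.mul_div_cancel_left _ hb]
  · simp only [false_iff, not_or, not_exists, not_and]
    refine ⟨?_, ?_⟩
    · rintro rfl
      simp at hm
    · rintro p rfl
      simp at hm

end Asks

theorem LimsupAt.shift {Y : Ordinal.{0} → R} {β δ : Ordinal.{0}} (hδ : 0 < δ)
    (h : LimsupAt Y (β + δ)) : LimsupAt (fun ε => Y (β + ε)) δ := by
  intro j
  simp only [h j]
  constructor
  · intro H ε hε
    obtain ⟨γ, h1, h2, h3⟩ := H (β + ε) (by simpa using hε)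
    obtain ⟨ζ, rfl⟩ := exists_add_of_le (le_self_add.trans h1)
    exact ⟨ζ, by simpa using h1, by simpa using h2, h3⟩
  · intro H γ hγ
    rcases le_total β γ with hβ | hβ
    · obtain ⟨ζ, rfl⟩ := exists_add_of_le hβ
      obtain ⟨ε, h1, h2, h3⟩ := H ζ (by simpa using hγ)
      exact ⟨β + ε, by simpa using h1, by simpa using h2, h3⟩
    · obtain ⟨ε, -, h2, h3⟩ := H 0 hδ
      exact ⟨β + ε, hβ.trans le_self_add, by simpa using h2, h3⟩

namespace Asks

variable {e b : ℕ} {w : R} {Y : Ordinal.{0} → R} {β δ : Ordinal.{0}}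

/-- At stage `α` no answer has been given to the question about `d`. -/
structure Waits (b : ℕ) (Y : Ordinal.{0} → R) (d : ℕ → Bool) (α : Ordinal.{0}) : Prop where
  yes : Y α yesFlag = false
  no : Y α noFlag = false
  started : Y α startedFlag = true
  diag : ∀ p, Y α (cell 1 p 3) = d p

theorem Waits.restart {d : ℕ → Bool} {α : Ordinal.{0}} (h : Waits b Y d α) :
    ITTM.restart (Y α) = false := by
  simp [ITTM.restart, h.yes, h.started]

/-- After a restart, the machine `e` is simulated until it halts. -/
theorem waits (h : Asks e b w Y) (hn : Y β noFlag = false) (hr : restart (Y β) = true)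
    (hδ : ∀ ε < δ, ¬ (Code.machine e).haltedAt (rightR w)
      (pairR (diagReal b (ITTM.diag b (Y β))) zeroR) ε) (ε : Ordinal.{0}) (hε : ε ≤ δ) :
    Waits b Y (ITTM.diag b (Y β)) (β + 1 + ε) ∧
      SlotShows e 2 (Y (β + 1 + ε) (cell 0 0 3)) (Y (β + 1 + ε) (cell 0 0 4)) w (Y (β + 1 + ε))
        ((Code.machine e).snap (rightR w) (pairR (diagReal b (ITTM.diag b (Y β))) zeroR) ε) := by
  induction ε using WellFoundedLT.induction with
  | ind ε ih =>
  have ih' := fun ζ (hζ : ζ < ε) => ih ζ hζ (hζ.le.trans hε)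
  refine ⟨?_, ?_⟩
  · rcases Ordinal.zero_or_succ_or_isSuccLimit ε with rfl | ⟨ζ, rfl⟩ | hlim
    · rw [add_zero]
      refine ⟨?_, ?_, h.started hn, fun p => by rw [h.diag hn, hr, cond_true]⟩
      · rw [← Bool.not_eq_true, h.yes hn]
        simp [hr]
      · rw [← Bool.not_eq_true, h.no hn]
        simp [hr]
    · rw [Order.succ_eq_add_one] at *
      have hζ := lt_add_one ζ
      obtain ⟨hw, hs⟩ := ih' ζ hζ
      have hhalt : ¬ ∃ n, headState e 2 (Y (β + 1 + ζ) (cell 0 0 3)) (Y (β + 1 + ζ) (cell 0 0 4))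
          (Y (β + 1 + ζ)) n (Code.halt e) = true := by
        rintro ⟨n, hn⟩
        exact hδ ζ (hζ.trans_le hε) (Fin.ext ((hs.headState _ _).mp hn).2.symm)
      rw [← add_assoc]
      refine ⟨?_, ?_, h.started hw.no, fun p => by
        rw [h.diag hw.no, hw.restart, cond_false, hw.diag]⟩
      · rw [← Bool.not_eq_true, h.yes hw.no]
        exact fun hc => hhalt hc.2.1
      · rw [← Bool.not_eq_true, h.no hw.no]
        exact fun hc => hhalt hc.2.1
    · have hl := (h.limit _ (Ordinal.isSuccLimit_add (β + 1) hlim)).shift hlim.bot_lt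
      exact ⟨hl.eq_of_forall hlim.bot_lt fun γ _ hγ => (ih' γ hγ).1.yes,
        hl.eq_of_forall hlim.bot_lt fun γ _ hγ => (ih' γ hγ).1.no,
        hl.eq_of_forall hlim.bot_lt fun γ _ hγ => (ih' γ hγ).1.started,
        fun p => hl.eq_of_forall hlim.bot_lt fun γ _ hγ => (ih' γ hγ).1.diag p⟩
  · have hf := h.flags_restart hn hr
    refine slotShows_of_rules (Z := fun ζ => Y (β + 1 + ζ)) (κ := ε) (f₁ := cell 0 0 3)
      (f₂ := cell 0 0 4) (by simpa using hf.1) (by simpa using hf.2) (fun i n => ?_)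
      (fun ζ hζ => ?_) (fun ζ hζ n k => ?_)
      (fun ζ _ hlim => (h.limit _ (Ordinal.isSuccLimit_add (β + 1) hlim)).shift hlim.bot_lt)
      (fun ζ hζ => hδ ζ (hζ.trans_le hε)) ε le_rfl
    · rw [add_zero, h.slot_restart hn hr]
    · have hw := (ih' ζ hζ).1
      have := h.flagsAt hw.no hw.restart
      rw [FlagsAt, add_assoc] at this
      exact this
    · have hw := (ih' ζ hζ).1
      have := h.slot hw.no hw.restart n k
      rw [add_assoc] at this
      exact this

/-- The answer to a question. -/
theorem answer (h : Asks e b w Y) (hn : Y β noFlag = false) (hr : restart (Y β) = true)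
    (hδ : (Code.machine e).haltsAt (rightR w)
      (pairR (diagReal b (ITTM.diag b (Y β))) zeroR) δ) :
    Y (β + 1 + δ + 1) yesFlag = ((Code.machine e).snap (rightR w)
      (pairR (diagReal b (ITTM.diag b (Y β))) zeroR) δ).tape 2 0 ∧
    Y (β + 1 + δ + 1) noFlag = !((Code.machine e).snap (rightR w)
      (pairR (diagReal b (ITTM.diag b (Y β))) zeroR) δ).tape 2 0 ∧
    ∀ p, Y (β + 1 + δ + 1) (cell 1 p 3) = ITTM.diag b (Y β) p := by
  obtain ⟨hw, hs⟩ := h.waits hn hr hδ.2 δ le_rfl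
  have hhalt : ∃ n, headState e 2 (Y (β + 1 + δ) (cell 0 0 3)) (Y (β + 1 + δ) (cell 0 0 4))
      (Y (β + 1 + δ)) n (Code.halt e) = true := by
    refine ⟨_, (hs.headState _ _).mpr ⟨rfl, ?_⟩⟩
    rw [show _ = _ from hδ.1]
    rfl
  have ht := hs.tape 2 0
  refine ⟨?_, ?_, fun p => by rw [h.diag hw.no, hw.restart, cond_false, hw.diag]⟩
  · rw [Bool.eq_iff_iff, h.yes hw.no]
    simp only [hw.restart, hhalt, true_and]
    exact ht ▸ Iff.rfl
  · rw [Bool.eq_iff_iff, h.no hw.no]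
    simp only [hw.restart, hhalt, true_and, Bool.not_eq_true']
    exact ht ▸ Iff.rfl

/-- A stage at which a question is asked, all earlier answers being positive. -/
def Good (Y : Ordinal.{0} → R) (β : Ordinal.{0}) : Prop :=
  restart (Y β) = true ∧ ∀ γ ≤ β, Y γ noFlag = false

theorem Good.no_eq_false (h : Asks e b w Y) (hβ : Good Y β)
    (hδ : (Code.machine e).haltsAt (rightR w)
      (pairR (diagReal b (ITTM.diag b (Y β))) zeroR) δ) {γ : Ordinal.{0}}
    (hγ : γ ≤ β + 1 + δ) : Y γ noFlag = false := by
  rcases le_or_gt γ β with h1 | h1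
  · exact hβ.2 γ h1
  · obtain ⟨ε, rfl⟩ := exists_add_of_le (Order.add_one_le_iff.mpr h1)
    exact (h.waits (hβ.2 β le_rfl) hβ.1 hδ.2 ε (by simpa using hγ)).1.no

theorem exists_good_ge (h : Asks e b w Y)
    (hyes : ∀ β, Good Y β → ∃ δ, (Code.machine e).haltsAt (rightR w)
      (pairR (diagReal b (ITTM.diag b (Y β))) zeroR) δ ∧ ((Code.machine e).snap (rightR w)
      (pairR (diagReal b (ITTM.diag b (Y β))) zeroR) δ).tape 2 0 = true) (α : Ordinal.{0}) :
    ∃ β, α ≤ β ∧ Good Y β := by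
  have hnext : ∀ β, Good Y β → ∃ γ, β < γ ∧ Good Y γ ∧ Y γ yesFlag = true := by
    intro β hβ
    obtain ⟨δ, hδ, hout⟩ := hyes β hβ
    obtain ⟨h1, h2, -⟩ := h.answer (hβ.2 β le_rfl) hβ.1 hδ
    rw [hout] at h1 h2
    refine ⟨β + 1 + δ + 1, ?_, ⟨by simp [restart, h1], fun γ hγ => ?_⟩, h1⟩
    · exact (lt_add_one β).trans_le (le_self_add.trans le_self_add)
    · rcases hγ.eq_or_lt with rfl | hlt
      · exact h2
      · exact Good.no_eq_false h hβ hδ (Order.lt_add_one_iff.mp hlt)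
  induction α using WellFoundedLT.induction with
  | ind α ih =>
  rcases Ordinal.zero_or_succ_or_isSuccLimit α with rfl | ⟨ζ, rfl⟩ | hlim
  · refine ⟨0, le_rfl, by simp [restart, h.zero, zeroR], fun γ hγ => ?_⟩
    rw [nonpos_iff_eq_zero.mp hγ, h.zero]
    rfl
  · obtain ⟨β, hβ, hg⟩ := ih ζ (Order.lt_succ ζ)
    obtain ⟨γ, hγ, hg', -⟩ := hnext β hg
    exact ⟨γ, Order.succ_le_of_lt (hβ.trans_lt hγ), hg'⟩
  · by_contra hne
    have hlt : ∀ β, Good Y β → β < α := fun β hg => not_le.mp fun hc => hne ⟨β, hc, hg⟩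
    have hno : ∀ γ < α, Y γ noFlag = false := fun γ hγ => by
      obtain ⟨β, hβ, hg⟩ := ih γ hγ
      exact hg.2 γ hβ
    refine hne ⟨α, le_rfl, ?_, fun γ hγ => ?_⟩
    · have : Y α yesFlag = true := (h.limit α hlim _).mpr fun γ hγ => by
        obtain ⟨β, hβ, hg⟩ := ih γ hγ
        obtain ⟨ζ, hζ, hg', hy⟩ := hnext β hg
        exact ⟨ζ, hβ.trans hζ.le, hlt ζ hg', hy⟩
      simp [restart, this]
    · rcases hγ.eq_or_lt with rfl | hγα
      · exact (h.limit γ hlim).eq_of_forall hlim.bot_lt fun ζ _ hζ => hno ζ hζ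
      · exact hno γ hγα

/-- If all halting machines have halted, then the diagonal is not the output of a machine. -/
theorem not_outputs_diagReal [NeZero b] (h : Simulates w Y β)
    (hβ : ∀ p δ, (Code.machine p).haltsAt (rightR w) zeroR δ → δ < β) (M : OMachine) :
    ¬ M.outputs (rightR w) zeroR (diagReal b (ITTM.diag b (Y β))) := by
  rintro ⟨δ, hδ, hout⟩
  obtain ⟨p, rfl⟩ := Code.exists_machine_eq M
  obtain ⟨h1, h2⟩ := h.halted hδ β le_rfl (hβ p δ hδ).le
  have h3 : diagReal b (ITTM.diag b (Y β)) (b * cell 1 p 3) = ITTM.diag b (Y β) p := by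
    have hb := NeZero.ne b
    have hc : cell 1 p 3 ≠ 0 := by
      rw [show (0 : ℕ) = cell 0 0 0 from rfl, Ne, cell_inj]
      simp
    rw [Bool.eq_iff_iff, diagReal, decide_eq_true_eq]
    simp [hb, hc, cell_inj]
  rw [← hout, ← h2, ITTM.diag, h1.mpr (hβ p δ hδ), Bool.true_and] at h3
  simp at h3

theorem exists_forall_lt_of_haltsAt (y : R) : ∃ κ : Ordinal.{0}, ∀ p δ,
    (Code.machine p).haltsAt y zeroR δ → δ < κ := by
  have hex : ∀ p, ∃ κ : Ordinal.{0}, ∀ δ, (Code.machine p).haltsAt y zeroR δ → δ < κ := by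
    intro p
    by_cases hp : ∃ δ, (Code.machine p).haltsAt y zeroR δ
    · obtain ⟨δ, hδ⟩ := hp
      refine ⟨δ + 1, fun ε hε => Order.lt_add_one_iff.mpr (not_lt.mp fun hlt => ?_)⟩
      exact hε.2 δ hlt hδ.1
    · exact ⟨0, fun δ hδ => absurd ⟨δ, hδ⟩ hp⟩
  choose f hf using hex
  exact ⟨⨆ p, f p, fun p δ hδ => (hf p δ hδ).trans_le (Ordinal.le_iSup f p)⟩

theorem exists_spread_eq [NeZero b] (h : Asks e b w Y)
    (he : ∀ x, ∃ δ, (Code.machine e).haltsAt (rightR w) (pairR x zeroR) δ ∧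
      (((Code.machine e).snap (rightR w) (pairR x zeroR) δ).tape 2 0 = true ↔
        ∃ M : OMachine, M.outputs (rightR w) zeroR x)) :
    ∃ x α, (¬ ∃ M : OMachine, M.outputs (rightR w) zeroR x) ∧ (∀ β < α, Y β 0 = false) ∧
      Y α 0 = true ∧ spread b (Y α) = x := by
  have hgood : ∃ β, Good Y β ∧
      ¬ ∃ M : OMachine, M.outputs (rightR w) zeroR (diagReal b (ITTM.diag b (Y β))) := by
    by_contra! hc
    obtain ⟨κ, hκ⟩ := exists_forall_lt_of_haltsAt (rightR w)
    obtain ⟨β, hβ, hg⟩ := h.exists_good_ge (fun β hg => by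
      obtain ⟨δ, hδ, hout⟩ := he (diagReal b (ITTM.diag b (Y β)))
      exact ⟨δ, hδ, hout.mpr (hc β hg)⟩) κ
    obtain ⟨M, hM⟩ := hc β hg
    exact not_outputs_diagReal (h.simulates fun γ hγ => hg.2 γ hγ.le)
      (fun p δ hδ => (hκ p δ hδ).trans_le hβ) M hM
  obtain ⟨β, hg, hout⟩ := hgood
  obtain ⟨δ, hδ, hiff⟩ := he (diagReal b (ITTM.diag b (Y β)))
  obtain ⟨-, h2, h3⟩ := h.answer (hg.2 β le_rfl) hg.1 hδ
  rw [Bool.eq_false_iff.mpr (hiff.not.mpr hout), Bool.not_false] at h2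
  have hacc : ∀ γ ≤ β + 1 + δ + 1, Y γ 0 = false := by
    intro γ
    induction γ using WellFoundedLT.induction with
    | ind γ ih =>
    intro hγ
    rcases Ordinal.zero_or_succ_or_isSuccLimit γ with rfl | ⟨ζ, rfl⟩ | hlim
    · rw [h.zero]
      rfl
    · rw [Order.succ_eq_add_one] at *
      exact h.accept (Good.no_eq_false h hg hδ (by simpa using hγ))
    · exact (h.limit γ hlim).eq_of_forall hlim.bot_lt fun ζ _ hζ => ih ζ hζ (hζ.le.trans hγ)
  refine ⟨_, β + 1 + δ + 1 + 1, hout, fun γ hγ => hacc γ (Order.lt_add_one_iff.mp hγ), ?_, ?_⟩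
  · rw [show (0 : ℕ) = cell 0 0 0 from rfl, h.rule]
    simp [askRule, h2]
  · rw [h.spread_eq h2]
    exact congrArg _ (funext h3)

end Asks

/-- The oracle machine which does not use its oracle. -/
def Machine.toOMachine (M : Machine) : OMachine :=
  ⟨M.Q, M.start, M.limit, M.halt, fun a => M.trans (a.1, fun i => a.2 i.castSucc)⟩

theorem Machine.snap_toOMachine (M : Machine) (y x : R) (α : Ordinal.{0}) :
    (M.toOMachine.snap y x α).state = (M.snap x α).state ∧
    (M.toOMachine.snap y x α).head = (M.snap x α).head ∧
    ∀ i n, (M.toOMachine.snap y x α).tape (Fin.castSucc i) n = (M.snap x α).tape i n := by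
  induction α using WellFoundedLT.induction with
  | ind α ih =>
  rcases Ordinal.zero_or_succ_or_isSuccLimit α with rfl | ⟨β, rfl⟩ | hlim
  · rw [OMachine.snap_zero, Machine.snap_zero]
    refine ⟨rfl, rfl, fun i n => ?_⟩
    fin_cases i <;> rfl
  · rw [Order.succ_eq_add_one] at *
    obtain ⟨h1, h2, h3⟩ := ih β (lt_add_one β)
    have hT : M.toOMachine.trans ((M.toOMachine.snap y x β).state,
        fun i => (M.toOMachine.snap y x β).tape i (M.toOMachine.snap y x β).head) =
        M.trans ((M.snap x β).state, fun i => (M.snap x β).tape i (M.snap x β).head) := by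
      rw [← h1, ← h2]
      simp only [← h3]
      rfl
    rw [OMachine.snap_succ, Machine.snap_succ]
    refine ⟨?_, ?_, fun i n => ?_⟩
    · simp only [OMachine.stepSnap, Machine.stepSnap, hT]
    · simp only [OMachine.stepSnap, Machine.stepSnap, hT]
      simp only [h2]
    · simp only [OMachine.stepSnap, Machine.stepSnap, hT]
      simp [h2, h3]
  · rw [OMachine.snap_limit _ _ _ hlim, Machine.snap_limit _ _ hlim]
    refine ⟨rfl, rfl, fun i n => ?_⟩
    simp only [decide_eq_decide]
    refine forall₂_congr fun β _ => exists_congr fun γ => and_congr_right fun _ => ?_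
    refine and_congr_right fun hγ => ?_
    rw [(ih γ hγ).2.2]

theorem Machine.outputs_toOMachine {M : Machine} {x z : R} (y : R) (h : M.outputs x z) :
    ∃ α, M.toOMachine.haltsAt y x α ∧ (M.toOMachine.snap y x α).tape 2 = z := by
  obtain ⟨α, ⟨h1, h2⟩, h3⟩ := h
  have hiff : ∀ β, M.toOMachine.haltedAt y x β ↔ M.haltedAt x β := fun β => by
    rw [OMachine.haltedAt, Machine.haltedAt, (M.snap_toOMachine y x β).1]
    rfl
  exact ⟨α, ⟨(hiff α).mpr h1, fun β hβ => (hiff β).not.mpr (h2 β hβ)⟩,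
    (funext ((M.snap_toOMachine y x α).2.2 2)).trans h3⟩

theorem leftR_pairR (x y : R) : leftR (pairR x y) = x := by
  funext n
  simp [leftR, pairR]

theorem rightR_pairR (x y : R) : rightR (pairR x y) = y := by
  funext n
  have h1 : (2 * n + 1) % 2 ≠ 0 := by omega
  have h2 : (2 * n + 1) / 2 = n := by omega
  simp only [rightR, pairR, if_neg h1, h2]

theorem not_decidable_reducibilityRel : ¬ ITTMDecidable (pairCodes reducibilityRel) := by
  rintro ⟨D, hD⟩
  obtain ⟨e, he⟩ := Code.exists_machine_eq D.toOMachine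
  obtain ⟨b, hb, K, g, hK, h⟩ := exists_realizes_of_cells (loc_askRule e)
  have hasks : Asks e b zeroR (flow (g zeroR)) := ⟨flow_zero, (h zeroR).1, (h zeroR).2⟩
  obtain ⟨x, α, hx, hα, h1, hs⟩ := hasks.exists_spread_eq fun x => by
    have hmem : pairR x zeroR ∈ pairCodes reducibilityRel ↔
        ∃ M : OMachine, M.outputs (rightR zeroR) zeroR x := by
      rw [pairCodes, Set.mem_ofPred_eq, leftR_pairR, rightR_pairR]
      rfl
    rw [he, ← hmem]
    by_cases hx : pairR x zeroR ∈ pairCodes reducibilityRel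
    · obtain ⟨δ, hδ, hout⟩ := Machine.outputs_toOMachine (rightR zeroR) ((hD _).1 hx)
      exact ⟨δ, hδ, by simp [hout, hx, oneR]⟩
    · obtain ⟨δ, hδ, hout⟩ := Machine.outputs_toOMachine (rightR zeroR) ((hD _).2 hx)
      exact ⟨δ, hδ, by simp [hout, hx, zeroR]⟩
  obtain ⟨U, hU⟩ := K.exists_omachine
  obtain ⟨c, hc, hhalt⟩ := hU zeroR
  obtain ⟨γ, hγ, hlt, ht⟩ := hK.halts hc hα h1
  exact hx ⟨U, γ, ⟨(hhalt γ).1.mpr hγ, fun β hβ => (hhalt β).1.not.mpr (hlt β hβ)⟩,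
    (hhalt γ).2.trans (ht.trans hs)⟩

end ITTM

/-- The infinite time reducibility relation `{(x,y) : x = φ_p^y(0) for some
program p}` is infinite time semi-decidable but not infinite time
decidable. -/
theorem reducibility_semidecidable_not_decidable :
    ITTM.ITTMSemiDecidable (ITTM.pairCodes ITTM.reducibilityRel) ∧
    ¬ ITTM.ITTMDecidable (ITTM.pairCodes ITTM.reducibilityRel) := by
  exact ⟨ITTM.semiDecidable_reducibilityRel, ITTM.not_decidable_reducibilityRel⟩
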